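/- For every integer n ≥ 3, σ(n) < e^γ · n · log(log(n)) + 2.50637·n/log(log(n)). -/

import Mathlib

open Filter Topology Metric

section EntireFunctions

/-- Removing a zero of an entire function. -/
lemma exists_entire_eq_pow_mul {F : ℂ → ℂ} (hF : Differentiable ℂ F) {w : ℂ} (hw : F w ≠ 0)
    (ρ : ℂ) : ∃ g : ℂ → ℂ, Differentiable ℂ g ∧ g ρ ≠ 0 ∧
      ∀ z, F z = (z - ρ) ^ analyticOrderNatAt F ρ * g z := by
  have htop : analyticOrderAt F ρ ≠ ⊤ := by
    intro h
    rw [AnalyticOnNhd.analyticOrderAt_eq_top_iff_eq_zero ρ (fun z => hF.analyticAt z)] at h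
    exact hw (by simp [h])
  obtain ⟨g, hg, hgρ, hgF⟩ := (hF.analyticAt ρ).analyticOrderAt_ne_top.mp htop
  set m := analyticOrderNatAt F ρ
  refine ⟨fun z => if z = ρ then g ρ else F z / (z - ρ) ^ m, ?_, by simpa using hgρ, ?_⟩
  · intro z
    by_cases hz : z = ρ
    · subst hz
      refine hg.differentiableAt.congr_of_eventuallyEq ?_
      filter_upwards [hgF] with x hx
      by_cases hxz : x = z
      · simp [hxz]
      · have : (x - z) ^ m ≠ 0 := pow_ne_zero _ (sub_ne_zero.mpr hxz)
        simp only [hxz, if_false, hx, smul_eq_mul]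
        field_simp
    · have hd : DifferentiableAt ℂ (fun z => F z / (z - ρ) ^ m) z := by
        refine (hF z).div (by fun_prop) (pow_ne_zero _ (sub_ne_zero.mpr hz))
      refine hd.congr_of_eventuallyEq ?_
      filter_upwards [isOpen_ne.mem_nhds hz] with x hx
      rw [if_neg hx]
  · intro z
    by_cases hz : z = ρ
    · subst hz
      simpa using hgF.self_of_nhds
    · have : (z - ρ) ^ m ≠ 0 := pow_ne_zero _ (sub_ne_zero.mpr hz)
      simp only [hz, if_false]
      field_simp

lemma exists_entire_eq_prod_mul {F : ℂ → ℂ} (hF : Differentiable ℂ F) {w : ℂ} (hw : F w ≠ 0)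
    (Z : Finset ℂ) : ∃ g : ℂ → ℂ, Differentiable ℂ g ∧ (∀ ρ ∈ Z, g ρ ≠ 0) ∧
      ∀ z, F z = (∏ ρ ∈ Z, (z - ρ) ^ analyticOrderNatAt F ρ) * g z := by
  classical
  induction Z using Finset.induction_on with
  | empty => exact ⟨F, hF, by simp, by simp⟩
  | insert a Z ha ih =>
    obtain ⟨g, hg, hgZ, hgF⟩ := ih
    have hgw : g w ≠ 0 := fun h => hw (by rw [hgF w, h, mul_zero])
    obtain ⟨k, hk, hka, hkg⟩ := exists_entire_eq_pow_mul hg hgw a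
    have hP : AnalyticAt ℂ (fun z => ∏ ρ ∈ Z, (z - ρ) ^ analyticOrderNatAt F ρ) a := by
      apply Differentiable.analyticAt
      fun_prop
    have hP0 : (fun z => ∏ ρ ∈ Z, (z - ρ) ^ analyticOrderNatAt F ρ) a ≠ 0 := by
      refine Finset.prod_ne_zero_iff.mpr fun ρ hρ => pow_ne_zero _ (sub_ne_zero.mpr ?_)
      rintro rfl
      exact ha hρ
    have hord : analyticOrderNatAt F a = analyticOrderNatAt g a := by
      have : F = (fun z => ∏ ρ ∈ Z, (z - ρ) ^ analyticOrderNatAt F ρ) * g := funext hgF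
      unfold analyticOrderNatAt
      conv_lhs => rw [this]
      rw [analyticOrderAt_mul hP (hg.analyticAt a), hP.analyticOrderAt_eq_zero.mpr hP0, zero_add]
    refine ⟨k, hk, ?_, ?_⟩
    · intro ρ hρ
      rcases Finset.mem_insert.mp hρ with rfl | hρ
      · exact hka
      · intro h
        exact hgZ ρ hρ (by rw [hkg, h, mul_zero])
    · intro z
      rw [Finset.prod_insert ha, hgF z, hkg z, hord]
      ring

lemma finite_zeros_inter_closedBall {F : ℂ → ℂ} (hF : Differentiable ℂ F) {w : ℂ}
    (hw : F w ≠ 0) (R : ℝ) : {ρ : ℂ | F ρ = 0 ∧ ‖ρ‖ ≤ R}.Finite := by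
  have h := AnalyticOnNhd.preimage_zero_mem_codiscrete
    (f := F) (fun z _ => hF.analyticAt z) (x := w) hw
  have h' := mem_codiscrete'.mp h
  have hc : (F ⁻¹' {0}ᶜ)ᶜ = F ⁻¹' {0} := by ext; simp
  rw [hc] at h'
  have hfin := ((isCompact_closedBall (0 : ℂ) R).inter_right (s := closedBall (0 : ℂ) R)
    (t := F ⁻¹' {0}) (isClosed_singleton.preimage hF.continuous)).finite
      (h'.2.mono Set.inter_subset_right)
  refine hfin.subset ?_
  rintro ρ ⟨h1, h2⟩
  exact ⟨by simpa using h2, h1⟩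

/-- The zeros of `F` of norm at most `R`. -/
noncomputable def zerosUpTo (F : ℂ → ℂ) (R : ℝ) : Finset ℂ :=
  open Classical in
  if h : {ρ : ℂ | F ρ = 0 ∧ ‖ρ‖ ≤ R}.Finite then h.toFinset else ∅

lemma mem_zerosUpTo {F : ℂ → ℂ} (hF : Differentiable ℂ F) {w : ℂ} (hw : F w ≠ 0) {R : ℝ}
    {ρ : ℂ} : ρ ∈ zerosUpTo F R ↔ F ρ = 0 ∧ ‖ρ‖ ≤ R := by
  rw [zerosUpTo, dif_pos (finite_zeros_inter_closedBall hF hw R)]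
  simp

/-- A quantitative estimate for the second derivative of the logarithm of a nonvanishing
function. -/
lemma norm_logDeriv_sub_le {G : ℂ → ℂ} (hG : Differentiable ℂ G) {R M : ℝ} (hR : 0 < R)
    (hM : 0 < M) (hG0 : ∀ z ∈ ball (0 : ℂ) R, G z ≠ 0)
    (hGM : ∀ z ∈ ball (0 : ℂ) R, ‖G z‖ ≤ ‖G 0‖ * Real.exp M) {s s' : ℂ}
    (hs : ‖s‖ < R / 8) (hs' : ‖s'‖ < R / 8) :
    ‖logDeriv G s - logDeriv G s'‖ ≤ 64 * M / R ^ 2 * ‖s - s'‖ := by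
  have hdL : DifferentiableOn ℂ (logDeriv G) (ball 0 R) := by
    intro z hz
    exact ((hG.deriv z).div (hG z) (hG0 z hz)).differentiableWithinAt
  obtain ⟨L, hL0, hL⟩ := (hdL.isExactOn_ball).with_val_at 0 0
  have hexp : ∀ z ∈ ball (0 : ℂ) R, G z = G 0 * Complex.exp (L z) := by
    have hconst : ∀ z ∈ ball (0 : ℂ) R, HasDerivAt (fun z => G z * Complex.exp (-L z)) 0 z := by
      intro z hz
      have := (hG z).hasDerivAt.mul (hL z hz).neg.cexp
      refine this.congr_deriv ?_
      rw [logDeriv_apply]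
      field_simp [hG0 z hz]
      ring
    intro z hz
    have := (convex_ball (0 : ℂ) R).is_const_of_fderivWithin_eq_zero (𝕜 := ℂ)
      (f := fun z => G z * Complex.exp (-L z))
      (fun z hz => (hconst z hz).differentiableAt.differentiableWithinAt) (fun z hz => by
        rw [fderivWithin_of_isOpen isOpen_ball hz]
        ext
        simp [(hconst z hz).deriv]) hz (mem_ball_self hR)
    simp only [hL0, neg_zero, Complex.exp_zero, mul_one] at this
    rw [← this, mul_assoc, ← Complex.exp_add]
    simp
  have hre : ∀ z ∈ ball (0 : ℂ) R, (L z).re ≤ M := by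
    intro z hz
    have h1 := hGM z hz
    rw [hexp z hz, norm_mul, Complex.norm_exp] at h1
    have h2 := le_of_mul_le_mul_left h1 (norm_pos_iff.mpr (hG0 0 (mem_ball_self hR)))
    exact Real.exp_le_exp.mp h2
  have hLd : DifferentiableOn ℂ L (ball 0 R) := fun z hz =>
    (hL z hz).differentiableAt.differentiableWithinAt
  have hb1 : ∀ z : ℂ, ‖z‖ ≤ R / 2 → ‖L z‖ ≤ 2 * M := by
    intro z hz
    refine (Complex.borelCaratheodory_zero hM hLd hre hR (by simp; linarith) hL0).trans ?_
    rw [div_le_iff₀ (by linarith)]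
    nlinarith [norm_nonneg z]
  have hb2 : ∀ z : ℂ, ‖z‖ ≤ R / 4 → ‖logDeriv G z‖ ≤ 8 * M / R := by
    intro z hz
    have hzR : z ∈ ball (0 : ℂ) R := by simp; linarith
    have hsub : closedBall z (R / 4) ⊆ ball 0 R := by
      intro y hy
      simp only [mem_closedBall, dist_eq_norm, mem_ball_zero_iff] at hy ⊢
      linarith [norm_sub_norm_le y z]
    have := Complex.norm_deriv_le_of_forall_mem_sphere_norm_le (f := L) (c := z) (R := R / 4)
      (C := 2 * M) (by linarith) (by
        apply DifferentiableOn.diffContOnCl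
        rw [closure_ball _ (by linarith)]
        exact hLd.mono hsub) (fun y hy => by
        apply hb1
        simp only [mem_sphere, dist_eq_norm] at hy
        linarith [norm_sub_norm_le y z])
    rw [(hL z hzR).deriv] at this
    refine this.trans (le_of_eq ?_)
    field_simp
    norm_num
  have hb3 : ∀ z ∈ ball (0 : ℂ) (R / 8), ‖deriv (logDeriv G) z‖ ≤ 64 * M / R ^ 2 := by
    intro z hz
    rw [mem_ball_zero_iff] at hz
    have hsub : closedBall z (R / 8) ⊆ ball 0 R := by
      intro y hy
      simp only [mem_closedBall, dist_eq_norm, mem_ball_zero_iff] at hy ⊢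
      linarith [norm_sub_norm_le y z]
    have := Complex.norm_deriv_le_of_forall_mem_sphere_norm_le (f := logDeriv G) (c := z)
      (R := R / 8) (C := 8 * M / R) (by linarith) (by
        apply DifferentiableOn.diffContOnCl
        rw [closure_ball _ (by linarith)]
        exact hdL.mono hsub) (fun y hy => by
        apply hb2
        simp only [mem_sphere, dist_eq_norm] at hy
        linarith [norm_sub_norm_le y z])
    refine this.trans (le_of_eq ?_)
    field_simp
    norm_num
  refine (convex_ball (0 : ℂ) (R / 8)).norm_image_sub_le_of_norm_deriv_le (𝕜 := ℂ)
    (f := logDeriv G) ?_ hb3 (by simpa using hs') (by simpa using hs)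
  intro z hz
  rw [mem_ball_zero_iff] at hz
  exact (hdL z (by simp; linarith)).differentiableAt (isOpen_ball.mem_nhds (by simp; linarith))

lemma logDeriv_sub_pow {ρ s : ℂ} (m : ℕ) :
    logDeriv (fun z : ℂ => (z - ρ) ^ m) s = m * (s - ρ)⁻¹ := by
  rw [logDeriv_fun_pow (by fun_prop), logDeriv_apply]
  simp

/-- The partial fraction expansion of the logarithmic derivative of an entire function of order
at most `3/2`. -/
theorem tendsto_sum_zerosUpTo {F : ℂ → ℂ} (hF : Differentiable ℂ F) (h0 : F 0 ≠ 0) {C : ℝ}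
    (hC : 0 < C) (hFC : ∀ z, ‖F z‖ ≤ Real.exp (C * (1 + ‖z‖) ^ (3 / 2 : ℝ))) {s s' : ℂ}
    (hs : F s ≠ 0) (hs' : F s' ≠ 0) :
    Tendsto (fun R : ℝ => ∑ ρ ∈ zerosUpTo F R,
        (analyticOrderNatAt F ρ : ℂ) * ((s - ρ)⁻¹ - (s' - ρ)⁻¹)) atTop
      (𝓝 (logDeriv F s - logDeriv F s')) := by
  set B : ℝ := |Real.log ‖F 0‖|
  have hlim : Tendsto (fun R : ℝ => 64 * (C * (1 + 3 * R) ^ (3 / 2 : ℝ) + B) / R ^ 2 * ‖s - s'‖)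
      atTop (𝓝 0) := by
    have h1 : Tendsto (fun R : ℝ => R ^ (-(1 / 2) : ℝ)) atTop (𝓝 0) :=
      tendsto_rpow_neg_atTop (by norm_num)
    have h2 : Tendsto (fun R : ℝ => (R ^ 2)⁻¹) atTop (𝓝 0) :=
      (tendsto_pow_atTop (by norm_num)).inv_tendsto_atTop
    have h3 : Tendsto (fun R : ℝ => 64 * (C * (4 ^ (3 / 2 : ℝ) * R ^ (-(1 / 2) : ℝ))
        + B * (R ^ 2)⁻¹) * ‖s - s'‖) atTop (𝓝 0) := by
      have := (((h1.const_mul (4 ^ (3 / 2 : ℝ))).const_mul C).add (h2.const_mul B)).const_mul 64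
      simpa using this.mul_const ‖s - s'‖
    refine squeeze_zero' ?_ ?_ h3
    · filter_upwards [eventually_ge_atTop 1] with R hR
      positivity
    · filter_upwards [eventually_ge_atTop 1] with R hR
      have hR0 : 0 < R := by linarith
      have : (1 + 3 * R) ^ (3 / 2 : ℝ) ≤ 4 ^ (3 / 2 : ℝ) * R ^ (3 / 2 : ℝ) := by
        rw [← Real.mul_rpow (by norm_num) hR0.le]
        exact Real.rpow_le_rpow (by linarith) (by linarith) (by norm_num)
      have h4 : R ^ (-(1 / 2) : ℝ) = R ^ (3 / 2 : ℝ) / R ^ 2 := by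
        rw [← Real.rpow_natCast R 2, ← Real.rpow_sub hR0]
        norm_num
      rw [h4, div_eq_mul_inv]
      have h5 : 64 * (C * (1 + 3 * R) ^ (3 / 2 : ℝ) + B) * (R ^ 2)⁻¹
        ≤ 64 * (C * (4 ^ (3 / 2 : ℝ) * R ^ (3 / 2 : ℝ)) + B) * (R ^ 2)⁻¹ := by gcongr
      refine mul_le_mul_of_nonneg_right (h5.trans (le_of_eq ?_)) (norm_nonneg _)
      field_simp
  rw [tendsto_iff_norm_sub_tendsto_zero]
  refine squeeze_zero' (Eventually.of_forall fun _ => norm_nonneg _) ?_ hlim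
  filter_upwards [eventually_gt_atTop 1, eventually_gt_atTop (8 * ‖s‖),
    eventually_gt_atTop (8 * ‖s'‖)] with R hR hR1 hR2
  have hR0 : 0 < R := by linarith
  obtain ⟨g, hg, hgZ, hgF⟩ := exists_entire_eq_prod_mul hF h0 (zerosUpTo F R)
  have hgne : ∀ z ∈ ball (0 : ℂ) R, g z ≠ 0 := by
    intro z hz h
    have hzF : F z = 0 := by rw [hgF, h, mul_zero]
    refine hgZ z ((mem_zerosUpTo hF h0).mpr ⟨hzF, ?_⟩) h
    rw [mem_ball_zero_iff] at hz
    exact hz.le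
  have hld : ∀ z, F z ≠ 0 → logDeriv F z = ∑ ρ ∈ zerosUpTo F R,
      (analyticOrderNatAt F ρ : ℂ) * (z - ρ)⁻¹ + logDeriv g z := by
    intro z hz
    have hFe : F = fun z => (∏ ρ ∈ zerosUpTo F R, (z - ρ) ^ analyticOrderNatAt F ρ) * g z :=
      funext hgF
    have hPz : (∏ ρ ∈ zerosUpTo F R, (z - ρ) ^ analyticOrderNatAt F ρ) ≠ 0 := by
      intro h
      exact hz (by rw [hgF, h, zero_mul])
    have hgz : g z ≠ 0 := fun h => hz (by rw [hgF, h, mul_zero])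
    conv_lhs => rw [hFe]
    rw [logDeriv_mul (f := fun z => ∏ ρ ∈ zerosUpTo F R, (z - ρ) ^ analyticOrderNatAt F ρ)
      z hPz hgz (by fun_prop) (hg z)]
    congr 1
    have := logDeriv_prod (s := zerosUpTo F R)
      (f := fun ρ z => (z - ρ) ^ analyticOrderNatAt F ρ) (x := z)
      (fun ρ hρ => (Finset.prod_ne_zero_iff.mp hPz) ρ hρ) (fun ρ _ => by fun_prop)
    rw [this]
    exact Finset.sum_congr rfl fun ρ _ => logDeriv_sub_pow _
  have hM : ∀ z ∈ ball (0 : ℂ) R, ‖g z‖ ≤ ‖g 0‖ * Real.exp (C * (1 + 3 * R) ^ (3 / 2 : ℝ) + B) := by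
    set P : ℝ := ∏ ρ ∈ zerosUpTo F R, ‖ρ‖ ^ analyticOrderNatAt F ρ
    have hP0 : ‖F 0‖ = P * ‖g 0‖ := by
      rw [hgF 0, norm_mul, norm_prod]
      simp [P]
    have hPpos : 0 < P := by
      refine Finset.prod_pos fun ρ hρ => pow_pos (norm_pos_iff.mpr ?_) _
      rintro rfl
      exact h0 ((mem_zerosUpTo hF h0).mp hρ).1
    have hsph : ∀ z ∈ frontier (ball (0 : ℂ) (3 * R)),
        ‖g z‖ ≤ Real.exp (C * (1 + 3 * R) ^ (3 / 2 : ℝ)) / P := by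
      intro z hz
      rw [frontier_ball _ (by linarith), mem_sphere_zero_iff_norm] at hz
      rw [le_div_iff₀ hPpos]
      have := hFC z
      rw [hz] at this
      refine le_trans ?_ this
      rw [hgF z, norm_mul, mul_comm, norm_prod]
      refine mul_le_mul_of_nonneg_right ?_ (norm_nonneg _)
      refine Finset.prod_le_prod (fun _ _ => by positivity) fun ρ hρ => ?_
      rw [norm_pow]
      refine pow_le_pow_left₀ (norm_nonneg _) ?_ _
      have := ((mem_zerosUpTo hF h0).mp hρ).2
      linarith [norm_sub_norm_le z ρ]
    intro z hz
    have hz3 : z ∈ closure (ball (0 : ℂ) (3 * R)) := by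
      apply subset_closure
      rw [mem_ball_zero_iff] at hz ⊢
      linarith
    refine (Complex.norm_le_of_forall_mem_frontier_norm_le isBounded_ball hg.diffContOnCl hsph
      hz3).trans ?_
    rw [div_le_iff₀ hPpos, Real.exp_add]
    have : 1 ≤ ‖F 0‖ * Real.exp B := by
      have hF0 := norm_pos_iff.mpr h0
      calc (1 : ℝ) = ‖F 0‖ * Real.exp (-Real.log ‖F 0‖) := by
            rw [Real.exp_neg, Real.exp_log hF0, mul_inv_cancel₀ hF0.ne']
        _ ≤ _ := by
          gcongr
          exact neg_le_abs _
    calc Real.exp (C * (1 + 3 * R) ^ (3 / 2 : ℝ))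
        ≤ Real.exp (C * (1 + 3 * R) ^ (3 / 2 : ℝ)) * (‖F 0‖ * Real.exp B) :=
          le_mul_of_one_le_right (Real.exp_pos _).le this
      _ = _ := by rw [hP0]; ring
  have key := norm_logDeriv_sub_le hg hR0 (M := C * (1 + 3 * R) ^ (3 / 2 : ℝ) + B) (by positivity)
    hgne hM (s := s) (s' := s') (by linarith) (by linarith)
  rw [hld s hs, hld s' hs']
  simp only [mul_sub, Finset.sum_sub_distrib]
  rw [← norm_neg]
  refine le_of_eq_of_le (congrArg norm ?_) key
  ring

end EntireFunctions

section XiFunction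

open MeasureTheory

lemma exists_bound_mellin_of_re_mem_Icc {f : ℝ → ℂ} (h0 : MellinConvergent f 0)
    (h1 : MellinConvergent f 2) :
    ∃ B : ℝ, ∀ s : ℂ, 0 ≤ s.re → s.re ≤ 2 → ‖mellin f s‖ ≤ B := by
  refine ⟨∫ t in Set.Ioi (0 : ℝ), (‖(t : ℂ) ^ ((0 : ℂ) - 1) • f t‖ +
    ‖(t : ℂ) ^ ((2 : ℂ) - 1) • f t‖), fun s hs0 hs1 => ?_⟩
  refine norm_integral_le_of_norm_le (h0.norm.add h1.norm) ?_
  refine (ae_restrict_mem measurableSet_Ioi).mono fun t ht => ?_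
  have ht0 : (0 : ℝ) < t := ht
  simp only [norm_smul, Complex.norm_cpow_eq_rpow_re_of_pos ht0, ← add_mul]
  refine mul_le_mul_of_nonneg_right ?_ (norm_nonneg _)
  simp only [Complex.sub_re, Complex.zero_re, Complex.one_re, Complex.re_ofNat]
  rcases le_total t 1 with h | h
  · have := Real.rpow_le_rpow_of_exponent_ge ht0 h (show (0 : ℝ) - 1 ≤ s.re - 1 by linarith)
    have := Real.rpow_pos_of_pos ht0 (2 - 1)
    linarith
  · have := Real.rpow_le_rpow_of_exponent_le h (show s.re - 1 ≤ 2 - 1 by linarith)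
    have := Real.rpow_pos_of_pos ht0 (0 - 1)
    linarith

lemma exists_bound_completedRiemannZeta₀ :
    ∃ B : ℝ, ∀ s : ℂ, 0 ≤ s.re → s.re ≤ 4 → ‖completedRiemannZeta₀ s‖ ≤ B := by
  have h := (HurwitzZeta.hurwitzEvenFEPair 0).isStrongFEPair_toStrongFEPair.hasMellin
  obtain ⟨B, hB⟩ := exists_bound_mellin_of_re_mem_Icc (h 0).1 (h 2).1
  refine ⟨B / 2, fun s hs0 hs1 => ?_⟩
  have := hB (s / 2) (by simp; linarith) (by simp; linarith)
  have e : completedRiemannZeta₀ s =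
    mellin (HurwitzZeta.hurwitzEvenFEPair 0).f_modif (s / 2) / 2 := rfl
  rw [e, norm_div, Complex.norm_ofNat]
  exact div_le_div_of_nonneg_right this (by norm_num)

lemma norm_Gamma_le_Gamma_re {s : ℂ} (hs : 0 < s.re) : ‖Complex.Gamma s‖ ≤ Real.Gamma s.re := by
  rw [Complex.Gamma_eq_integral hs, Real.Gamma_eq_integral hs, Complex.GammaIntegral]
  refine norm_integral_le_of_norm_le (Real.GammaIntegral_convergent hs) ?_
  refine (ae_restrict_mem measurableSet_Ioi).mono fun t ht => ?_
  have ht0 : (0 : ℝ) < t := ht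
  rw [norm_mul, Complex.norm_cpow_eq_rpow_re_of_pos ht0]
  simp [Complex.norm_exp]

lemma norm_riemannZeta_le {s : ℂ} (hs : 2 ≤ s.re) : ‖riemannZeta s‖ ≤ 2 := by
  rw [zeta_eq_tsum_one_div_nat_cpow (by linarith)]
  have hsum : HasSum (fun n : ℕ => 1 / (n : ℝ) ^ 2) (Real.pi ^ 2 / 6) := hasSum_zeta_two
  have hle : ∀ n : ℕ, ‖1 / (n : ℂ) ^ s‖ ≤ 1 / (n : ℝ) ^ 2 := by
    intro n
    rcases Nat.eq_zero_or_pos n with rfl | hn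
    · have : s ≠ 0 := by
        rintro rfl
        norm_num at hs
      simp [Complex.zero_cpow this]
    · rw [norm_div, norm_one, Complex.norm_natCast_cpow_of_pos hn, ← Real.rpow_natCast (n : ℝ) 2]
      have h1 : (1 : ℝ) ≤ n := by exact_mod_cast hn
      exact one_div_le_one_div_of_le (by positivity)
        (Real.rpow_le_rpow_of_exponent_le h1 (by exact_mod_cast hs))
  refine (tsum_of_norm_bounded hsum hle).trans ?_
  nlinarith [Real.pi_lt_d2, Real.pi_pos]

lemma Gamma_le_exp {x : ℝ} (hx : 2 ≤ x) : Real.Gamma x ≤ Real.exp (3 * (1 + x) ^ (3 / 2 : ℝ)) := by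
  set n := ⌈x⌉₊ with hn
  have hxn : x ≤ n := Nat.le_ceil x
  have hn1 : (n : ℝ) < x + 1 := Nat.ceil_lt_add_one (by linarith)
  have hn2 : (2 : ℝ) ≤ n := hx.trans hxn
  have h1 : Real.Gamma x ≤ Real.Gamma (n + 1) :=
    Real.Gamma_strictMonoOn_Ici.monotoneOn (by simpa using hx) (by simp; linarith) (by linarith)
  rw [Real.Gamma_nat_eq_factorial] at h1
  have h2 : (n.factorial : ℝ) ≤ (n : ℝ) ^ n := by exact_mod_cast Nat.factorial_le_pow n
  refine h1.trans (h2.trans ?_)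
  have hn0 : (0 : ℝ) < n := by linarith
  have hy0 : 0 < 1 + x := by linarith
  rw [← Real.exp_log (pow_pos hn0 n), Real.log_pow]
  refine Real.exp_le_exp.mpr ?_
  have h3 : Real.log n ≤ (n : ℝ) ^ (1 / 2 : ℝ) / (1 / 2) :=
    Real.log_le_rpow_div hn0.le (by norm_num)
  have h4 : (n : ℝ) ^ (1 / 2 : ℝ) ≤ (1 + x) ^ (1 / 2 : ℝ) :=
    Real.rpow_le_rpow hn0.le (by linarith) (by norm_num)
  have h5 : (1 + x) ^ (3 / 2 : ℝ) = (1 + x) * (1 + x) ^ (1 / 2 : ℝ) := by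
    rw [show (3 / 2 : ℝ) = 1 + 1 / 2 by norm_num, Real.rpow_add hy0, Real.rpow_one]
  rw [h5]
  have h6 : 0 ≤ (1 + x) ^ (1 / 2 : ℝ) := by positivity
  calc (n : ℝ) * Real.log n ≤ (1 + x) * (2 * (1 + x) ^ (1 / 2 : ℝ)) := by
        refine mul_le_mul (by linarith) (by linarith) (Real.log_nonneg (by linarith)) hy0.le
    _ ≤ _ := by nlinarith [mul_nonneg hy0.le h6]

/-- Riemann's entire function `s (s - 1) π ^ (-s / 2) Γ(s / 2) ζ(s)`. -/
noncomputable def riemannXi (s : ℂ) : ℂ := s * (s - 1) * completedRiemannZeta₀ s + 1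

lemma differentiable_riemannXi : Differentiable ℂ riemannXi := by
  have := differentiable_completedZeta₀
  unfold riemannXi
  fun_prop

lemma riemannXi_one_sub (s : ℂ) : riemannXi (1 - s) = riemannXi s := by
  rw [riemannXi, riemannXi, completedRiemannZeta₀_one_sub]
  ring

lemma riemannXi_zero : riemannXi 0 = 1 := by simp [riemannXi]

lemma riemannXi_one : riemannXi 1 = 1 := by simp [riemannXi]

lemma riemannXi_eq {s : ℂ} (h0 : s ≠ 0) (h1 : s ≠ 1) :
    riemannXi s = s * (s - 1) * completedRiemannZeta s := by
  have h2 : 1 - s ≠ 0 := sub_ne_zero.mpr h1.symm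
  rw [completedRiemannZeta_eq, riemannXi]
  field_simp
  ring

lemma riemannXi_eq_mul_riemannZeta {s : ℂ} (h0 : 0 < s.re) (h1 : s ≠ 1) :
    riemannXi s = s * (s - 1) * (Complex.Gammaℝ s * riemannZeta s) := by
  have hs : s ≠ 0 := by
    rintro rfl
    simp at h0
  rw [riemannXi_eq hs h1, riemannZeta_def_of_ne_zero hs,
    mul_div_cancel₀ _ (Complex.Gammaℝ_ne_zero_of_re_pos h0)]

lemma riemannXi_ne_zero_of_one_le_re {s : ℂ} (hs : 1 ≤ s.re) : riemannXi s ≠ 0 := by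
  by_cases h1 : s = 1
  · simp [h1, riemannXi_one]
  · have hs0 : s ≠ 0 := by
      rintro rfl
      norm_num at hs
    rw [riemannXi_eq_mul_riemannZeta (by linarith) h1]
    exact mul_ne_zero (mul_ne_zero hs0 (sub_ne_zero.mpr h1))
      (mul_ne_zero (Complex.Gammaℝ_ne_zero_of_re_pos (by linarith))
        (riemannZeta_ne_zero_of_one_le_re hs))

lemma riemannXi_ne_zero_of_re_nonpos {s : ℂ} (hs : s.re ≤ 0) : riemannXi s ≠ 0 := by
  rw [← riemannXi_one_sub]
  exact riemannXi_ne_zero_of_one_le_re (by simp; linarith)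

lemma re_mem_Ioo_of_riemannXi_eq_zero {s : ℂ} (hs : riemannXi s = 0) : 0 < s.re ∧ s.re < 1 := by
  constructor
  · by_contra! h
    exact riemannXi_ne_zero_of_re_nonpos h hs
  · by_contra! h
    exact riemannXi_ne_zero_of_one_le_re h hs

lemma deriv_riemannXi_one : deriv riemannXi 1 = completedRiemannZeta₀ 1 := by
  have h := (differentiable_completedZeta₀ 1).hasDerivAt
  have h1 : HasDerivAt (fun s : ℂ => s * (s - 1)) (1 * (1 - 1) + 1 * 1) 1 :=
    (hasDerivAt_id (1 : ℂ)).mul ((hasDerivAt_id (1 : ℂ)).sub_const 1)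
  have := (h1.mul h).add_const 1
  refine (this.congr_deriv ?_).deriv
  simp

lemma logDeriv_riemannXi_one_sub (s : ℂ) : logDeriv riemannXi (1 - s) = -logDeriv riemannXi s := by
  have h : deriv (fun z => riemannXi (1 - z)) s = -deriv riemannXi (1 - s) :=
    deriv_comp_const_sub riemannXi 1 s
  have h2 : (fun z => riemannXi (1 - z)) = riemannXi := funext riemannXi_one_sub
  rw [h2] at h
  rw [logDeriv_apply, logDeriv_apply, riemannXi_one_sub, h]
  ring

lemma exists_bound_riemannXi : ∃ C : ℝ, 0 < C ∧
    ∀ z, ‖riemannXi z‖ ≤ Real.exp (C * (1 + ‖z‖) ^ (3 / 2 : ℝ)) := by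
  have hpoly : ∀ z : ℂ, ‖z * (z - 1)‖ ≤ (1 + ‖z‖) ^ 2 := by
    intro z
    rw [norm_mul, sq]
    refine mul_le_mul (by linarith) ?_ (norm_nonneg _) (by positivity)
    refine (norm_sub_le _ _).trans ?_
    simp [add_comm]
  have hrpow : ∀ z : ℂ, 1 + ‖z‖ ≤ (1 + ‖z‖) ^ (3 / 2 : ℝ) := by
    intro z
    exact Real.self_le_rpow_of_one_le (by linarith [norm_nonneg z]) (by norm_num)
  have hpe : ∀ z : ℂ, (1 + ‖z‖) ^ 2 ≤ Real.exp (2 * (1 + ‖z‖) ^ (3 / 2 : ℝ)) := by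
    intro z
    have h0 := norm_nonneg z
    have : 1 + ‖z‖ ≤ Real.exp ((1 + ‖z‖) ^ (3 / 2 : ℝ)) := by
      linarith [hrpow z, Real.add_one_le_exp ((1 + ‖z‖) ^ (3 / 2 : ℝ))]
    rw [two_mul, Real.exp_add, ← sq]
    exact pow_le_pow_left₀ (by linarith) this 2
  obtain ⟨B, hB⟩ := exists_bound_completedRiemannZeta₀
  have key : ∀ z : ℂ, 1 / 2 ≤ z.re →
      ‖riemannXi z‖ ≤ Real.exp ((|B| + 6) * (1 + ‖z‖) ^ (3 / 2 : ℝ)) := by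
    intro z hz
    have h0 := norm_nonneg z
    have h1 := hrpow z
    set X := (1 + ‖z‖) ^ (3 / 2 : ℝ)
    rcases le_or_gt z.re 4 with h4 | h4
    · have hb : ‖completedRiemannZeta₀ z‖ ≤ |B| := (hB z (by linarith) h4).trans (le_abs_self B)
      have : ‖riemannXi z‖ ≤ Real.exp (2 * X) * |B| + 1 := by
        refine (norm_add_le _ _).trans ?_
        rw [norm_one, norm_mul]
        gcongr
        exact (hpoly z).trans (hpe z)
      refine this.trans ?_
      have h5 : Real.exp (2 * X) * |B| + 1 ≤ Real.exp (2 * X) * (|B| + 1) := by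
        have : 1 ≤ Real.exp (2 * X) := Real.one_le_exp (by linarith)
        linarith
      refine h5.trans ?_
      calc Real.exp (2 * X) * (|B| + 1) ≤ Real.exp (2 * X) * Real.exp |B| := by
            gcongr
            exact Real.add_one_le_exp _
        _ = Real.exp (2 * X + |B|) := by rw [Real.exp_add]
        _ ≤ _ := by
          apply Real.exp_le_exp.mpr
          nlinarith [abs_nonneg B]
    · have hz1 : z ≠ 1 := by
        rintro rfl
        norm_num at h4
      rw [riemannXi_eq_mul_riemannZeta (by linarith) hz1, norm_mul, norm_mul]
      have hG : ‖Complex.Gammaℝ z‖ ≤ Real.exp (3 * X) := by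
        rw [Complex.Gammaℝ_def, norm_mul, Complex.norm_cpow_eq_rpow_re_of_pos Real.pi_pos]
        have hp : Real.pi ^ (-z / 2).re ≤ 1 := by
          refine Real.rpow_le_one_of_one_le_of_nonpos (by linarith [Real.pi_gt_three]) ?_
          simp
          linarith
        have hg : ‖Complex.Gamma (z / 2)‖ ≤ Real.exp (3 * X) := by
          have hre : (z / 2).re = z.re / 2 := by simp
          refine (norm_Gamma_le_Gamma_re (by rw [hre]; linarith)).trans ?_
          rw [hre]
          refine (Gamma_le_exp (by linarith)).trans ?_
          refine Real.exp_le_exp.mpr (mul_le_mul_of_nonneg_left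
            (Real.rpow_le_rpow (by linarith) ?_ (by norm_num)) (by norm_num))
          linarith [Complex.re_le_norm z]
        calc _ ≤ 1 * Real.exp (3 * X) := mul_le_mul hp hg (norm_nonneg _) zero_le_one
          _ = _ := one_mul _
      have hz2 : ‖riemannZeta z‖ ≤ Real.exp X :=
        (norm_riemannZeta_le (by linarith)).trans (by linarith [Real.add_one_le_exp X])
      calc _ ≤ Real.exp (2 * X) * (Real.exp (3 * X) * Real.exp X) := by
            refine mul_le_mul ?_ ?_ (by positivity) (by positivity)
            · rw [← norm_mul]
              exact (hpoly z).trans (hpe z)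
            · rw [norm_mul]
              exact mul_le_mul hG hz2 (norm_nonneg _) (Real.exp_pos _).le
        _ = Real.exp (6 * X) := by
          rw [← Real.exp_add, ← Real.exp_add]
          ring_nf
        _ ≤ _ := by
          apply Real.exp_le_exp.mpr
          nlinarith [abs_nonneg B]
  refine ⟨(|B| + 6) * 2 ^ (3 / 2 : ℝ), by positivity, fun z => ?_⟩
  have h2 : ∀ w : ℂ, ‖w‖ ≤ 1 + ‖z‖ → (|B| + 6) * (1 + ‖w‖) ^ (3 / 2 : ℝ) ≤
      (|B| + 6) * 2 ^ (3 / 2 : ℝ) * (1 + ‖z‖) ^ (3 / 2 : ℝ) := by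
    intro w hw
    rw [mul_assoc, ← Real.mul_rpow (by norm_num) (by positivity)]
    gcongr
    linarith [norm_nonneg z]
  rcases le_total (1 / 2) z.re with h | h
  · exact (key z h).trans (Real.exp_le_exp.mpr (h2 z (by linarith)))
  · rw [← riemannXi_one_sub]
    refine (key (1 - z) (by simp; linarith)).trans (Real.exp_le_exp.mpr (h2 _ ?_))
    simpa using norm_sub_le (1 : ℂ) z

lemma analyticOrderNatAt_riemannXi_one_sub (ρ : ℂ) :
    analyticOrderNatAt riemannXi (1 - ρ) = analyticOrderNatAt riemannXi ρ := by
  have h2 : riemannXi ∘ (fun z => 1 - z) = riemannXi := funext riemannXi_one_sub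
  have hd : deriv (fun z : ℂ => 1 - z) ρ ≠ 0 := by
    simp
  have := analyticOrderAt_comp_of_deriv_ne_zero (f := riemannXi) (g := fun z : ℂ => 1 - z)
    (z₀ := ρ) (by fun_prop) hd
  unfold analyticOrderNatAt
  rw [← this, h2]

lemma tendsto_sum_zeros_riemannXi {s s' : ℂ} (hs : riemannXi s ≠ 0) (hs' : riemannXi s' ≠ 0) :
    Tendsto (fun R : ℝ => ∑ ρ ∈ zerosUpTo riemannXi R,
        (analyticOrderNatAt riemannXi ρ : ℂ) * ((s - ρ)⁻¹ - (s' - ρ)⁻¹)) atTop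
      (𝓝 (logDeriv riemannXi s - logDeriv riemannXi s')) := by
  obtain ⟨C, hC, h⟩ := exists_bound_riemannXi
  exact tendsto_sum_zerosUpTo differentiable_riemannXi (by simp [riemannXi_zero]) hC h hs hs'

end XiFunction

section DigammaSeries

lemma ne_neg_natCast_of_re_pos {z : ℂ} (hz : 0 < z.re) (m : ℕ) : z ≠ -m := by
  rintro rfl
  simp at hz
  linarith [(Nat.cast_nonneg m : (0 : ℝ) ≤ m)]

lemma add_natCast_ne_zero_of_re_pos {z : ℂ} (hz : 0 < z.re) (m : ℕ) : z + m ≠ 0 := fun h =>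
  ne_neg_natCast_of_re_pos hz m (eq_neg_of_add_eq_zero_left h)

lemma digamma_ofReal {x : ℝ} (hx : 0 < x) :
    Complex.digamma x = (deriv (Real.log ∘ Real.Gamma) x : ℝ) := by
  have hc := (Complex.differentiableAt_Gamma (x : ℂ)
    (ne_neg_natCast_of_re_pos (by simpa using hx))).hasDerivAt.comp_ofReal
  have hr : HasDerivAt Real.Gamma (deriv Real.Gamma x) x :=
    (Real.differentiableAt_Gamma fun m => by
      have : (0 : ℝ) ≤ m := Nat.cast_nonneg m
      linarith).hasDerivAt
  have hr' := hr.ofReal_comp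
  have he : (fun y : ℝ => Complex.Gamma y) = fun y : ℝ => ((Real.Gamma y : ℝ) : ℂ) :=
    funext fun y => Complex.Gamma_ofReal y
  rw [he] at hc
  have h1 := hc.unique hr'
  have hG := (Real.Gamma_pos_of_pos hx).ne'
  have h2 : deriv (Real.log ∘ Real.Gamma) x = deriv Real.Gamma x / Real.Gamma x :=
    (hr.log hG).deriv
  rw [h2, Complex.digamma_def, logDeriv_apply, h1, Complex.Gamma_ofReal]
  push_cast
  rfl

/-- The difference of two terms of the digamma series. -/
noncomputable def digammaTerm (z : ℂ) (k : ℕ) : ℂ := 1 / (k + 1) - 1 / (z + k)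

lemma norm_digammaTerm_le {z : ℂ} {δ B : ℝ} (hδ : 0 < δ) (hδ1 : δ ≤ 1) (hz : δ ≤ z.re)
    (hB : ‖z‖ ≤ B) (k : ℕ) : ‖digammaTerm z k‖ ≤ (B + 1) / δ * (1 / ((k : ℝ) + 1) ^ 2) := by
  have hk : (0 : ℝ) ≤ k := Nat.cast_nonneg k
  have h1 : ((k : ℂ) + 1) ≠ 0 := Nat.cast_add_one_ne_zero k
  have h2 : z + k ≠ 0 := add_natCast_ne_zero_of_re_pos (hδ.trans_le hz) k
  have e : digammaTerm z k = (z - 1) / ((k + 1) * (z + k)) := by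
    rw [digammaTerm]
    field_simp
    ring
  have h3 : δ * (k + 1) ≤ ‖z + k‖ := by
    refine le_trans ?_ (Complex.re_le_norm _)
    simp
    nlinarith
  have h4 : ‖(k : ℂ) + 1‖ = k + 1 := by
    exact_mod_cast Complex.norm_natCast (k + 1)
  have h5 : ‖z - 1‖ ≤ B + 1 := (norm_sub_le _ _).trans (by simpa using hB)
  have hB0 : 0 ≤ B := (norm_nonneg z).trans hB
  rw [e, norm_div, norm_mul, h4]
  calc ‖z - 1‖ / ((k + 1) * ‖z + k‖) ≤ (B + 1) / ((k + 1) * (δ * (k + 1))) := by gcongr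
    _ = _ := by field_simp

lemma summable_one_div_add_one_sq : Summable fun k : ℕ => 1 / ((k : ℝ) + 1) ^ 2 := by
  have := (summable_nat_add_iff 1).mpr (Real.summable_one_div_nat_pow.mpr (one_lt_two))
  simpa using this

lemma summable_digammaTerm {z : ℂ} (hz : 0 < z.re) : Summable (digammaTerm z) := by
  refine Summable.of_norm_bounded
    (summable_one_div_add_one_sq.mul_left ((‖z‖ + 1) / min z.re 1)) fun k => ?_
  exact norm_digammaTerm_le (lt_min hz one_pos) (min_le_right _ _) (min_le_left _ _) le_rfl k

lemma differentiableOn_tsum_digammaTerm :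
    DifferentiableOn ℂ (fun z => ∑' k, digammaTerm z k) {z | 0 < z.re} := by
  intro z hz
  have hz : 0 < z.re := hz
  set δ := min (z.re / 2) 1
  have hδ : 0 < δ := lt_min (by linarith) one_pos
  set U : Set ℂ := {w | δ < w.re} ∩ ball 0 (‖z‖ + 1)
  have hU : IsOpen U := (isOpen_lt continuous_const Complex.continuous_re).inter isOpen_ball
  have hzU : z ∈ U := ⟨by
    have : δ ≤ z.re / 2 := min_le_left _ _
    simp only [Set.mem_ofPred_eq]
    linarith, by simp⟩
  have := Complex.differentiableOn_tsum_of_summable_norm (F := fun k z => digammaTerm z k) (U := U)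
    (summable_one_div_add_one_sq.mul_left ((‖z‖ + 1 + 1) / δ)) (fun k w hw => by
      have : w + k ≠ 0 := add_natCast_ne_zero_of_re_pos (hδ.trans hw.1) k
      refine DifferentiableAt.differentiableWithinAt ?_
      unfold digammaTerm
      fun_prop (disch := assumption)) hU (fun k w hw =>
      norm_digammaTerm_le hδ (min_le_right _ _) hw.1.le
        (mem_ball_zero_iff.mp hw.2).le k)
  exact (this.differentiableAt (hU.mem_nhds hzU)).differentiableWithinAt

lemma tsum_digammaTerm_add_one {z : ℂ} (hz : 0 < z.re) :
    ∑' k, digammaTerm (z + 1) k = (∑' k, digammaTerm z k) + z⁻¹ := by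
  have h1 : 0 < (z + 1).re := by simp; linarith
  have hs := (summable_digammaTerm h1).hasSum.sub (summable_digammaTerm hz).hasSum
  have hlim : Tendsto (fun n : ℕ => z⁻¹ - (z + n)⁻¹) atTop (𝓝 (z⁻¹ - 0)) := by
    refine tendsto_const_nhds.sub (tendsto_inv₀_cobounded.comp ?_)
    rw [← tendsto_norm_atTop_iff_cobounded]
    refine tendsto_atTop_mono (fun n => ?_) tendsto_natCast_atTop_atTop
    calc (n : ℝ) ≤ (z + n).re := by simp; linarith
      _ ≤ _ := Complex.re_le_norm _
  have hpart : ∀ n : ℕ, ∑ k ∈ Finset.range n, (digammaTerm (z + 1) k - digammaTerm z k) =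
      z⁻¹ - (z + n)⁻¹ := by
    intro n
    have := Finset.sum_range_sub' (fun k : ℕ => (z + k)⁻¹) n
    simp only [Nat.cast_zero, add_zero] at this
    rw [← this]
    refine Finset.sum_congr rfl fun k _ => ?_
    simp only [digammaTerm, one_div]
    push_cast
    rw [add_right_comm z 1 (k : ℂ), add_assoc z]
    ring
  have h2 := hs.tendsto_sum_nat
  simp only [hpart] at h2
  have := tendsto_nhds_unique h2 hlim
  linear_combination this

lemma tsum_digammaTerm_one : ∑' k, digammaTerm 1 k = 0 := by
  have : ∀ k, digammaTerm 1 k = 0 := fun k => by simp [digammaTerm, add_comm]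
  simp [this]

lemma monotoneOn_deriv_log_Gamma :
    MonotoneOn (deriv (Real.log ∘ Real.Gamma)) (Set.Ioi 0) := by
  refine Real.convexOn_log_Gamma.monotoneOn_deriv fun x hx => ?_
  have hx : 0 < x := hx
  refine DifferentiableAt.log (Real.differentiableAt_Gamma fun m => ?_)
    (Real.Gamma_pos_of_pos hx).ne'
  have : (0 : ℝ) ≤ m := Nat.cast_nonneg m
  linarith

lemma tsum_digammaTerm_ofReal (x : ℝ) : ∑' k, digammaTerm x k =
    ((∑' k : ℕ, (1 / ((k : ℝ) + 1) - 1 / (x + k)) : ℝ) : ℂ) := by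
  rw [Complex.ofReal_tsum]
  refine tsum_congr fun k => ?_
  simp [digammaTerm]

lemma monotoneOn_tsum_digammaTerm :
    MonotoneOn (fun x : ℝ => ∑' k : ℕ, (1 / ((k : ℝ) + 1) - 1 / (x + k))) (Set.Ioi 0) := by
  have hsum : ∀ x : ℝ, 0 < x → Summable fun k : ℕ => (1 / ((k : ℝ) + 1) - 1 / (x + k)) := by
    intro x hx
    have := summable_digammaTerm (z := x) (by simpa using hx)
    rw [← Complex.summable_ofReal]
    refine this.congr fun k => ?_
    simp [digammaTerm]
  intro x hx y hy hxy
  have hx : 0 < x := hx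
  refine (hsum x hx).tsum_le_tsum (fun k => ?_) (hsum y hy)
  gcongr

/-- The partial fraction expansion of the digamma function on the right half-plane. -/
theorem digamma_eq_tsum {z : ℂ} (hz : 0 < z.re) :
    Complex.digamma z = -Real.eulerMascheroniConstant + ∑' k, digammaTerm z k := by
  obtain ⟨ψ, hψ⟩ : ∃ ψ : ℝ → ℝ, ψ = deriv (Real.log ∘ Real.Gamma) := ⟨_, rfl⟩
  obtain ⟨S, hS⟩ : ∃ S : ℝ → ℝ, S = fun x => ∑' k : ℕ, (1 / ((k : ℝ) + 1) - 1 / (x + k)) :=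
    ⟨_, rfl⟩
  have hψmono : MonotoneOn ψ (Set.Ioi 0) := hψ ▸ monotoneOn_deriv_log_Gamma
  have hSmono : MonotoneOn S (Set.Ioi 0) := hS ▸ monotoneOn_tsum_digammaTerm
  have hψc : ∀ x : ℝ, 0 < x → Complex.digamma x = ψ x := fun x hx => by
    rw [digamma_ofReal hx, hψ]
  have hSc : ∀ x : ℝ, ∑' k, digammaTerm x k = S x := fun x => by
    rw [tsum_digammaTerm_ofReal, hS]
  have hψ1 : ∀ x : ℝ, 0 < x → ψ (x + 1) = ψ x + x⁻¹ := by
    intro x hx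
    have := Complex.digamma_apply_add_one x (ne_neg_natCast_of_re_pos (by simpa using hx))
    have h2 := hψc (x + 1) (by linarith)
    rw [hψc x hx] at this
    push_cast at h2
    rw [h2] at this
    exact_mod_cast this
  have hS1 : ∀ x : ℝ, 0 < x → S (x + 1) = S x + x⁻¹ := by
    intro x hx
    have := tsum_digammaTerm_add_one (z := x) (by simpa using hx)
    have h2 := hSc (x + 1)
    push_cast at h2
    rw [h2, hSc] at this
    exact_mod_cast this
  set D : ℝ → ℝ := fun x => ψ x - S x
  have hD1 : ∀ x : ℝ, 0 < x → D (x + 1) = D x := by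
    intro x hx
    simp only [D, hψ1 x hx, hS1 x hx]
    ring
  have hDn : ∀ (n : ℕ) (x : ℝ), 0 < x → D (x + n) = D x := by
    intro n x hx
    induction n with
    | zero => simp
    | succ n ih =>
      push_cast
      rw [← add_assoc, hD1 _ (by positivity), ih]
  have hbound : ∀ x ∈ Set.Icc (1 : ℝ) 2, ∀ n : ℕ, |D x - D 1| ≤ 1 / ((n : ℝ) + 1) := by
    intro x hx n
    have hn : (0 : ℝ) ≤ n := Nat.cast_nonneg n
    rw [← hDn n x (by linarith [hx.1]), ← hDn n 1 one_pos]
    have h1 := hψmono (a := 1 + n) (b := x + n) (by simp; linarith)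
      (by simp; linarith [hx.1]) (by linarith [hx.1])
    have h2 := hψmono (a := x + n) (b := 1 + n + 1)
      (by simp; linarith [hx.1]) (by simp; linarith) (by linarith [hx.2])
    have h3 := hSmono (a := 1 + n) (b := x + n) (by simp; linarith)
      (by simp; linarith [hx.1]) (by linarith [hx.1])
    have h4 := hSmono (a := x + n) (b := 1 + n + 1)
      (by simp; linarith [hx.1]) (by simp; linarith) (by linarith [hx.2])
    have h5 := hψ1 (1 + n) (by linarith)
    have h6 := hS1 (1 + n) (by linarith)
    change S (1 + n) ≤ S (x + n) at h3
    change S (x + n) ≤ S (1 + n + 1) at h4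
    have h7 : ((1 : ℝ) + n)⁻¹ = 1 / (n + 1) := by rw [add_comm, one_div]
    rw [h7] at h5 h6
    rw [abs_le]
    constructor <;> simp only [D] <;> linarith
  have hconst : ∀ x ∈ Set.Icc (1 : ℝ) 2, D x = D 1 := by
    intro x hx
    have h : |D x - D 1| ≤ 0 :=
      ge_of_tendsto' tendsto_one_div_add_atTop_nhds_zero_nat (hbound x hx)
    linarith [abs_nonpos_iff.mp h]
  have hD1' : D 1 = -Real.eulerMascheroniConstant := by
    have h1 := hψc 1 one_pos
    rw [Complex.ofReal_one, Complex.digamma_one] at h1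
    have h2 := hSc 1
    rw [Complex.ofReal_one, tsum_digammaTerm_one] at h2
    have h1' : ψ 1 = -Real.eulerMascheroniConstant := by exact_mod_cast h1.symm
    have h2' : S 1 = 0 := by exact_mod_cast h2.symm
    simp only [D, h1', h2', sub_zero]
  have hopen : IsOpen {z : ℂ | 0 < z.re} := isOpen_lt continuous_const Complex.continuous_re
  have hA1 : AnalyticOnNhd ℂ Complex.digamma {z | 0 < z.re} := by
    refine DifferentiableOn.analyticOnNhd (fun w hw => ?_) hopen
    have hG : DifferentiableOn ℂ Complex.Gamma {z | 0 < z.re} := fun w hw =>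
      (Complex.differentiableAt_Gamma w (ne_neg_natCast_of_re_pos hw)).differentiableWithinAt
    have hG' := hG.deriv hopen
    exact (hG' w hw).div (hG w hw) (Complex.Gamma_ne_zero_of_re_pos hw)
  have hA2 : AnalyticOnNhd ℂ (fun z => -Real.eulerMascheroniConstant + ∑' k, digammaTerm z k)
      {z | 0 < z.re} :=
    (differentiableOn_tsum_digammaTerm.const_add _).analyticOnNhd hopen
  have hpre : IsPreconnected {z : ℂ | 0 < z.re} := (convex_halfSpace_re_gt 0).isPreconnected
  have hfreq : ∃ᶠ z in 𝓝[≠] (3 / 2 : ℂ), Complex.digamma z =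
      -Real.eulerMascheroniConstant + ∑' k, digammaTerm z k := by
    have ht : Tendsto (fun n : ℕ => ((3 / 2 + (1 / ((n : ℝ) + 2)) : ℝ) : ℂ)) atTop
        (𝓝[≠] (3 / 2 : ℂ)) := by
      refine tendsto_nhdsWithin_iff.mpr ⟨?_, Eventually.of_forall fun n => ?_⟩
      · have h : Tendsto (fun n : ℕ => (1 / ((n : ℝ) + 2))) atTop (𝓝 0) := by
          have := (tendsto_one_div_add_atTop_nhds_zero_nat (𝕜 := ℝ)).comp (tendsto_add_atTop_nat 1)
          refine this.congr fun n => ?_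
          simp only [Function.comp]
          push_cast
          ring_nf
        have h2 := (Complex.continuous_ofReal.tendsto _).comp (h.const_add (3 / 2 : ℝ))
        simp only [add_zero] at h2
        have h3 : ((3 / 2 : ℝ) : ℂ) = 3 / 2 := by norm_num
        rw [h3] at h2
        exact h2
      · have : (0 : ℝ) < 1 / ((n : ℝ) + 2) := by positivity
        intro h
        have h2 := congrArg Complex.re h
        rw [Complex.ofReal_re] at h2
        norm_num at h2
        norm_num at this
        linarith
    refine ht.frequently (Eventually.frequently (Eventually.of_forall fun n => ?_))
    set x : ℝ := 3 / 2 + (1 / ((n : ℝ) + 2))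
    have h1 : 1 / ((n : ℝ) + 2) ≤ 1 / 2 := by
      apply one_div_le_one_div_of_le <;> linarith [(Nat.cast_nonneg n : (0 : ℝ) ≤ n)]
    have h2 : 0 < 1 / ((n : ℝ) + 2) := by positivity
    have h3 := hconst x ⟨by simp only [x]; linarith, by simp only [x]; linarith⟩
    rw [hψc x (by positivity), hSc]
    have h4 : ψ x = -Real.eulerMascheroniConstant + S x := by
      have : D x = ψ x - S x := rfl
      linarith
    exact_mod_cast h4
  exact hA1.eqOn_of_preconnected_of_frequently_eq hA2 hpre (by norm_num) hfreq hz

end DigammaSeries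

section ZetaLogDeriv

/-- The contribution of the trivial zeros to the logarithmic derivative of `ζ`. -/
noncomputable def trivialZeroSum (s : ℂ) : ℂ := ∑' k : ℕ, (1 / (2 * k + 3) - 1 / (s + 2 * k + 2))

/-- The value at `1` of the logarithmic derivative of `riemannXi`. -/
noncomputable def xiLogDerivOne : ℝ :=
  (Real.eulerMascheroniConstant - Real.log (4 * Real.pi)) / 2 + 1

lemma logDeriv_riemannXi_one : logDeriv riemannXi 1 = xiLogDerivOne := by
  rw [logDeriv_apply, riemannXi_one, deriv_riemannXi_one, completedRiemannZeta₀_one, div_one,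
    xiLogDerivOne]
  have : Complex.log (4 * Real.pi) = (Real.log (4 * Real.pi) : ℝ) := by
    rw [Complex.ofReal_log (by positivity)]
    norm_num
  rw [this]
  push_cast
  ring

lemma digamma_three_halves :
    Complex.digamma (3 / 2) = 2 - 2 * Real.log 2 - Real.eulerMascheroniConstant := by
  have h := Complex.digamma_apply_add_one (1 / 2) (ne_neg_natCast_of_re_pos (by norm_num))
  rw [Complex.digamma_one_half] at h
  rw [show (3 / 2 : ℂ) = 1 / 2 + 1 by norm_num, h, Complex.ofReal_log (by norm_num)]
  push_cast
  ring

lemma trivialZeroSum_eq_and_summable {s : ℂ} (hs : -2 < s.re) :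
    Summable (fun k : ℕ => (1 / (2 * k + 3) - 1 / (s + 2 * k + 2) : ℂ)) ∧
    trivialZeroSum s = (Complex.digamma (s / 2 + 1) - Complex.digamma (3 / 2)) / 2 := by
  have h1 : 0 < (s / 2 + 1).re := by simp; linarith
  have h2 : 0 < (3 / 2 : ℂ).re := by norm_num
  have hs1 := (summable_digammaTerm h1).hasSum.sub (summable_digammaTerm h2).hasSum
  have hs2 := hs1.div_const 2
  have he : (fun k : ℕ => (digammaTerm (s / 2 + 1) k - digammaTerm (3 / 2) k) / 2) =
      fun k : ℕ => (1 / (2 * k + 3) - 1 / (s + 2 * k + 2) : ℂ) := by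
    funext k
    have h3 := add_natCast_ne_zero_of_re_pos h1 k
    have h4 := add_natCast_ne_zero_of_re_pos h2 k
    have h5 : (s + 2 * k + 2) ≠ 0 := by
      intro h
      apply h3
      linear_combination h / 2
    have h6 : (2 * (k : ℂ) + 3) ≠ 0 := by
      intro h
      apply h4
      linear_combination h / 2
    rw [digammaTerm, digammaTerm]
    rw [show s / 2 + 1 + (k : ℂ) = (s + 2 * k + 2) / 2 by ring,
      show 3 / 2 + (k : ℂ) = (2 * k + 3) / 2 by ring]
    field_simp
    ring
  rw [he] at hs2
  refine ⟨hs2.summable, ?_⟩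
  rw [trivialZeroSum, hs2.tsum_eq, digamma_eq_tsum h1, digamma_eq_tsum h2]
  ring

lemma logDeriv_Gammaℝ {s : ℂ} (hs : 0 < s.re) : logDeriv Complex.Gammaℝ s =
    -(Real.log Real.pi) / 2 + Complex.digamma (s / 2) / 2 := by
  have hs2 : 0 < (s / 2).re := by simp; linarith
  have hπ : (Real.pi : ℂ) ≠ 0 := by exact_mod_cast Real.pi_ne_zero
  have he : Complex.Gammaℝ = fun s : ℂ => (Real.pi : ℂ) ^ (-s / 2) * Complex.Gamma (s / 2) := by
    funext s
    rw [Complex.Gammaℝ_def]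
  have hG := (Complex.differentiableAt_Gamma (s / 2) (ne_neg_natCast_of_re_pos hs2))
  have hG2 : DifferentiableAt ℂ (fun s : ℂ => Complex.Gamma (s / 2)) s :=
    DifferentiableAt.comp s hG (by fun_prop)
  have hP : HasDerivAt (fun s : ℂ => (Real.pi : ℂ) ^ (-s / 2))
      ((Real.pi : ℂ) ^ (-s / 2) * Complex.log Real.pi * (-1 / 2)) s :=
    HasDerivAt.const_cpow ((hasDerivAt_id s).neg.div_const 2) (Or.inl hπ)
  have hP0 : (Real.pi : ℂ) ^ (-s / 2) ≠ 0 := by simp [Complex.cpow_eq_zero_iff, hπ]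
  rw [he, logDeriv_mul (f := fun s : ℂ => (Real.pi : ℂ) ^ (-s / 2))
    (g := fun s : ℂ => Complex.Gamma (s / 2)) s hP0
    (Complex.Gamma_ne_zero_of_re_pos hs2) hP.differentiableAt hG2]
  congr 1
  · rw [logDeriv_apply, hP.deriv, Complex.ofReal_log Real.pi_pos.le]
    field_simp
  · have := logDeriv_comp (f := Complex.Gamma) (g := fun s : ℂ => s / 2) (x := s) hG (by fun_prop)
    have h2 : (Complex.Gamma ∘ fun s : ℂ => s / 2) = fun s : ℂ => Complex.Gamma (s / 2) := rfl
    rw [h2] at this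
    rw [this, Complex.digamma_def]
    simp
    ring

/-- The logarithmic derivative of `ζ` in terms of the entire function `riemannXi`. -/
theorem neg_logDeriv_riemannZeta {s : ℂ} (hs : 1 < s.re) : -logDeriv riemannZeta s =
    1 / (s - 1) + (xiLogDerivOne - Real.eulerMascheroniConstant : ℝ) + trivialZeroSum s
      - logDeriv riemannXi s := by
  have hs1 : s ≠ 1 := by
    rintro rfl
    simp at hs
  have hs0 : s ≠ 0 := by
    rintro rfl
    norm_num at hs
  have hs1' : s - 1 ≠ 0 := sub_ne_zero.mpr hs1
  have hev : riemannXi =ᶠ[𝓝 s] fun s => s * (s - 1) * (Complex.Gammaℝ s * riemannZeta s) := by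
    filter_upwards [(isOpen_lt continuous_const Complex.continuous_re).mem_nhds hs] with w hw
    refine riemannXi_eq_mul_riemannZeta (by linarith [show 1 < w.re from hw]) ?_
    rintro rfl
    simp at hw
  have hGd : DifferentiableAt ℂ Complex.Gammaℝ s := by
    have hG := Complex.Gammaℝ_ne_zero_of_re_pos (s := s) (by linarith)
    have := (Complex.differentiable_Gammaℝ_inv s).inv (inv_ne_zero hG)
    have he : (fun s => (Complex.Gammaℝ s)⁻¹)⁻¹ = Complex.Gammaℝ := by
      funext w
      simp
    rwa [he] at this
  have hG0 := Complex.Gammaℝ_ne_zero_of_re_pos (s := s) (by linarith)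
  have hZ0 := riemannZeta_ne_zero_of_one_le_re hs.le
  have hZd := differentiableAt_riemannZeta hs1
  have hld : logDeriv riemannXi s = 1 / s + 1 / (s - 1) + (logDeriv Complex.Gammaℝ s +
      logDeriv riemannZeta s) := by
    have h1 : logDeriv riemannXi s =
        logDeriv (fun s => s * (s - 1) * (Complex.Gammaℝ s * riemannZeta s)) s := by
      rw [logDeriv_apply, logDeriv_apply, hev.deriv_eq, hev.self_of_nhds]
    rw [h1, logDeriv_mul (f := fun s : ℂ => s * (s - 1))
      (g := fun s => Complex.Gammaℝ s * riemannZeta s) s (mul_ne_zero hs0 hs1')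
      (mul_ne_zero hG0 hZ0) (by fun_prop) (hGd.mul hZd),
      logDeriv_mul (f := Complex.Gammaℝ) (g := riemannZeta) s hG0 hZ0 hGd hZd,
      logDeriv_mul (f := fun s : ℂ => s) (g := fun s => s - 1) s hs0 hs1' (by fun_prop) (by fun_prop)]
    congr 2
    · simp
    · simp [logDeriv_apply]
  have hψ := Complex.digamma_apply_add_one (s / 2)
    (ne_neg_natCast_of_re_pos (by simp; linarith))
  have hlog : Real.log (4 * Real.pi) = 2 * Real.log 2 + Real.log Real.pi := by
    rw [Real.log_mul (by norm_num) Real.pi_ne_zero, show (4 : ℝ) = 2 ^ 2 by norm_num, Real.log_pow]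
    norm_num
  rw [hld, logDeriv_Gammaℝ (by linarith), (trivialZeroSum_eq_and_summable (by linarith)).2, hψ,
    digamma_three_halves, xiLogDerivOne, hlog]
  push_cast
  field_simp
  ring

end ZetaLogDeriv

section Constants

lemma eulerMascheroniConstant_lt : Real.eulerMascheroniConstant < 0.58 := by
  have h := Real.eulerMascheroniConstant_lt_eulerMascheroniSeq' 256
  rw [Real.eulerMascheroniSeq'] at h
  have h2 : Real.log ((256 : ℕ) : ℝ) = 8 * Real.log 2 := by
    rw [show ((256 : ℕ) : ℝ) = 2 ^ 8 by norm_num, Real.log_pow]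
    norm_num
  rw [if_neg (by norm_num), h2] at h
  have h3 : ((harmonic 256 : ℚ) : ℝ) < 6.125 := by
    have : (harmonic 256 : ℚ) < 6.125 := by
      rw [harmonic_eq_sum_Icc]
      decide +kernel
    generalize harmonic 256 = q at this
    have h4 : (q : ℝ) < ((6.125 : ℚ) : ℝ) := by exact_mod_cast this
    norm_num at h4 ⊢
    exact h4
  linarith [Real.log_two_gt_d9]

lemma lt_eulerMascheroniConstant : 0.57 < Real.eulerMascheroniConstant := by
  have h := Real.eulerMascheroniSeq_lt_eulerMascheroniConstant 255
  rw [Real.eulerMascheroniSeq] at h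
  have h2 : Real.log ((255 : ℕ) + 1 : ℝ) = 8 * Real.log 2 := by
    rw [show ((255 : ℕ) + 1 : ℝ) = 2 ^ 8 by norm_num, Real.log_pow]
    norm_num
  rw [h2] at h
  have h3 : 6.1201 < ((harmonic 255 : ℚ) : ℝ) := by
    have : 6.1201 < (harmonic 255 : ℚ) := by
      rw [harmonic_eq_sum_Icc]
      decide +kernel
    generalize harmonic 255 = q at this
    have h4 : ((6.1201 : ℚ) : ℝ) < (q : ℝ) := by exact_mod_cast this
    norm_num at h4 ⊢
    exact h4
  linarith [Real.log_two_lt_d9]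

lemma lt_log_four_mul_pi : 2.53 < Real.log (4 * Real.pi) := by
  rw [Real.lt_log_iff_exp_lt (by positivity)]
  have h1 : Real.exp 2.53 = Real.exp 1 ^ 2 * Real.exp 0.53 := by
    rw [← Real.exp_nat_mul, ← Real.exp_add]
    norm_num
  have h2 : Real.exp 0.53 ≤ 1.69895 := by
    have := Real.exp_bound' (x := 0.53) (by norm_num) (by norm_num) (n := 7) (by norm_num)
    simp only [Finset.sum_range_succ, Finset.sum_range_zero, Nat.factorial] at this
    norm_num at this ⊢
    linarith
  have h3 := Real.exp_one_lt_d9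
  have h4 := Real.pi_gt_d4
  rw [h1]
  have h5 : Real.exp 1 ^ 2 ≤ 2.7182818286 ^ 2 := by gcongr
  calc Real.exp 1 ^ 2 * Real.exp 0.53 ≤ 2.7182818286 ^ 2 * 1.69895 := by gcongr
    _ < 4 * 3.1415 := by norm_num
    _ < 4 * Real.pi := by linarith

lemma xiLogDerivOne_le : xiLogDerivOne ≤ 0.025 := by
  rw [xiLogDerivOne]
  linarith [eulerMascheroniConstant_lt, lt_log_four_mul_pi]

lemma xiLogDerivOne_sub_le : xiLogDerivOne - Real.eulerMascheroniConstant ≤ -0.55 := by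
  rw [xiLogDerivOne]
  linarith [lt_eulerMascheroniConstant, lt_log_four_mul_pi]

end Constants

section Zeros

/-- The multiplicity of a zero of `riemannXi`, as a real number. -/
noncomputable def xiMult (ρ : ℂ) : ℝ := analyticOrderNatAt riemannXi ρ

lemma xiMult_nonneg (ρ : ℂ) : 0 ≤ xiMult ρ := Nat.cast_nonneg _

lemma xiMult_one_sub (ρ : ℂ) : xiMult (1 - ρ) = xiMult ρ := by
  rw [xiMult, xiMult, analyticOrderNatAt_riemannXi_one_sub]

lemma xiMult_eq_zero {ρ : ℂ} (h : riemannXi ρ ≠ 0) : xiMult ρ = 0 := by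
  have ha : AnalyticAt ℂ riemannXi ρ := differentiable_riemannXi.analyticAt ρ
  rw [xiMult, analyticOrderNatAt, ha.analyticOrderAt_eq_zero.mpr h]
  simp

lemma one_le_xiMult {ρ : ℂ} (h : riemannXi ρ = 0) : 1 ≤ xiMult ρ := by
  have ha : AnalyticAt ℂ riemannXi ρ := differentiable_riemannXi.analyticAt ρ
  have h0 : analyticOrderAt riemannXi ρ ≠ 0 := fun h' => ha.analyticOrderAt_eq_zero.mp h' h
  have ht : analyticOrderAt riemannXi ρ ≠ ⊤ := by
    intro h'
    have hA : AnalyticOnNhd ℂ riemannXi Set.univ := fun z _ => differentiable_riemannXi.analyticAt z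
    have := hA.eqOn_zero_of_preconnected_of_eventuallyEq_zero isPreconnected_univ (Set.mem_univ ρ)
      (analyticOrderAt_eq_top.mp h')
    have h1 := this (Set.mem_univ 1)
    rw [riemannXi_one] at h1
    simp at h1
  rw [xiMult]
  have : analyticOrderNatAt riemannXi ρ ≠ 0 := by
    intro h'
    apply h0
    rw [← Nat.cast_analyticOrderNatAt ht, h']
    rfl
  exact_mod_cast Nat.one_le_iff_ne_zero.mpr this

lemma mem_zerosUpTo_riemannXi {ρ : ℂ} {R : ℝ} :
    ρ ∈ zerosUpTo riemannXi R ↔ riemannXi ρ = 0 ∧ ‖ρ‖ ≤ R :=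
  mem_zerosUpTo differentiable_riemannXi (w := 1) (by simp [riemannXi_one])

/-- Finite sums over zeros are bounded by the full sum, for nonnegative summands. -/
lemma sum_le_of_tendsto_sum_zerosUpTo {f : ℂ → ℝ} {l : ℝ}
    (hf : ∀ ρ, riemannXi ρ = 0 → 0 ≤ f ρ)
    (h : Tendsto (fun R => ∑ ρ ∈ zerosUpTo riemannXi R, f ρ) atTop (𝓝 l))
    (s : Finset ℂ) (hs : ∀ ρ ∈ s, riemannXi ρ = 0) : ∑ ρ ∈ s, f ρ ≤ l := by
  refine ge_of_tendsto h ?_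
  filter_upwards [eventually_ge_atTop (∑ ρ ∈ s, ‖ρ‖)] with R hR
  refine Finset.sum_le_sum_of_subset_of_nonneg ?_
    fun ρ hρ _ => hf ρ (mem_zerosUpTo_riemannXi.mp hρ).1
  intro ρ hρ
  exact mem_zerosUpTo_riemannXi.mpr ⟨hs ρ hρ,
    (Finset.single_le_sum (f := fun ρ : ℂ => ‖ρ‖) (fun _ _ => norm_nonneg _) hρ).trans hR⟩

/-- Summation over zeros in order of absolute value agrees with unconditional summation. -/
lemma tendsto_sum_zerosUpTo_of_summable {f : ℂ → ℂ} (hf : Summable f)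
    (h0 : ∀ ρ, riemannXi ρ ≠ 0 → f ρ = 0) :
    Tendsto (fun R => ∑ ρ ∈ zerosUpTo riemannXi R, f ρ) atTop (𝓝 (∑' ρ, f ρ)) := by
  have h1 : ∀ R, ∑ ρ ∈ zerosUpTo riemannXi R, f ρ =
      ∑' ρ, if ρ ∈ zerosUpTo riemannXi R then f ρ else 0 := by
    intro R
    rw [tsum_eq_sum (s := zerosUpTo riemannXi R) (fun ρ hρ => if_neg hρ)]
    exact Finset.sum_congr rfl fun ρ hρ => (if_pos hρ).symm
  simp_rw [h1]
  refine tendsto_tsum_of_dominated_convergence (bound := fun ρ => ‖f ρ‖) hf.norm ?_ ?_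
  · intro ρ
    refine tendsto_const_nhds.congr' ?_
    filter_upwards [eventually_ge_atTop ‖ρ‖] with R hR
    by_cases hρ : riemannXi ρ = 0
    · rw [if_pos (mem_zerosUpTo_riemannXi.mpr ⟨hρ, hR⟩)]
    · simp [h0 ρ hρ]
  · refine Eventually.of_forall fun R ρ => ?_
    split_ifs
    · rfl
    · simp

lemma logDeriv_riemannXi_zero : logDeriv riemannXi 0 = -(xiLogDerivOne : ℂ) := by
  have h := logDeriv_riemannXi_one_sub 1
  rw [sub_self, logDeriv_riemannXi_one] at h
  exact h

lemma tendsto_sum_zeros_one : Tendsto (fun R => ∑ ρ ∈ zerosUpTo riemannXi R,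
    (xiMult ρ : ℂ) * ((1 - ρ)⁻¹ + ρ⁻¹)) atTop (𝓝 (2 * xiLogDerivOne)) := by
  have h := tendsto_sum_zeros_riemannXi (s := 1) (s' := 0) (by simp [riemannXi_one])
    (by simp [riemannXi_zero])
  rw [logDeriv_riemannXi_one, logDeriv_riemannXi_zero] at h
  convert h using 2
  · refine Finset.sum_congr rfl fun ρ _ => ?_
    rw [zero_sub, inv_neg, sub_neg_eq_add, xiMult]
    simp
  · ring

lemma inv_one_add_sq_le_re {ρ : ℂ} (h0 : 0 < ρ.re) (h1 : ρ.re < 1) :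
    1 / (1 + ρ.im ^ 2) ≤ ((1 - ρ)⁻¹ + ρ⁻¹).re := by
  have e1 : ((1 - ρ)⁻¹ + ρ⁻¹).re =
      (1 - ρ.re) / ((1 - ρ.re) ^ 2 + ρ.im ^ 2) + ρ.re / (ρ.re ^ 2 + ρ.im ^ 2) := by
    simp [Complex.inv_re, Complex.normSq_apply]
    ring
  rw [e1]
  have a1 : (1 - ρ.re) / (1 + ρ.im ^ 2) ≤ (1 - ρ.re) / ((1 - ρ.re) ^ 2 + ρ.im ^ 2) := by
    apply div_le_div_of_nonneg_left (by linarith)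
    · nlinarith [sq_nonneg ρ.im]
    · nlinarith
  have a2 : ρ.re / (1 + ρ.im ^ 2) ≤ ρ.re / (ρ.re ^ 2 + ρ.im ^ 2) := by
    apply div_le_div_of_nonneg_left (by linarith)
    · nlinarith [sq_nonneg ρ.im]
    · nlinarith
  calc 1 / (1 + ρ.im ^ 2) = (1 - ρ.re) / (1 + ρ.im ^ 2) + ρ.re / (1 + ρ.im ^ 2) := by ring
    _ ≤ _ := add_le_add a1 a2

lemma sum_zeros_one_le (s : Finset ℂ) (hs : ∀ ρ ∈ s, riemannXi ρ = 0) :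
    ∑ ρ ∈ s, xiMult ρ * ((1 - ρ)⁻¹ + ρ⁻¹).re ≤ 2 * xiLogDerivOne := by
  have h : Tendsto (fun R => ∑ ρ ∈ zerosUpTo riemannXi R,
      xiMult ρ * ((1 - ρ)⁻¹ + ρ⁻¹).re) atTop (𝓝 (2 * xiLogDerivOne)) := by
    have h2 := (Complex.continuous_re.tendsto _).comp tendsto_sum_zeros_one
    have e : (2 * (xiLogDerivOne : ℂ)).re = 2 * xiLogDerivOne := by simp
    rw [e] at h2
    refine h2.congr fun R => ?_
    simp only [Function.comp, Complex.re_sum, Complex.re_ofReal_mul]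
  refine sum_le_of_tendsto_sum_zerosUpTo (fun ρ hρ => ?_) h s hs
  have := re_mem_Ioo_of_riemannXi_eq_zero hρ
  exact mul_nonneg (xiMult_nonneg ρ)
    ((by positivity : (0 : ℝ) ≤ _).trans (inv_one_add_sq_le_re this.1 this.2))

lemma riemannXi_one_sub_eq_zero {ρ : ℂ} (hρ : riemannXi ρ = 0) : riemannXi (1 - ρ) = 0 := by
  rw [riemannXi_one_sub, hρ]

lemma ne_one_sub_of_riemannXi_eq_zero {ρ : ℂ} (hρ : riemannXi ρ = 0) : ρ ≠ 1 - ρ := by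
  intro h
  have h2 : ρ = 1 / 2 := by linear_combination h / 2
  have h1 := sum_zeros_one_le {ρ} (by simpa using hρ)
  rw [Finset.sum_singleton, h2] at h1
  have h3 := one_le_xiMult hρ
  have h4 := xiLogDerivOne_le
  rw [h2] at h3
  norm_num at h1
  linarith

lemma le_im_sq_of_riemannXi_eq_zero {ρ : ℂ} (hρ : riemannXi ρ = 0) : 39 ≤ ρ.im ^ 2 := by
  have hne := ne_one_sub_of_riemannXi_eq_zero hρ
  have h1 := sum_zeros_one_le {ρ, 1 - ρ} (by
    intro x hx
    rcases Finset.mem_insert.mp hx with rfl | hx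
    · exact hρ
    · rw [Finset.mem_singleton.mp hx]
      exact riemannXi_one_sub_eq_zero hρ)
  rw [Finset.sum_pair hne, xiMult_one_sub, sub_sub_cancel, add_comm (ρ⁻¹)] at h1
  obtain ⟨h2, h3⟩ := re_mem_Ioo_of_riemannXi_eq_zero hρ
  have h4 := inv_one_add_sq_le_re h2 h3
  have h5 := one_le_xiMult hρ
  have h6 := xiLogDerivOne_le
  have h7 : (0 : ℝ) < 1 / (1 + ρ.im ^ 2) := by positivity
  have h8 : 1 / (1 + ρ.im ^ 2) ≤ 0.025 := by nlinarith
  rw [div_le_iff₀ (by positivity)] at h8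
  linarith

/-- The summand of the absolutely convergent sum over zeros. -/
noncomputable def xiWeight (ρ : ℂ) : ℝ := xiMult ρ / ρ.im ^ 2

lemma xiWeight_nonneg (ρ : ℂ) : 0 ≤ xiWeight ρ := div_nonneg (xiMult_nonneg ρ) (sq_nonneg _)

lemma xiWeight_eq_zero {ρ : ℂ} (h : riemannXi ρ ≠ 0) : xiWeight ρ = 0 := by
  rw [xiWeight, xiMult_eq_zero h, zero_div]

lemma xiWeight_one_sub (ρ : ℂ) : xiWeight (1 - ρ) = xiWeight ρ := by
  simp [xiWeight, xiMult_one_sub]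

/-- Finite sums over arbitrary points are bounded by bounds for finite sums over zeros. -/
lemma sum_le_of_forall_sum_zeros_le {f : ℂ → ℝ} {c : ℝ} (h0 : ∀ ρ, riemannXi ρ ≠ 0 → f ρ = 0)
    (h : ∀ s : Finset ℂ, (∀ ρ ∈ s, riemannXi ρ = 0) → ∑ ρ ∈ s, f ρ ≤ c) (s : Finset ℂ) :
    ∑ ρ ∈ s, f ρ ≤ c := by
  classical
  rw [← Finset.sum_filter_of_ne (p := fun ρ => riemannXi ρ = 0)]
  · exact h _ fun ρ hρ => (Finset.mem_filter.mp hρ).2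
  · intro ρ _ hne
    by_contra h'
    exact hne (h0 ρ h')

lemma sum_xiWeight_le (s : Finset ℂ) : ∑ ρ ∈ s, xiWeight ρ ≤ 0.0513 := by
  refine sum_le_of_forall_sum_zeros_le (fun ρ => xiWeight_eq_zero) (fun s hs => ?_) s
  calc ∑ ρ ∈ s, xiWeight ρ ≤ ∑ ρ ∈ s, (40 / 39) * (xiMult ρ * ((1 - ρ)⁻¹ + ρ⁻¹).re) := by
        refine Finset.sum_le_sum fun ρ hρ => ?_
        obtain ⟨h2, h3⟩ := re_mem_Ioo_of_riemannXi_eq_zero (hs ρ hρ)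
        have h4 := inv_one_add_sq_le_re h2 h3
        have h5 := le_im_sq_of_riemannXi_eq_zero (hs ρ hρ)
        have h6 : 1 / ρ.im ^ 2 ≤ 40 / 39 * (1 / (1 + ρ.im ^ 2)) := by
          rw [div_mul_div_comm, div_le_div_iff₀ (by positivity) (by positivity)]
          linarith
        calc xiWeight ρ = xiMult ρ * (1 / ρ.im ^ 2) := by rw [xiWeight]; ring
          _ ≤ xiMult ρ * (40 / 39 * (1 / (1 + ρ.im ^ 2))) :=
            mul_le_mul_of_nonneg_left h6 (xiMult_nonneg ρ)
          _ ≤ xiMult ρ * (40 / 39 * ((1 - ρ)⁻¹ + ρ⁻¹).re) := by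
            refine mul_le_mul_of_nonneg_left ?_ (xiMult_nonneg ρ)
            linarith
          _ = _ := by ring
    _ = (40 / 39) * ∑ ρ ∈ s, xiMult ρ * ((1 - ρ)⁻¹ + ρ⁻¹).re := by rw [Finset.mul_sum]
    _ ≤ 0.0513 := by linarith [sum_zeros_one_le s hs, xiLogDerivOne_le]

lemma summable_xiWeight : Summable xiWeight :=
  summable_of_sum_le xiWeight_nonneg sum_xiWeight_le

lemma tsum_xiWeight_le : ∑' ρ, xiWeight ρ ≤ 0.0513 :=
  summable_xiWeight.tsum_le_of_sum_le sum_xiWeight_le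

/-- Symmetrised partial fraction expansion of the logarithmic derivative. -/
lemma tendsto_sum_zeros_symm {s : ℂ} (hs : 1 < s.re) :
    Tendsto (fun R => ∑ ρ ∈ zerosUpTo riemannXi R,
      (xiMult ρ : ℂ) * ((s - ρ)⁻¹ + (s - (1 - ρ))⁻¹)) atTop (𝓝 (2 * logDeriv riemannXi s)) := by
  have hs1 := riemannXi_ne_zero_of_one_le_re hs.le
  have h := tendsto_sum_zeros_riemannXi (s := s) (s' := 1 - s) hs1
    (by rwa [riemannXi_one_sub])
  rw [logDeriv_riemannXi_one_sub, sub_neg_eq_add, ← two_mul] at h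
  refine h.congr fun R => Finset.sum_congr rfl fun ρ _ => ?_
  rw [show 1 - s - ρ = -(s - (1 - ρ)) by ring, inv_neg, sub_neg_eq_add, xiMult]
  simp

lemma re_inv_sub_pos {s ρ : ℂ} (h : ρ.re < s.re) : 0 < (s - ρ)⁻¹.re := by
  rw [Complex.inv_re]
  have h0 : s - ρ ≠ 0 := by
    intro h'
    rw [sub_eq_zero.mp h'] at h
    exact lt_irrefl _ h
  refine div_pos (by simpa using h) (Complex.normSq_pos.mpr h0)

lemma sum_zeros_re_le {s : ℂ} (hs : 1 < s.re) (Z : Finset ℂ) (hZ : ∀ ρ ∈ Z, riemannXi ρ = 0) :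
    ∑ ρ ∈ Z, xiMult ρ * ((s - ρ)⁻¹.re + (s - (1 - ρ))⁻¹.re) ≤ 2 * (logDeriv riemannXi s).re := by
  have h2 := (Complex.continuous_re.tendsto _).comp (tendsto_sum_zeros_symm hs)
  have e : (2 * logDeriv riemannXi s).re = 2 * (logDeriv riemannXi s).re := by simp
  rw [e] at h2
  refine sum_le_of_tendsto_sum_zerosUpTo (f := fun ρ => xiMult ρ * ((s - ρ)⁻¹.re +
    (s - (1 - ρ))⁻¹.re)) (fun ρ hρ => ?_) (h2.congr fun R => ?_) Z hZ
  · obtain ⟨h2, h3⟩ := re_mem_Ioo_of_riemannXi_eq_zero hρ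
    have a1 := re_inv_sub_pos (s := s) (ρ := ρ) (by linarith)
    have a2 := re_inv_sub_pos (s := s) (ρ := 1 - ρ) (by simp; linarith)
    exact mul_nonneg (xiMult_nonneg ρ) (by linarith)
  · simp only [Function.comp, Complex.re_sum, Complex.re_ofReal_mul, Complex.add_re]

lemma logDeriv_riemannXi_re_nonneg {s : ℂ} (hs : 1 < s.re) : 0 ≤ (logDeriv riemannXi s).re := by
  have := sum_zeros_re_le hs ∅ (by simp)
  simp at this
  linarith

lemma re_inv_sub_le_logDeriv {s ρ : ℂ} (hs : 1 < s.re) (hρ : riemannXi ρ = 0) :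
    (s - ρ)⁻¹.re ≤ (logDeriv riemannXi s).re := by
  have hne := ne_one_sub_of_riemannXi_eq_zero hρ
  have h1 := sum_zeros_re_le hs {ρ, 1 - ρ} (by
    intro x hx
    rcases Finset.mem_insert.mp hx with rfl | hx
    · exact hρ
    · rw [Finset.mem_singleton.mp hx]
      exact riemannXi_one_sub_eq_zero hρ)
  rw [Finset.sum_pair hne, xiMult_one_sub, sub_sub_cancel] at h1
  obtain ⟨h2, h3⟩ := re_mem_Ioo_of_riemannXi_eq_zero hρ
  have h5 := one_le_xiMult hρ
  have a1 := re_inv_sub_pos (s := s) (ρ := ρ) (by linarith)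
  have a2 := re_inv_sub_pos (s := s) (ρ := 1 - ρ) (by simp; linarith)
  nlinarith

end Zeros

section TrivialZeros

lemma antitoneOn_half_log_sub_inv :
    AntitoneOn (fun v : ℝ => (Real.log (v + 1) - Real.log (v - 1)) / 2 - 1 / v) (Set.Ioi 1) := by
  have hd : ∀ v ∈ Set.Ioi (1 : ℝ), HasDerivAt
      (fun v : ℝ => (Real.log (v + 1) - Real.log (v - 1)) / 2 - 1 / v)
      ((1 / (v + 1) - 1 / (v - 1)) / 2 - (-1 / v ^ 2)) v := by
    intro v hv
    have hv1 : (1 : ℝ) < v := hv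
    have h1 : HasDerivAt (fun v : ℝ => Real.log (v + 1)) (1 / (v + 1)) v :=
      ((hasDerivAt_id v).add_const 1).log (by simp; linarith)
    have h2 : HasDerivAt (fun v : ℝ => Real.log (v - 1)) (1 / (v - 1)) v :=
      ((hasDerivAt_id v).sub_const 1).log (by simp; linarith)
    have h3 : HasDerivAt (fun v : ℝ => 1 / v) (-1 / v ^ 2) v := by
      have h := hasDerivAt_inv (show v ≠ 0 by linarith)
      simpa [one_div, neg_div] using h
    exact ((h1.sub h2).div_const 2).sub h3
  refine antitoneOn_of_deriv_nonpos (convex_Ioi 1)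
    (fun v hv => (hd v hv).continuousAt.continuousWithinAt)
    (fun v hv => (hd v (interior_subset hv)).differentiableAt.differentiableWithinAt) ?_
  intro v hv
  have hv1 : (1 : ℝ) < v := interior_subset hv
  rw [(hd v hv1).deriv]
  have h1 : 0 < v - 1 := by linarith
  have : (1 / (v + 1) - 1 / (v - 1)) / 2 - (-1 / v ^ 2) = -1 / (v ^ 2 * (v + 1) * (v - 1)) := by
    field_simp
    ring
  rw [this]
  exact div_nonpos_of_nonpos_of_nonneg (by norm_num) (by positivity)

lemma midpoint_le {w v t : ℝ} (hv : 0 ≤ v) (hvw : v < w) :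
    2 * (t ^ 2 / (w * (w ^ 2 + t ^ 2))) ≤ t ^ 2 / ((w - v) * ((w - v) ^ 2 + t ^ 2)) +
      t ^ 2 / ((w + v) * ((w + v) ^ 2 + t ^ 2)) := by
  have hw : 0 < w := hv.trans_lt hvw
  have h1 : 0 < w - v := by linarith
  have h2 : 0 < w + v := by linarith
  set p := t ^ 2 / ((w - v) * ((w - v) ^ 2 + t ^ 2)) with hp
  set q := t ^ 2 / ((w + v) * ((w + v) ^ 2 + t ^ 2)) with hq
  set r := t ^ 2 / (w * (w ^ 2 + t ^ 2)) with hr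
  have hp0 : 0 ≤ p := by positivity
  have hq0 : 0 ≤ q := by positivity
  have hr0 : 0 ≤ r := by positivity
  have hpoly : ((w - v) * ((w - v) ^ 2 + t ^ 2)) * ((w + v) * ((w + v) ^ 2 + t ^ 2)) ≤
      (w * (w ^ 2 + t ^ 2)) * (w * (w ^ 2 + t ^ 2)) := by
    have e : (w * (w ^ 2 + t ^ 2)) * (w * (w ^ 2 + t ^ 2)) -
        ((w - v) * ((w - v) ^ 2 + t ^ 2)) * ((w + v) * ((w + v) ^ 2 + t ^ 2)) =
        v ^ 2 * (3 * w ^ 2 * (w ^ 2 - v ^ 2) + t ^ 4 + 2 * t ^ 2 * v ^ 2 + v ^ 4) := by ring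
    have : v ^ 2 ≤ w ^ 2 := by nlinarith
    have : 0 ≤ v ^ 2 * (3 * w ^ 2 * (w ^ 2 - v ^ 2) + t ^ 4 + 2 * t ^ 2 * v ^ 2 + v ^ 4) := by
      have : 0 ≤ w ^ 2 - v ^ 2 := by linarith
      positivity
    linarith
  have hpq : r ^ 2 ≤ p * q := by
    have h := div_le_div_of_nonneg_left (a := t ^ 2 * t ^ 2) (by positivity) (by positivity) hpoly
    rwa [hp, hq, hr, div_mul_div_comm, sq (t ^ 2 / _), div_mul_div_comm]
  nlinarith [sq_nonneg (p - q), sq_nonneg (p + q - 2 * r)]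

lemma le_log_sub_log {w t : ℝ} (hw : 1 < w) :
    t ^ 2 / (w * (w ^ 2 + t ^ 2)) ≤
      (Real.log (1 + t ^ 2 / (w - 1) ^ 2) - Real.log (1 + t ^ 2 / (w + 1) ^ 2)) / 4 := by
  have hG : ∀ y : ℝ, 0 < y → HasDerivAt (fun y => Real.log (1 + t ^ 2 / y ^ 2) / 2)
      (-(t ^ 2 / (y * (y ^ 2 + t ^ 2)))) y := by
    intro y hy
    have h1 : HasDerivAt (fun y : ℝ => 1 + t ^ 2 / y ^ 2) (t ^ 2 * (-(2 * y) / (y ^ 2) ^ 2)) y := by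
      have h := ((hasDerivAt_pow 2 y).inv (by positivity)).const_mul (t ^ 2)
      simpa [div_eq_mul_inv] using h.const_add 1
    have h2 := (h1.log (by positivity)).div_const 2
    refine h2.congr_deriv ?_
    have : y ^ 2 + t ^ 2 ≠ 0 := by positivity
    field_simp
  set F : ℝ → ℝ := fun v => Real.log (1 + t ^ 2 / (w - v) ^ 2) / 2 -
    Real.log (1 + t ^ 2 / (w + v) ^ 2) / 2 - 2 * (t ^ 2 / (w * (w ^ 2 + t ^ 2))) * v with hF
  have hFd : ∀ v ∈ Set.Icc (0 : ℝ) 1, HasDerivAt F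
      (t ^ 2 / ((w - v) * ((w - v) ^ 2 + t ^ 2)) + t ^ 2 / ((w + v) * ((w + v) ^ 2 + t ^ 2)) -
        2 * (t ^ 2 / (w * (w ^ 2 + t ^ 2)))) v := by
    intro v hv
    have h1 := (hG (w - v) (by linarith [hv.2])).comp v ((hasDerivAt_id v).const_sub w)
    have h2 := (hG (w + v) (by linarith [hv.1])).comp v ((hasDerivAt_id v).const_add w)
    have h3 := (hasDerivAt_id v).const_mul (2 * (t ^ 2 / (w * (w ^ 2 + t ^ 2))))
    exact ((h1.sub h2).sub h3).congr_deriv (by ring)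
  have hmono : MonotoneOn F (Set.Icc 0 1) := by
    refine monotoneOn_of_deriv_nonneg (convex_Icc 0 1)
      (fun v hv => (hFd v hv).continuousAt.continuousWithinAt)
      (fun v hv => (hFd v (interior_subset hv)).differentiableAt.differentiableWithinAt) ?_
    intro v hv
    have hv' := interior_subset hv
    rw [(hFd v hv').deriv]
    linarith [midpoint_le (t := t) hv'.1 (by linarith [hv'.2] : v < w)]
  have := hmono (Set.left_mem_Icc.mpr zero_le_one) (Set.right_mem_Icc.mpr zero_le_one) zero_le_one
  simp only [hF] at this
  simp only [sub_zero, add_zero, mul_zero, mul_one, sub_self] at this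
  linarith

lemma sum_inv_sub_inv_le {S : ℝ} (hS : 1 ≤ S) (n : ℕ) :
    ∑ k ∈ Finset.range n, (1 / (2 * k + 3) - 1 / (S + 2 * k + 2)) ≤
      Real.log ((S + 1) / 2) / 2 := by
  have h : ∀ k ∈ Finset.range n, (1 / (2 * k + 3) - 1 / (S + 2 * k + 2) : ℝ) ≤
      (Real.log (S + 2 * k + 1) - Real.log (2 * k + 2)) / 2 -
      (Real.log (S + 2 * (k + 1 : ℕ) + 1) - Real.log (2 * (k + 1 : ℕ) + 2)) / 2 := by
    intro k _
    have hk : (0 : ℝ) ≤ k := Nat.cast_nonneg k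
    have := antitoneOn_half_log_sub_inv (a := 2 * k + 3) (b := S + 2 * k + 2)
      (by simp; linarith) (by simp; linarith) (by linarith)
    simp only at this
    push_cast
    rw [show (2 * k + 3 + 1 : ℝ) = 2 * (k + 1) + 2 by ring,
      show (2 * k + 3 - 1 : ℝ) = 2 * k + 2 by ring,
      show (S + 2 * k + 2 + 1 : ℝ) = S + 2 * (k + 1) + 1 by ring,
      show (S + 2 * k + 2 - 1 : ℝ) = S + 2 * k + 1 by ring] at this
    linarith
  refine (Finset.sum_le_sum h).trans ?_
  rw [Finset.sum_range_sub' (fun k : ℕ => (Real.log (S + 2 * k + 1) - Real.log (2 * k + 2)) / 2)]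
  have h1 : Real.log (2 * n + 2) ≤ Real.log (S + 2 * n + 1) :=
    Real.log_le_log (by positivity) (by linarith)
  rw [Real.log_div (by linarith) (by norm_num)]
  simp only [Nat.cast_zero, mul_zero, add_zero, zero_add]
  linarith

lemma summable_trivialZeroSum {s : ℂ} (hs : -2 < s.re) :
    Summable fun k : ℕ => (1 / (2 * k + 3) - 1 / (s + 2 * k + 2) : ℂ) :=
  (trivialZeroSum_eq_and_summable hs).1

lemma re_trivialZeroSum_le_of_sum_le {s : ℂ} (hs : -2 < s.re) {c : ℝ}
    (h : ∀ n, ∑ k ∈ Finset.range n, (1 / (2 * k + 3) - 1 / (s + 2 * k + 2) : ℂ).re ≤ c) :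
    (trivialZeroSum s).re ≤ c := by
  rw [trivialZeroSum, Complex.re_tsum (summable_trivialZeroSum hs)]
  exact (Complex.reCLM.summable (summable_trivialZeroSum hs)).hasSum.tendsto_sum_nat |>
    fun h' => le_of_tendsto' h' h

lemma re_trivialZeroSum_ofReal_le {S : ℝ} (hS : 1 ≤ S) :
    (trivialZeroSum S).re ≤ Real.log ((S + 1) / 2) / 2 := by
  refine re_trivialZeroSum_le_of_sum_le (by simp; linarith) fun n => ?_
  refine le_of_eq_of_le (Finset.sum_congr rfl fun k _ => ?_) (sum_inv_sub_inv_le hS n)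
  rw [← Complex.ofReal_re (1 / (2 * k + 3) - 1 / (S + 2 * k + 2))]
  push_cast
  rfl

lemma re_trivialZeroSum_le {x : ℝ} (hx : 0 ≤ x) (t : ℝ) :
    (trivialZeroSum (1 + x + t * Complex.I)).re ≤ Real.log (1 + t ^ 2 / 4) / 4 + x / 4 := by
  refine re_trivialZeroSum_le_of_sum_le (by simp; linarith) fun n => ?_
  have h : ∀ k ∈ Finset.range n,
      (1 / (2 * k + 3) - 1 / ((1 + x + t * Complex.I : ℂ) + 2 * k + 2) : ℂ).re ≤
      (1 / (2 * k + 3) - 1 / ((1 + x) + 2 * k + 2)) +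
      (Real.log (1 + t ^ 2 / (x + 2 * k + 2) ^ 2) / 4 -
        Real.log (1 + t ^ 2 / (x + 2 * (k + 1 : ℕ) + 2) ^ 2) / 4) := by
    intro k _
    have hk : (0 : ℝ) ≤ k := Nat.cast_nonneg k
    set w : ℝ := x + 2 * k + 3 with hw
    have hw0 : 1 < w := by linarith
    have e1 : ((1 + x + t * Complex.I : ℂ) + 2 * k + 2) = ⟨w, t⟩ := by
      apply Complex.ext <;> simp [hw]
      ring
    have e2 : (1 / (2 * k + 3) - 1 / (⟨w, t⟩ : ℂ) : ℂ).re =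
        1 / (2 * k + 3) - w / (w ^ 2 + t ^ 2) := by
      rw [Complex.sub_re, one_div (⟨w, t⟩ : ℂ), Complex.inv_re, Complex.normSq_apply]
      congr 1
      · rw [← Complex.ofReal_re (1 / (2 * k + 3))]
        push_cast
        rfl
      · simp only [sq]
    rw [e1, e2]
    have h1 := le_log_sub_log (t := t) hw0
    have e3 : w - 1 = x + 2 * k + 2 := by rw [hw]; ring
    have e4 : w + 1 = x + 2 * (k + 1 : ℕ) + 2 := by rw [hw]; push_cast; ring
    have e5 : (1 + x) + 2 * k + 2 = w := by rw [hw]; ring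
    rw [e3, e4] at h1
    rw [e5]
    have e6 : t ^ 2 / (w * (w ^ 2 + t ^ 2)) = 1 / w - w / (w ^ 2 + t ^ 2) := by
      have : w ^ 2 + t ^ 2 ≠ 0 := by positivity
      field_simp
      ring
    linarith
  refine (Finset.sum_le_sum h).trans ?_
  rw [Finset.sum_add_distrib,
    Finset.sum_range_sub' (fun k : ℕ => Real.log (1 + t ^ 2 / (x + 2 * k + 2) ^ 2) / 4)]
  have h1 := sum_inv_sub_inv_le (S := 1 + x) (by linarith) n
  have h2 : Real.log ((1 + x + 1) / 2) ≤ x / 2 := by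
    have := Real.log_le_sub_one_of_pos (x := (1 + x + 1) / 2) (by linarith)
    linarith
  have h3 : 0 ≤ Real.log (1 + t ^ 2 / (x + 2 * n + 2) ^ 2) := by
    apply Real.log_nonneg
    have : 0 ≤ t ^ 2 / (x + 2 * n + 2) ^ 2 := by positivity
    linarith
  have h4 : Real.log (1 + t ^ 2 / (x + 2 * (0 : ℕ) + 2) ^ 2) ≤ Real.log (1 + t ^ 2 / 4) := by
    apply Real.log_le_log (by positivity)
    have : t ^ 2 / (x + 2 * (0 : ℕ) + 2) ^ 2 ≤ t ^ 2 / 4 := by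
      apply div_le_div_of_nonneg_left (by positivity) (by norm_num)
      push_cast
      nlinarith
    linarith
  linarith

end TrivialZeros

section ZeroFree

lemma neg_logDeriv_riemannZeta_eq_LSeries {s : ℂ} (hs : 1 < s.re) :
    -logDeriv riemannZeta s = LSeries (fun n => (ArithmeticFunction.vonMangoldt n : ℂ)) s := by
  rw [ArithmeticFunction.LSeries_vonMangoldt_eq_deriv_riemannZeta_div hs, logDeriv_apply, neg_div]

lemma re_term_vonMangoldt (σ t : ℝ) (n : ℕ) :
    (LSeries.term (fun n => (ArithmeticFunction.vonMangoldt n : ℂ)) (σ + t * Complex.I) n).re =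
      ArithmeticFunction.vonMangoldt n * (n : ℝ) ^ (-σ) * Real.cos (t * Real.log n) := by
  rcases eq_or_ne n 0 with rfl | hn
  · simp
  have hn' : (n : ℂ) ≠ 0 := Nat.cast_ne_zero.mpr hn
  have hn0 : (0 : ℝ) < n := Nat.cast_pos.mpr (Nat.pos_of_ne_zero hn)
  rw [LSeries.term_of_ne_zero hn, div_eq_mul_inv, ← Complex.cpow_neg, Complex.re_ofReal_mul,
    mul_assoc]
  congr 1
  rw [Complex.cpow_def_of_ne_zero hn', Complex.exp_re, Real.rpow_def_of_pos hn0,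
    ← Complex.natCast_log]
  simp only [Complex.mul_re, Complex.mul_im, Complex.neg_re, Complex.neg_im, Complex.add_re,
    Complex.add_im, Complex.ofReal_re, Complex.ofReal_im, Complex.I_re, Complex.I_im]
  rw [← Real.cos_neg]
  ring_nf

lemma three_four_one {σ : ℝ} (hσ : 1 < σ) (t : ℝ) :
    0 ≤ 3 * (-logDeriv riemannZeta σ).re + 4 * (-logDeriv riemannZeta (σ + t * Complex.I)).re +
      (-logDeriv riemannZeta (σ + (2 * t : ℝ) * Complex.I)).re := by
  have key : ∀ u : ℝ, HasSum (fun n : ℕ => ArithmeticFunction.vonMangoldt n * (n : ℝ) ^ (-σ) *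
      Real.cos (u * Real.log n)) (-logDeriv riemannZeta (σ + u * Complex.I)).re := by
    intro u
    have hs : 1 < (σ + u * Complex.I : ℂ).re := by simpa using hσ
    have h := (ArithmeticFunction.LSeriesSummable_vonMangoldt hs).LSeriesHasSum
    have h2 := Complex.hasSum_re h
    rw [neg_logDeriv_riemannZeta_eq_LSeries hs]
    simpa only [re_term_vonMangoldt] using h2
  have h0 := key 0
  simp only [Complex.ofReal_zero, zero_mul, add_zero] at h0
  have h := ((h0.mul_left 3).add ((key t).mul_left 4)).add (key (2 * t))
  refine h.nonneg fun n => ?_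
  have e : 2 * t * Real.log n = 2 * (t * Real.log n) := by ring
  rw [e, Real.cos_two_mul, Real.cos_zero]
  have : 0 ≤ ArithmeticFunction.vonMangoldt n * (n : ℝ) ^ (-σ) :=
    mul_nonneg ArithmeticFunction.vonMangoldt_nonneg (by positivity)
  nlinarith [mul_nonneg this (sq_nonneg (1 + Real.cos (t * Real.log n)))]

lemma re_neg_logDeriv_riemannZeta_le {x : ℝ} (hx : 0 < x) (t : ℝ) :
    (-logDeriv riemannZeta ((1 + x : ℝ) + t * Complex.I)).re ≤ x / (x ^ 2 + t ^ 2) - 0.55 +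
      Real.log (1 + t ^ 2 / 4) / 4 + x / 4 -
      (logDeriv riemannXi ((1 + x : ℝ) + t * Complex.I)).re := by
  rw [neg_logDeriv_riemannZeta (by simpa using hx)]
  have h1 := re_trivialZeroSum_le hx.le t
  have h2 := xiLogDerivOne_sub_le
  have e : (1 / (((1 + x : ℝ) : ℂ) + t * Complex.I - 1)).re = x / (x ^ 2 + t ^ 2) := by
    rw [one_div, Complex.inv_re, Complex.normSq_apply]
    simp [sq]
  have e2 : ((1 + x : ℝ) : ℂ) = 1 + x := by push_cast; rfl
  rw [Complex.sub_re, Complex.add_re, Complex.add_re, e, Complex.ofReal_re, e2]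
  linarith

/-- The logarithmic quantity governing the zero-free region. -/
noncomputable def xiHeight (ρ : ℂ) : ℝ := Real.log (1 + ρ.im ^ 2 / 400)

lemma xiHeight_nonneg (ρ : ℂ) : 0 ≤ xiHeight ρ :=
  Real.log_nonneg (by linarith [show 0 ≤ ρ.im ^ 2 / 400 by positivity])

lemma log_ten_le : Real.log 10 ≤ 2.3106 := by
  have h : Real.log (10 ^ 3) ≤ Real.log (2 ^ 10) := Real.log_le_log (by norm_num) (by norm_num)
  rw [Real.log_pow, Real.log_pow] at h
  push_cast at h
  linarith [Real.log_two_lt_d9]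

theorem zero_free_region {ρ : ℂ} (hρ : riemannXi ρ = 0) :
    1 / (1 - ρ.re) ≤ 32.1 + 17.44 * xiHeight ρ := by
  set L := xiHeight ρ with hL
  set Q : ℝ := 2.3 + 1.25 * L with hQ
  have hL0 : 0 ≤ L := xiHeight_nonneg ρ
  have hγ := le_im_sq_of_riemannXi_eq_zero hρ
  obtain ⟨hβ0, hβ1⟩ := re_mem_Ioo_of_riemannXi_eq_zero hρ
  have hQ0 : 2.3 ≤ Q := by linarith
  set x : ℝ := 0.464 / Q with hx
  have hx0 : 0 < x := by positivity
  have hx1 : x ≤ 0.2018 := by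
    rw [hx, div_le_iff₀ (by linarith)]
    linarith
  have h341 := three_four_one (σ := 1 + x) (by linarith) ρ.im
  have b0 := re_neg_logDeriv_riemannZeta_le hx0 0
  have b1 := re_neg_logDeriv_riemannZeta_le hx0 ρ.im
  have b2 := re_neg_logDeriv_riemannZeta_le hx0 (2 * ρ.im)
  have c0 := logDeriv_riemannXi_re_nonneg (s := (1 + x : ℝ) + (0 : ℝ) * Complex.I)
    (by simpa using hx0)
  have c1 := re_inv_sub_le_logDeriv (s := (1 + x : ℝ) + ρ.im * Complex.I) (by simpa using hx0) hρ
  have c2 := logDeriv_riemannXi_re_nonneg (s := (1 + x : ℝ) + (2 * ρ.im : ℝ) * Complex.I)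
    (by simpa using hx0)
  have e1 : (((1 + x : ℝ) : ℂ) + ρ.im * Complex.I - ρ)⁻¹.re = 1 / (1 + x - ρ.re) := by
    have : ((1 + x : ℝ) : ℂ) + ρ.im * Complex.I - ρ = ((1 + x - ρ.re : ℝ) : ℂ) := by
      apply Complex.ext <;> simp
    rw [this, ← Complex.ofReal_inv, Complex.ofReal_re, one_div]
  rw [e1] at c1
  simp only [Complex.ofReal_zero, zero_mul, add_zero] at b0 c0
  have d0 : x / (x ^ 2 + 0 ^ 2) = 1 / x := by
    field_simp
    ring
  have d1 : x / (x ^ 2 + ρ.im ^ 2) ≤ x / 39 := by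
    apply div_le_div_of_nonneg_left hx0.le (by norm_num)
    nlinarith
  have d2 : x / (x ^ 2 + (2 * ρ.im) ^ 2) ≤ x / 156 := by
    apply div_le_div_of_nonneg_left hx0.le (by norm_num)
    nlinarith
  have l0 : Real.log (1 + 0 ^ 2 / 4) = 0 := by norm_num
  have l1 : Real.log (1 + ρ.im ^ 2 / 4) ≤ 2 * 2.3106 + L := by
    calc Real.log (1 + ρ.im ^ 2 / 4) ≤ Real.log (10 ^ 2 * (1 + ρ.im ^ 2 / 400)) :=
          Real.log_le_log (by positivity) (by linarith)
      _ = 2 * Real.log 10 + L := by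
        rw [Real.log_mul (by norm_num) (by positivity), Real.log_pow, hL, xiHeight]
        norm_num
      _ ≤ _ := by linarith [log_ten_le]
  have l2 : Real.log (1 + (2 * ρ.im) ^ 2 / 4) ≤ 2 * (2.3106 + 0.6932) + L := by
    calc Real.log (1 + (2 * ρ.im) ^ 2 / 4) ≤ Real.log ((10 * 2) ^ 2 * (1 + ρ.im ^ 2 / 400)) :=
          Real.log_le_log (by positivity) (by linarith)
      _ = 2 * (Real.log 10 + Real.log 2) + L := by
        rw [Real.log_mul (by norm_num) (by positivity), Real.log_pow,
          Real.log_mul (by norm_num) (by norm_num), hL, xiHeight]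
        norm_num
      _ ≤ _ := by linarith [log_ten_le, Real.log_two_lt_d9]
  rw [d0, l0] at b0
  have hmain : 4 * (1 / (1 + x - ρ.re)) ≤ 3 * (1 / x) + Q := by
    rw [hQ]
    linarith
  have hx2 : 1 / x = Q * (125 / 58) := by
    rw [hx, one_div_div]
    ring
  clear_value L
  clear h341 b0 b1 b2 c0 c1 c2 e1 d0 d1 d2 l0 l1 l2
  have hmain2 : 4 * (1 / (1 + x - ρ.re)) ≤ 7.46552 * Q := by
    rw [hx2] at hmain
    linarith
  have hpos : 0 < 1 + x - ρ.re := by linarith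
  rw [mul_one_div, div_le_iff₀ hpos] at hmain2
  have hxQ : x * Q = 0.464 := by
    rw [hx]
    field_simp
  have h3 : 0.0717 ≤ (1 - ρ.re) * Q := by linarith
  rw [div_le_iff₀ (by linarith)]
  have h4 : 0.0717 * (32.1 + 17.44 * L) ≥ Q := by
    rw [hQ]
    linarith
  have h5 : (1 - ρ.re) * Q ≤ (1 - ρ.re) * (0.0717 * (32.1 + 17.44 * L)) :=
    mul_le_mul_of_nonneg_left h4 (by linarith)
  linarith

end ZeroFree

section ZeroDensity

lemma re_logDeriv_riemannXi_le {S : ℝ} (hS : 1 < S) :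
    (logDeriv riemannXi S).re ≤ 1 / (S - 1) - 0.55 + Real.log ((S + 1) / 2) / 2 := by
  have h0 : 0 ≤ (-logDeriv riemannZeta S).re := by
    have h := three_four_one hS 0
    simp only [Complex.ofReal_zero, zero_mul, add_zero, mul_zero] at h
    linarith
  rw [neg_logDeriv_riemannZeta (by simpa using hS)] at h0
  have e : (1 / ((S : ℂ) - 1)).re = 1 / (S - 1) := by
    rw [← Complex.ofReal_re (1 / (S - 1))]
    push_cast
    rfl
  rw [Complex.sub_re, Complex.add_re, Complex.add_re, e, Complex.ofReal_re] at h0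
  linarith [re_trivialZeroSum_ofReal_le hS.le, xiLogDerivOne_sub_le]

lemma sum_xiMult_div_le {S : ℝ} (hS : 20 ≤ S) (Z : Finset ℂ) (hZ : ∀ ρ ∈ Z, riemannXi ρ = 0) :
    ∑ ρ ∈ Z, xiMult ρ / (S ^ 2 + ρ.im ^ 2) ≤ (Real.log S / 2 - 0.74) / S := by
  have h1 : (S - 1) * ∑ ρ ∈ Z, xiMult ρ / (S ^ 2 + ρ.im ^ 2) ≤ (logDeriv riemannXi S).re := by
    have h := sum_zeros_re_le (s := S) (by simp; linarith) Z hZ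
    have h2 : ∑ ρ ∈ Z, 2 * (S - 1) * (xiMult ρ / (S ^ 2 + ρ.im ^ 2)) ≤
        ∑ ρ ∈ Z, xiMult ρ * ((S - ρ)⁻¹.re + (S - (1 - ρ))⁻¹.re) := by
      refine Finset.sum_le_sum fun ρ hρ => ?_
      obtain ⟨hβ0, hβ1⟩ := re_mem_Ioo_of_riemannXi_eq_zero (hZ ρ hρ)
      have key : ∀ β : ℝ, 0 < β → β < 1 → (S - 1) / (S ^ 2 + ρ.im ^ 2) ≤
          (S - β) / ((S - β) ^ 2 + ρ.im ^ 2) := by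
        intro β h0 h1
        apply div_le_div₀ (by linarith) (by linarith)
        · nlinarith [sq_nonneg ρ.im]
        · nlinarith
      have e1 : ((S : ℂ) - ρ)⁻¹.re = (S - ρ.re) / ((S - ρ.re) ^ 2 + ρ.im ^ 2) := by
        rw [Complex.inv_re, Complex.normSq_apply]
        simp [sq]
      have e2 : ((S : ℂ) - (1 - ρ))⁻¹.re =
          (S - (1 - ρ.re)) / ((S - (1 - ρ.re)) ^ 2 + ρ.im ^ 2) := by
        rw [Complex.inv_re, Complex.normSq_apply]
        simp [sq]
      rw [e1, e2]
      calc 2 * (S - 1) * (xiMult ρ / (S ^ 2 + ρ.im ^ 2)) = xiMult ρ *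
            ((S - 1) / (S ^ 2 + ρ.im ^ 2) + (S - 1) / (S ^ 2 + ρ.im ^ 2)) := by ring
        _ ≤ _ := mul_le_mul_of_nonneg_left (add_le_add (key _ hβ0 hβ1)
            (key _ (by linarith) (by linarith))) (xiMult_nonneg ρ)
    rw [← Finset.mul_sum] at h2
    linarith
  have h2 := re_logDeriv_riemannXi_le (S := S) (by linarith)
  set Y := ∑ ρ ∈ Z, xiMult ρ / (S ^ 2 + ρ.im ^ 2)
  have l1 : Real.log ((S + 1) / 2) ≤ Real.log S + 1 / S - 0.6931 := by
    rw [Real.log_div (by linarith) (by norm_num)]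
    have : Real.log (S + 1) ≤ Real.log S + 1 / S := by
      have h := Real.log_le_sub_one_of_pos (x := (S + 1) / S) (by positivity)
      rw [Real.log_div (by linarith) (by linarith)] at h
      have e : (S + 1) / S - 1 = 1 / S := by
        field_simp
        ring
      linarith
    linarith [Real.log_two_gt_d9]
  have l2 : Real.log S ≤ 3.01 + S / 20 - 1 := by
    have h := Real.log_le_sub_one_of_pos (x := S / 20) (by positivity)
    rw [Real.log_div (by linarith) (by norm_num), show (20 : ℝ) = 10 * 2 by norm_num,
      Real.log_mul (by norm_num) (by norm_num)] at h
    linarith [log_ten_le, Real.log_two_lt_d9]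
  have l3 : S * (1 / (S - 1)) ≤ 1.053 := by
    rw [mul_one_div, div_le_iff₀ (by linarith)]
    linarith
  have l4 : S * (1 / S) = 1 := by field_simp
  rw [le_div_iff₀ (by linarith)]
  have h3 : (S - 1) * Y ≤ 1 / (S - 1) - 0.55 + (Real.log S + 1 / S - 0.6931) / 2 := by linarith
  have h4 : S * ((S - 1) * Y) ≤ (S - 1) * (Real.log S / 2 - 0.74) := by
    have := mul_le_mul_of_nonneg_left h3 (show 0 ≤ S by linarith)
    linarith
  have h5 : (S - 1) * (Y * S) ≤ (S - 1) * (Real.log S / 2 - 0.74) := by linarith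
  exact le_of_mul_le_mul_left h5 (by linarith)

lemma sum_xiWeight_mul_xiHeight_le (Z : Finset ℂ) :
    ∑ ρ ∈ Z, xiWeight ρ * xiHeight ρ ≤ 0.1262 := by
  refine sum_le_of_forall_sum_zeros_le (fun ρ h => by rw [xiWeight_eq_zero h, zero_mul])
    (fun Z hZ => ?_) Z
  set G : ℝ → ℝ := fun S => ∑ ρ ∈ Z, xiWeight ρ * Real.log (1 + ρ.im ^ 2 / S ^ 2) -
    (Real.log S - 0.48) / S with hG
  have hd : ∀ S : ℝ, 20 ≤ S → HasDerivAt G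
      (∑ ρ ∈ Z, (-2 / S * (xiMult ρ / (S ^ 2 + ρ.im ^ 2))) -
        (1.48 - Real.log S) / S ^ 2) S := by
    intro S hS
    have hS0 : S ≠ 0 := by linarith
    refine HasDerivAt.sub (HasDerivAt.fun_sum fun ρ hρ => ?_) ?_
    · have hγ := le_im_sq_of_riemannXi_eq_zero (hZ ρ hρ)
      have h1 : HasDerivAt (fun y : ℝ => 1 + ρ.im ^ 2 / y ^ 2)
          (ρ.im ^ 2 * (-(2 * S) / (S ^ 2) ^ 2)) S := by
        have h := ((hasDerivAt_pow 2 S).inv (by positivity)).const_mul (ρ.im ^ 2)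
        simpa [div_eq_mul_inv] using h.const_add 1
      have h2 := (h1.log (by positivity)).const_mul (xiWeight ρ)
      refine h2.congr_deriv ?_
      have h3 : S ^ 2 + ρ.im ^ 2 ≠ 0 := by positivity
      have h4 : ρ.im ≠ 0 := by
        intro h
        rw [h] at hγ
        norm_num at hγ
      rw [xiWeight]
      field_simp
    · have h := ((Real.hasDerivAt_log hS0).sub_const 0.48).div (hasDerivAt_id S) hS0
      refine h.congr_deriv ?_
      simp only [id]
      field_simp
      ring
  have hmono : MonotoneOn G (Set.Ici 20) := by
    refine monotoneOn_of_deriv_nonneg (convex_Ici 20)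
      (fun S hS => (hd S hS).continuousAt.continuousWithinAt)
      (fun S hS => (hd S (interior_subset hS)).differentiableAt.differentiableWithinAt) ?_
    intro S hS
    have hS20 : 20 ≤ S := interior_subset hS
    rw [(hd S hS20).deriv, ← Finset.mul_sum]
    have h := mul_le_mul_of_nonneg_left (sum_xiMult_div_le hS20 Z hZ)
      (show 0 ≤ 2 / S by positivity)
    have e : 2 / S * ((Real.log S / 2 - 0.74) / S) = -((1.48 - Real.log S) / S ^ 2) := by
      have : S ≠ 0 := by linarith
      field_simp
      ring
    rw [e] at h
    rw [neg_div, neg_mul]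
    linarith
  have hlim : Tendsto G atTop (𝓝 0) := by
    have h1 : Tendsto (fun S : ℝ => ∑ ρ ∈ Z, xiWeight ρ * Real.log (1 + ρ.im ^ 2 / S ^ 2)) atTop
        (𝓝 (∑ ρ ∈ Z, xiWeight ρ * Real.log (1 + 0))) := by
      refine tendsto_finsetSum _ fun ρ _ => Tendsto.const_mul _ ?_
      refine (Real.continuousAt_log (by norm_num)).tendsto.comp (Tendsto.const_add _ ?_)
      exact tendsto_const_nhds.div_atTop (tendsto_pow_atTop two_ne_zero)
    have h2 : Tendsto (fun S : ℝ => (Real.log S - 0.48) / S) atTop (𝓝 0) := by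
      have h3 : Tendsto (fun S : ℝ => Real.log S / S) atTop (𝓝 0) := by
        simpa using Real.isLittleO_log_id_atTop.tendsto_div_nhds_zero
      have h4 : Tendsto (fun S : ℝ => 0.48 / S) atTop (𝓝 0) :=
        tendsto_const_nhds.div_atTop tendsto_id
      simpa [sub_div] using h3.sub h4
    simpa using h1.sub h2
  have h20 : G 20 ≤ 0 := by
    refine ge_of_tendsto hlim ?_
    filter_upwards [eventually_ge_atTop 20] with S hS
    exact hmono (Set.mem_Ici.mpr le_rfl) hS hS
  have l20 : Real.log 20 ≤ 3.0038 := by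
    rw [show (20 : ℝ) = 10 * 2 by norm_num, Real.log_mul (by norm_num) (by norm_num)]
    linarith [log_ten_le, Real.log_two_lt_d9]
  simp only [hG] at h20
  have e : ∀ ρ : ℂ, Real.log (1 + ρ.im ^ 2 / 20 ^ 2) = xiHeight ρ := by
    intro ρ
    rw [xiHeight]
    norm_num
  simp only [e] at h20
  linarith

lemma summable_xiWeight_mul_xiHeight : Summable fun ρ => xiWeight ρ * xiHeight ρ :=
  summable_of_sum_le (fun ρ => mul_nonneg (xiWeight_nonneg ρ) (xiHeight_nonneg ρ))
    sum_xiWeight_mul_xiHeight_le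

lemma tsum_xiWeight_mul_xiHeight_le : ∑' ρ, xiWeight ρ * xiHeight ρ ≤ 0.1262 :=
  summable_xiWeight_mul_xiHeight.tsum_le_of_sum_le sum_xiWeight_mul_xiHeight_le

end ZeroDensity

section Laplace

open MeasureTheory

/-- `F` is the Laplace transform of `f` on the open right half-plane. -/
def HasLaplace (f : ℝ → ℂ) (F : ℂ → ℂ) : Prop := ∀ z : ℂ, 0 < z.re →
  IntegrableOn (fun u : ℝ => f u * Complex.exp (-z * u)) (Set.Ioi 0) ∧
    ∫ u in Set.Ioi (0 : ℝ), f u * Complex.exp (-z * u) = F z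

lemma HasLaplace.add {f g : ℝ → ℂ} {F G : ℂ → ℂ} (hf : HasLaplace f F) (hg : HasLaplace g G) :
    HasLaplace (fun u => f u + g u) (fun z => F z + G z) := by
  intro z hz
  simp only [add_mul]
  exact ⟨(hf z hz).1.add (hg z hz).1, by
    rw [integral_add (hf z hz).1 (hg z hz).1, (hf z hz).2, (hg z hz).2]⟩

lemma HasLaplace.const_mul {f : ℝ → ℂ} {F : ℂ → ℂ} (hf : HasLaplace f F) (c : ℂ) :
    HasLaplace (fun u => c * f u) (fun z => c * F z) := by
  intro z hz
  simp only [mul_assoc]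
  exact ⟨(hf z hz).1.const_mul c, by rw [integral_const_mul, (hf z hz).2]⟩

lemma HasLaplace.sub {f g : ℝ → ℂ} {F G : ℂ → ℂ} (hf : HasLaplace f F) (hg : HasLaplace g G) :
    HasLaplace (fun u => f u - g u) (fun z => F z - G z) := by
  have := hf.add (hg.const_mul (-1))
  simpa [← sub_eq_add_neg] using this

lemma HasLaplace.congr {f g : ℝ → ℂ} {F G : ℂ → ℂ} (hf : HasLaplace f F)
    (h1 : ∀ u, 0 < u → g u = f u) (h2 : ∀ z : ℂ, 0 < z.re → G z = F z) : HasLaplace g G := by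
  intro z hz
  have e : Set.EqOn (fun u : ℝ => f u * Complex.exp (-z * u))
      (fun u : ℝ => g u * Complex.exp (-z * u)) (Set.Ioi 0) := fun u hu => by
    simp only [h1 u hu]
  exact ⟨(hf z hz).1.congr_fun e measurableSet_Ioi, by
    rw [← setIntegral_congr_fun measurableSet_Ioi e, (hf z hz).2, h2 z hz]⟩

lemma integrable_tsum_of_summable_integral_norm {ι α : Type*} [Countable ι] [MeasurableSpace α]
    {μ : Measure α} {F : ι → α → ℂ} (hF : ∀ i, Integrable (F i) μ)
    (hs : Summable fun i => ∫ a, ‖F i a‖ ∂μ) (hp : ∀ᵐ a ∂μ, Summable fun i => ‖F i a‖) :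
    Integrable (fun a => ∑' i, F i a) μ := by
  constructor
  · refine aestronglyMeasurable_of_tendsto_ae (atTop : Filter (Finset ι))
      (f := fun s a => ∑ i ∈ s, F i a) (fun s => ?_) ?_
    · exact Finset.aestronglyMeasurable_fun_sum s fun i _ => (hF i).1
    · filter_upwards [hp] with a ha
      exact ha.of_norm.hasSum
  · have h1 : ∫⁻ a, ‖∑' i, F i a‖ₑ ∂μ ≤ ∫⁻ a, ∑' i, ‖F i a‖ₑ ∂μ := by
      refine lintegral_mono_ae ?_
      filter_upwards [hp] with a ha
      exact enorm_tsum_le_tsum_enorm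
    refine h1.trans_lt ?_
    rw [lintegral_tsum fun i => (hF i).1.enorm]
    have h2 : ∀ i, ∫⁻ a, ‖F i a‖ₑ ∂μ = ENNReal.ofReal (∫ a, ‖F i a‖ ∂μ) := fun i =>
      (ofReal_integral_norm_eq_lintegral_enorm (hF i)).symm
    simp_rw [h2]
    rw [← ENNReal.ofReal_tsum_of_nonneg (fun i => integral_nonneg fun a => norm_nonneg _) hs]
    exact ENNReal.ofReal_lt_top

lemma HasLaplace.tsum {ι : Type*} [Countable ι] {f : ι → ℝ → ℂ} {F : ι → ℂ → ℂ}
    (hf : ∀ i, HasLaplace (f i) (F i))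
    (hs : ∀ x : ℝ, 0 < x → Summable fun i => ∫ u in Set.Ioi (0 : ℝ), ‖f i u‖ * Real.exp (-x * u))
    (hp : ∀ u : ℝ, 0 < u → Summable fun i => ‖f i u‖) :
    HasLaplace (fun u => ∑' i, f i u) (fun z => ∑' i, F i z) := by
  intro z hz
  have hn : ∀ i (u : ℝ), ‖f i u * Complex.exp (-z * u)‖ = ‖f i u‖ * Real.exp (-z.re * u) := by
    intro i u
    rw [norm_mul, Complex.norm_exp]
    simp
  have hs' : Summable fun i => ∫ u in Set.Ioi (0 : ℝ), ‖f i u * Complex.exp (-z * u)‖ := by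
    simp only [hn]
    exact hs z.re hz
  have hp' : ∀ᵐ u ∂(volume.restrict (Set.Ioi (0 : ℝ))),
      Summable fun i => ‖f i u * Complex.exp (-z * u)‖ := by
    refine (ae_restrict_iff' measurableSet_Ioi).mpr (Eventually.of_forall fun u hu => ?_)
    simp only [hn]
    exact (hp u hu).mul_right _
  have h1 := integrable_tsum_of_summable_integral_norm (fun i => (hf i z hz).1) hs' hp'
  have h2 := (hasSum_integral_of_summable_integral_norm (fun i => (hf i z hz).1) hs').tsum_eq
  simp only [tsum_mul_right] at h1 h2
  refine ⟨h1, ?_⟩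
  rw [← h2]
  exact tsum_congr fun i => (hf i z hz).2

lemma hasLaplace_exp {a : ℂ} (ha : 0 ≤ a.re) :
    HasLaplace (fun u => Complex.exp (-a * u)) (fun z => 1 / (z + a)) := by
  intro z hz
  have hre : (-(z + a)).re < 0 := by
    simp
    linarith
  have e : ∀ u : ℝ, Complex.exp (-a * u) * Complex.exp (-z * u) =
      Complex.exp (-(z + a) * u) := by
    intro u
    rw [← Complex.exp_add]
    ring_nf
  simp only [e]
  refine ⟨integrableOn_exp_mul_complex_Ioi hre 0, ?_⟩
  rw [integral_exp_mul_complex_Ioi hre 0]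
  simp only [Complex.ofReal_zero, mul_zero, Complex.exp_zero]
  rw [neg_div_neg_eq]

lemma hasLaplace_one : HasLaplace (fun _ => 1) (fun z => 1 / z) := by
  have := hasLaplace_exp (a := 0) (by simp)
  simpa using this

lemma hasLaplace_id : HasLaplace (fun u => (u : ℂ)) (fun z => 1 / z ^ 2) := by
  intro z hz
  have hz0 : z ≠ 0 := by
    rintro rfl
    simp at hz
  have hd : ∀ u : ℝ, HasDerivAt (fun u : ℝ => -((u : ℂ) / z + 1 / z ^ 2) * Complex.exp (-z * u))
      (u * Complex.exp (-z * u)) u := by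
    intro u
    have h1 : HasDerivAt (fun u : ℂ => -(u / z + 1 / z ^ 2) * Complex.exp (-z * u))
        (u * Complex.exp (-z * u)) (u : ℂ) := by
      have h2 := (((hasDerivAt_id (u : ℂ)).div_const z).add_const (1 / z ^ 2)).neg.mul
        (((hasDerivAt_id (u : ℂ)).const_mul (-z)).cexp)
      refine h2.congr_deriv ?_
      simp only [id, Pi.neg_apply]
      field_simp
      ring
    exact h1.comp_ofReal
  have ht : Tendsto (fun u : ℝ => (u : ℂ) * Complex.exp (-z * u)) atTop (𝓝 0) := by
    rw [tendsto_zero_iff_norm_tendsto_zero]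
    have h1 := Real.tendsto_pow_mul_exp_neg_atTop_nhds_zero 1
    have h2 := (h1.comp (tendsto_id.const_mul_atTop hz)).div_const z.re
    rw [zero_div] at h2
    refine h2.congr' ?_
    filter_upwards [eventually_ge_atTop 0] with u hu
    rw [norm_mul, Complex.norm_exp, Complex.norm_real, Real.norm_of_nonneg hu]
    simp
    field_simp
  have ht2 : Tendsto (fun u : ℝ => Complex.exp (-z * u)) atTop (𝓝 0) := by
    rw [tendsto_zero_iff_norm_tendsto_zero]
    have h2 := Real.tendsto_exp_neg_atTop_nhds_zero.comp (tendsto_id.const_mul_atTop hz)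
    refine h2.congr fun u => ?_
    rw [Complex.norm_exp]
    simp
  have hlim : Tendsto (fun u : ℝ => -((u : ℂ) / z + 1 / z ^ 2) * Complex.exp (-z * u)) atTop
      (𝓝 0) := by
    have := ((ht.div_const z).add (ht2.const_mul (1 / z ^ 2))).neg
    simp only [zero_div, mul_zero, add_zero, neg_zero] at this
    refine this.congr fun u => ?_
    ring
  have hI1 : IntegrableOn (fun u : ℝ => (u : ℂ) * Complex.exp (-z * u)) (Set.Ioi 0) := by
    have hcont : Continuous fun u : ℝ => (u : ℂ) * Complex.exp (-z * u) := by fun_prop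
    rw [IntegrableOn, ← integrable_norm_iff hcont.aestronglyMeasurable]
    have hzh : 0 < z.re / 2 := half_pos hz
    refine integrable_of_isBigO_exp_neg hzh hcont.norm.continuousOn ?_
    rw [Asymptotics.isBigO_norm_left]
    have h1 : Tendsto (fun u : ℝ => (u : ℂ) * Complex.exp (-(z / 2) * u)) atTop (𝓝 0) := by
      rw [tendsto_zero_iff_norm_tendsto_zero]
      have h1 := Real.tendsto_pow_mul_exp_neg_atTop_nhds_zero 1
      have h2 := (h1.comp (tendsto_id.const_mul_atTop (half_pos hz))).div_const (z.re / 2)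
      rw [zero_div] at h2
      refine h2.congr' ?_
      filter_upwards [eventually_ge_atTop 0] with u hu
      rw [norm_mul, Complex.norm_exp, Complex.norm_real, Real.norm_of_nonneg hu]
      simp
      field_simp
    have h3 := h1.isBigO_one ℝ
    have h4 : (fun u : ℝ => Complex.exp (-(z / 2) * u)) =O[atTop]
        fun u : ℝ => Real.exp (-(z.re / 2) * u) := by
      refine Asymptotics.IsBigO.of_norm_le fun u => ?_
      rw [Complex.norm_exp]
      simp
    refine (h3.mul h4).congr (fun u => ?_) fun u => by simp
    rw [mul_assoc, ← Complex.exp_add]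
    ring_nf
  refine ⟨hI1, ?_⟩
  rw [integral_Ioi_of_hasDerivAt_of_tendsto' (fun u _ => hd u) hI1 hlim]
  simp

/-- The Laplace transform of the truncation of an exponential. -/
lemma hasLaplace_indicator_exp {a : ℂ} (ha : 0 ≤ a.re) {c : ℝ} (hc : 0 ≤ c) :
    HasLaplace ((Set.Ioi c).indicator fun u => Complex.exp (-a * u))
      (fun z => Complex.exp (-(z + a) * c) / (z + a)) := by
  intro z hz
  have hre : (-(z + a)).re < 0 := by
    simp
    linarith
  have e : (fun u : ℝ => (Set.Ioi c).indicator (fun u : ℝ => Complex.exp (-a * u)) u *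
      Complex.exp (-z * u)) = (Set.Ioi c).indicator fun u : ℝ => Complex.exp (-(z + a) * u) := by
    funext u
    by_cases hu : u ∈ Set.Ioi c
    · rw [Set.indicator_of_mem hu, Set.indicator_of_mem hu, ← Complex.exp_add]
      ring_nf
    · rw [Set.indicator_of_notMem hu, Set.indicator_of_notMem hu, zero_mul]
  have hsub : Set.Ioi (0 : ℝ) ∩ Set.Ioi c = Set.Ioi c :=
    Set.inter_eq_right.mpr (Set.Ioi_subset_Ioi hc)
  have hi := integrableOn_exp_mul_complex_Ioi hre c
  simp only [e]
  refine ⟨((integrable_indicator_iff measurableSet_Ioi).mpr hi).integrableOn, ?_⟩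
  rw [setIntegral_indicator measurableSet_Ioi, hsub, integral_exp_mul_complex_Ioi hre c,
    neg_div_neg_eq]

/-- Uniqueness of the Laplace transform for continuous functions vanishing at the origin. -/
theorem HasLaplace.eq_zero {f : ℝ → ℂ} (hf : HasLaplace f fun _ => 0)
    (hc : ContinuousOn f (Set.Ici 0)) (h0 : f 0 = 0) {u : ℝ} (hu : 0 ≤ u) : f u = 0 := by
  set g : ℝ → ℂ := fun u => f (max u 0) * Complex.exp (-1 * u) with hg
  have hgc : Continuous g := by
    refine Continuous.mul ?_ (by fun_prop)
    exact hc.comp_continuous (by fun_prop) fun u => le_max_right u 0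
  have hg0 : ∀ u, u ∉ Set.Ioi (0 : ℝ) → g u = 0 := by
    intro u hu
    simp only [Set.mem_Ioi, not_lt] at hu
    simp only [hg, max_eq_right hu, h0, zero_mul]
  have hg1 : ∀ u ∈ Set.Ioi (0 : ℝ), g u = f u * Complex.exp (-1 * u) := by
    intro u hu
    simp only [hg, max_eq_left (le_of_lt (Set.mem_Ioi.mp hu))]
  have hgi : Integrable g := by
    rw [← integrableOn_iff_integrable_of_support_subset (s := Set.Ioi 0)]
    · exact ((hf 1 (by simp)).1).congr_fun (fun u hu => (hg1 u hu).symm) measurableSet_Ioi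
    · intro u hu
      by_contra h
      exact hu (hg0 u h)
  have hF : FourierTransform.fourier g = fun _ => 0 := by
    funext w
    rw [Real.fourier_real_eq_integral_exp_smul]
    have h1 := (hf (1 + 2 * Real.pi * w * Complex.I) (by simp)).2
    rw [← setIntegral_eq_integral_of_forall_compl_eq_zero (s := Set.Ioi 0)
      (fun u hu => by rw [hg0 u hu, smul_zero])]
    refine Eq.trans ?_ h1
    refine setIntegral_congr_fun measurableSet_Ioi fun u hu => ?_
    simp only [hg1 u hu, smul_eq_mul]
    rw [mul_left_comm, ← Complex.exp_add]
    congr 2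
    push_cast
    ring
  have hinv := hgc.fourierInv_fourier_eq hgi (by rw [hF]; exact integrable_zero _ _ _)
  have hgz : g = 0 := by
    rw [← hinv, hF]
    funext v
    rw [Real.fourierInv_eq]
    simp
  rcases hu.eq_or_lt with rfl | hu'
  · exact h0
  · have := congrFun hgz u
    rw [hg1 u hu', Pi.zero_apply, mul_eq_zero] at this
    exact this.resolve_right (Complex.exp_ne_zero _)

lemma summable_integral_of_norm_le {ι : Type*} {f : ι → ℝ → ℂ} {c : ι → ℝ} (hc : Summable c)
    (h : ∀ i u, 0 < u → ‖f i u‖ ≤ c i) {x : ℝ} (hx : 0 < x) :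
    Summable fun i => ∫ u in Set.Ioi (0 : ℝ), ‖f i u‖ * Real.exp (-x * u) := by
  refine Summable.of_nonneg_of_le (fun ρ => integral_nonneg fun u => by positivity)
    (fun i => ?_) (hc.mul_right (1 / x))
  have hi : IntegrableOn (fun u : ℝ => Real.exp (-x * u)) (Set.Ioi 0) :=
    integrableOn_exp_mul_Ioi (by linarith) 0
  have e : ∫ u in Set.Ioi (0 : ℝ), Real.exp (-x * u) = 1 / x := by
    rw [integral_exp_mul_Ioi (by linarith) 0]
    simp
  rw [← e, ← integral_const_mul]
  refine integral_mono_of_nonneg (Eventually.of_forall fun u => by positivity)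
    (hi.const_mul _) ?_
  refine (ae_restrict_iff' measurableSet_Ioi).mpr (Eventually.of_forall fun u hu => ?_)
  exact mul_le_mul_of_nonneg_right (h i u hu) (Real.exp_pos _).le

end Laplace

section ZeroSum

open MeasureTheory

/-- The coefficient attached to a zero of `riemannXi` in the explicit formula. -/
noncomputable def xiCoeff (ρ : ℂ) : ℂ := xiMult ρ / (ρ * (1 - ρ))

/-- The contribution of the zeros of `riemannXi` to the explicit formula. -/
noncomputable def zeroSum (u : ℝ) : ℂ := ∑' ρ : ℂ, xiCoeff ρ * Complex.exp (-(1 - ρ) * u)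

lemma norm_xiCoeff_le (ρ : ℂ) : ‖xiCoeff ρ‖ ≤ xiWeight ρ := by
  by_cases h : riemannXi ρ = 0
  · have h1 : |ρ.im| ≤ ‖ρ‖ := Complex.abs_im_le_norm ρ
    have h2 : |ρ.im| ≤ ‖1 - ρ‖ := by
      have := Complex.abs_im_le_norm (1 - ρ)
      simpa using this
    have h3 := le_im_sq_of_riemannXi_eq_zero h
    rw [xiCoeff, xiWeight, norm_div, norm_mul, Complex.norm_real,
      Real.norm_of_nonneg (xiMult_nonneg ρ), ← sq_abs, sq]
    rw [← sq_abs] at h3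
    gcongr
    · exact xiMult_nonneg ρ
    · nlinarith
  · rw [xiCoeff, xiMult_eq_zero h]
    simp [xiWeight_nonneg]

lemma riemannXi_eq_zero_of_xiWeight_ne_zero {ρ : ℂ} (h : xiWeight ρ ≠ 0) : riemannXi ρ = 0 := by
  by_contra h'
  exact h (xiWeight_eq_zero h')

lemma norm_zeroSum_term_le (ρ : ℂ) (u : ℝ) : ‖xiCoeff ρ * Complex.exp (-(1 - ρ) * u)‖ ≤
    xiWeight ρ * Real.exp (-(1 - ρ.re) * u) := by
  rw [norm_mul, Complex.norm_exp]
  have : (-(1 - ρ) * (u : ℂ)).re = -(1 - ρ.re) * u := by simp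
  rw [this]
  gcongr
  exact norm_xiCoeff_le ρ

lemma xiWeight_mul_exp_le (ρ : ℂ) {u : ℝ} (hu : 0 ≤ u) :
    xiWeight ρ * Real.exp (-(1 - ρ.re) * u) ≤ xiWeight ρ := by
  by_cases h : xiWeight ρ = 0
  · simp [h]
  · have h1 := (re_mem_Ioo_of_riemannXi_eq_zero (riemannXi_eq_zero_of_xiWeight_ne_zero h)).2
    refine mul_le_of_le_one_right (xiWeight_nonneg ρ) (Real.exp_le_one_iff.mpr ?_)
    nlinarith

lemma summable_xiWeight_mul_exp {u : ℝ} (hu : 0 ≤ u) :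
    Summable fun ρ : ℂ => xiWeight ρ * Real.exp (-(1 - ρ.re) * u) :=
  Summable.of_nonneg_of_le (fun ρ => mul_nonneg (xiWeight_nonneg ρ) (Real.exp_pos _).le)
    (fun ρ => xiWeight_mul_exp_le ρ hu) summable_xiWeight

lemma norm_zeroSum_le_tsum {u : ℝ} (hu : 0 ≤ u) : ‖zeroSum u‖ ≤ 1 / 2 * ∑' ρ : ℂ,
    xiWeight ρ * (Real.exp (-(1 - ρ.re) * u) + Real.exp (-ρ.re * u)) := by
  have hs := summable_xiWeight_mul_exp hu
  have h1 : ‖zeroSum u‖ ≤ ∑' ρ : ℂ, xiWeight ρ * Real.exp (-(1 - ρ.re) * u) :=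
    tsum_of_norm_bounded hs.hasSum fun ρ => norm_zeroSum_term_le ρ u
  have e : ∀ ρ : ℂ, xiWeight ((Equiv.subLeft (1 : ℂ)) ρ) *
      Real.exp (-(1 - ((Equiv.subLeft (1 : ℂ)) ρ).re) * u) =
      xiWeight ρ * Real.exp (-ρ.re * u) := by
    intro ρ
    simp [xiWeight_one_sub]
  have hs2 : Summable fun ρ : ℂ => xiWeight ρ * Real.exp (-ρ.re * u) := by
    have := (Equiv.subLeft (1 : ℂ)).summable_iff.mpr hs
    exact this.congr e
  have h2 : ∑' ρ : ℂ, xiWeight ρ * Real.exp (-ρ.re * u) =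
      ∑' ρ : ℂ, xiWeight ρ * Real.exp (-(1 - ρ.re) * u) := by
    rw [← (Equiv.subLeft (1 : ℂ)).tsum_eq fun ρ : ℂ => xiWeight ρ * Real.exp (-(1 - ρ.re) * u)]
    exact tsum_congr fun ρ => (e ρ).symm
  simp only [mul_add]
  rw [hs.tsum_add hs2, h2]
  linarith

lemma norm_zeroSum_le {u : ℝ} (hu : 0 ≤ u) :
    ‖zeroSum u‖ ≤ 0.0513 / 2 * (1 + Real.exp (-u)) := by
  refine (norm_zeroSum_le_tsum hu).trans ?_
  have h : ∀ ρ : ℂ, xiWeight ρ * (Real.exp (-(1 - ρ.re) * u) + Real.exp (-ρ.re * u)) ≤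
      xiWeight ρ * (1 + Real.exp (-u)) := by
    intro ρ
    by_cases h : xiWeight ρ = 0
    · simp [h]
    · obtain ⟨h0, h1⟩ :=
        re_mem_Ioo_of_riemannXi_eq_zero (riemannXi_eq_zero_of_xiWeight_ne_zero h)
      refine mul_le_mul_of_nonneg_left ?_ (xiWeight_nonneg ρ)
      have e1 : Real.exp (-u) = Real.exp (-(1 - ρ.re) * u) * Real.exp (-ρ.re * u) := by
        rw [← Real.exp_add]
        ring_nf
      have e2 : Real.exp (-(1 - ρ.re) * u) ≤ 1 := Real.exp_le_one_iff.mpr (by nlinarith)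
      have e3 : Real.exp (-ρ.re * u) ≤ 1 := Real.exp_le_one_iff.mpr (by nlinarith)
      rw [e1]
      nlinarith
  have h2 := Summable.tsum_le_tsum h (Summable.of_nonneg_of_le
    (fun ρ => mul_nonneg (xiWeight_nonneg ρ) (by positivity)) h (summable_xiWeight.mul_right _))
    (summable_xiWeight.mul_right _)
  rw [tsum_mul_right] at h2
  have h3 := tsum_xiWeight_le
  have h4 := Real.exp_pos (-u)
  nlinarith

lemma exp_neg_mul_le {δ u : ℝ} (hδ : 0 < δ) (hu : 0 < u) :
    Real.exp (-δ * u) ≤ 1 / (Real.exp 1 * u) * (1 / δ) := by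
  have h := Real.add_one_le_exp (δ * u - 1)
  have h1 : δ * u * Real.exp 1 ≤ Real.exp (δ * u) := by
    have e : Real.exp (δ * u) = Real.exp (δ * u - 1) * Real.exp 1 := by
      rw [← Real.exp_add]
      ring_nf
    rw [e]
    have := Real.exp_pos 1
    nlinarith
  rw [neg_mul, Real.exp_neg, div_mul_div_comm, one_mul, inv_eq_one_div]
  refine one_div_le_one_div_of_le (by positivity) ?_
  linarith

lemma one_div_add_one_div_one_sub_le {δ R : ℝ} (h0 : 0 < δ) (h1 : δ < 1) (hδ : 1 / δ ≤ R)
    (hδ' : 1 / (1 - δ) ≤ R) : 1 / δ + 1 / (1 - δ) ≤ R + 2 := by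
  rcases le_total δ (1 / 2) with h | h
  · have : 1 / (1 - δ) ≤ 2 := by
      rw [div_le_iff₀ (by linarith)]
      linarith
    linarith
  · have : 1 / δ ≤ 2 := by
      rw [div_le_iff₀ h0]
      linarith
    linarith

lemma norm_zeroSum_le_div {u : ℝ} (hu : 0 < u) : ‖zeroSum u‖ ≤ 0.75 / u := by
  refine (norm_zeroSum_le_tsum hu.le).trans ?_
  have h : ∀ ρ : ℂ, xiWeight ρ * (Real.exp (-(1 - ρ.re) * u) + Real.exp (-ρ.re * u)) ≤
      1 / (Real.exp 1 * u) * (34.1 * xiWeight ρ + 17.44 * (xiWeight ρ * xiHeight ρ)) := by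
    intro ρ
    by_cases h : xiWeight ρ = 0
    · simp [h]
    · have hρ := riemannXi_eq_zero_of_xiWeight_ne_zero h
      obtain ⟨h0, h1⟩ := re_mem_Ioo_of_riemannXi_eq_zero hρ
      have z1 := zero_free_region hρ
      have z2 := zero_free_region (riemannXi_one_sub_eq_zero hρ)
      have e : xiHeight (1 - ρ) = xiHeight ρ := by simp [xiHeight]
      rw [e, Complex.sub_re, Complex.one_re, sub_sub_cancel] at z2
      have z3 := one_div_add_one_div_one_sub_le h0 h1 z2 z1
      have a1 := exp_neg_mul_le (sub_pos.mpr h1) hu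
      have a2 := exp_neg_mul_le h0 hu
      have hp : 0 < 1 / (Real.exp 1 * u) := by positivity
      calc xiWeight ρ * (Real.exp (-(1 - ρ.re) * u) + Real.exp (-ρ.re * u)) ≤
          xiWeight ρ * (1 / (Real.exp 1 * u) * (34.1 + 17.44 * xiHeight ρ)) := by
            refine mul_le_mul_of_nonneg_left ?_ (xiWeight_nonneg ρ)
            calc _ ≤ 1 / (Real.exp 1 * u) * (1 / ρ.re + 1 / (1 - ρ.re)) := by linarith
              _ ≤ _ := mul_le_mul_of_nonneg_left (by linarith) hp.le
        _ = _ := by ring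
  have hs : Summable fun ρ : ℂ =>
      1 / (Real.exp 1 * u) * (34.1 * xiWeight ρ + 17.44 * (xiWeight ρ * xiHeight ρ)) :=
    ((summable_xiWeight.mul_left _).add (summable_xiWeight_mul_xiHeight.mul_left _)).mul_left _
  have h2 := Summable.tsum_le_tsum h (Summable.of_nonneg_of_le
    (fun ρ => mul_nonneg (xiWeight_nonneg ρ) (by positivity)) h hs) hs
  rw [tsum_mul_left, (summable_xiWeight.mul_left _).tsum_add
    (summable_xiWeight_mul_xiHeight.mul_left _), tsum_mul_left, tsum_mul_left] at h2
  have h3 := tsum_xiWeight_le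
  have h4 := tsum_xiWeight_mul_xiHeight_le
  have he := Real.exp_one_gt_d9
  have hp : 0 < 1 / (Real.exp 1 * u) := by positivity
  have h5 : 1 / 2 * (1 / (Real.exp 1 * u) * 3.96) ≤ 0.75 / u := by
    have e : 1 / 2 * (1 / (Real.exp 1 * u) * 3.96) = 1.98 / Real.exp 1 / u := by
      field_simp
      norm_num
    rw [e]
    gcongr
    rw [div_le_iff₀ (by positivity)]
    linarith
  refine le_trans ?_ h5
  refine mul_le_mul_of_nonneg_left (h2.trans (mul_le_mul_of_nonneg_left ?_ hp.le)) (by norm_num)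
  linarith

lemma continuousOn_zeroSum : ContinuousOn zeroSum (Set.Ici 0) := by
  refine continuousOn_tsum (fun ρ => Continuous.continuousOn (by fun_prop)) summable_xiWeight ?_
  intro ρ u hu
  exact (norm_zeroSum_term_le ρ u).trans (xiWeight_mul_exp_le ρ hu)

lemma summable_xiCoeff : Summable xiCoeff :=
  Summable.of_norm_bounded summable_xiWeight norm_xiCoeff_le

lemma xiCoeff_eq_zero {ρ : ℂ} (h : riemannXi ρ ≠ 0) : xiCoeff ρ = 0 := by
  simp [xiCoeff, xiMult_eq_zero h]

lemma ne_zero_and_one_sub_ne_zero {ρ : ℂ} (h : riemannXi ρ = 0) : ρ ≠ 0 ∧ 1 - ρ ≠ 0 := by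
  obtain ⟨h0, h1⟩ := re_mem_Ioo_of_riemannXi_eq_zero h
  refine ⟨?_, fun h' => ?_⟩
  · rintro rfl
    simp at h0
  · rw [← sub_eq_zero.mp h'] at h1
    simp at h1

lemma tsum_xiCoeff : ∑' ρ, xiCoeff ρ = 2 * xiLogDerivOne := by
  refine tendsto_nhds_unique (tendsto_sum_zerosUpTo_of_summable summable_xiCoeff
    fun ρ => xiCoeff_eq_zero) (tendsto_sum_zeros_one.congr fun R => ?_)
  refine Finset.sum_congr rfl fun ρ hρ => ?_
  obtain ⟨h0, h1⟩ := ne_zero_and_one_sub_ne_zero (mem_zerosUpTo_riemannXi.mp hρ).1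
  rw [xiCoeff]
  field_simp
  ring

lemma zeroSum_zero : zeroSum 0 = 2 * xiLogDerivOne := by
  rw [← tsum_xiCoeff, zeroSum]
  simp

lemma norm_one_div_add_one_sub_le {z ρ : ℂ} (hz : 0 < z.re) (hρ : riemannXi ρ = 0) :
    ‖1 / (z + (1 - ρ))‖ ≤ 1 / z.re := by
  have h1 := (re_mem_Ioo_of_riemannXi_eq_zero hρ).2
  rw [norm_div, norm_one]
  refine one_div_le_one_div_of_le hz ?_
  have := Complex.re_le_norm (z + (1 - ρ))
  simp at this
  linarith

lemma tsum_xiCoeff_div {z : ℂ} (hz : 0 < z.re) :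
    z * (1 + z) * ∑' ρ, xiCoeff ρ * (1 / (z + (1 - ρ))) =
      2 * xiLogDerivOne * z + xiLogDerivOne - logDeriv riemannXi (1 + z) := by
  have hs : Summable fun ρ => xiCoeff ρ * (1 / (z + (1 - ρ))) := by
    refine Summable.of_norm_bounded (summable_xiWeight.mul_right (1 / z.re)) fun ρ => ?_
    by_cases h : riemannXi ρ = 0
    · rw [norm_mul]
      exact mul_le_mul (norm_xiCoeff_le ρ) (norm_one_div_add_one_sub_le hz h) (norm_nonneg _)
        (xiWeight_nonneg ρ)
    · simp [xiCoeff_eq_zero h, xiWeight_eq_zero h]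
  have h1 := (tendsto_sum_zerosUpTo_of_summable hs fun ρ h => by
    rw [xiCoeff_eq_zero h, zero_mul]).const_mul (z * (1 + z))
  refine tendsto_nhds_unique h1 ?_
  have h2 := tendsto_sum_zeros_riemannXi (s := 1) (s' := 1 + z) (by simp [riemannXi_one])
    (riemannXi_ne_zero_of_one_le_re (by simp; linarith))
  have h3 := (tendsto_sum_zeros_one.const_mul z).add h2
  rw [logDeriv_riemannXi_one] at h3
  have e : z * (2 * xiLogDerivOne) + (xiLogDerivOne - logDeriv riemannXi (1 + z)) =
      2 * xiLogDerivOne * z + xiLogDerivOne - logDeriv riemannXi (1 + z) := by ring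
  rw [e] at h3
  refine h3.congr fun R => ?_
  rw [Finset.mul_sum, Finset.mul_sum, ← Finset.sum_add_distrib]
  refine Finset.sum_congr rfl fun ρ hρ => ?_
  obtain ⟨h4, h5⟩ := ne_zero_and_one_sub_ne_zero (mem_zerosUpTo_riemannXi.mp hρ).1
  have h6 : z + (1 - ρ) ≠ 0 := by
    intro h'
    have h7 := (re_mem_Ioo_of_riemannXi_eq_zero (mem_zerosUpTo_riemannXi.mp hρ).1).2
    have := congrArg Complex.re h'
    simp at this
    linarith
  have h7 : 1 + z - ρ ≠ 0 := by
    convert h6 using 1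
    ring
  have h8 : (xiMult ρ : ℂ) = (analyticOrderNatAt riemannXi ρ : ℂ) := by simp [xiMult]
  rw [← h8, xiCoeff, show z + (1 - ρ) = 1 + z - ρ by ring]
  field_simp
  ring

lemma hasLaplace_zeroSum : HasLaplace zeroSum fun z =>
    (2 * xiLogDerivOne * z + xiLogDerivOne - logDeriv riemannXi (1 + z)) / (z * (1 + z)) := by
  set S : Set ℂ := Function.support xiWeight with hS
  have : Countable S := summable_xiWeight.countable_support
  have hmem : ∀ ρ : S, riemannXi ρ = 0 := fun ρ => riemannXi_eq_zero_of_xiWeight_ne_zero ρ.2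
  have hsub : ∀ g : ℂ → ℂ, ∑' ρ : S, xiCoeff ρ * g ρ = ∑' ρ, xiCoeff ρ * g ρ := by
    intro g
    refine tsum_subtype_eq_of_support_subset (f := fun ρ => xiCoeff ρ * g ρ) fun ρ hρ => ?_
    intro h
    refine hρ ?_
    have := norm_xiCoeff_le ρ
    rw [h, norm_le_zero_iff] at this
    simp [this]
  have h := HasLaplace.tsum (ι := S) (f := fun ρ u => xiCoeff ρ * Complex.exp (-(1 - ρ) * u))
    (F := fun ρ z => xiCoeff ρ * (1 / (z + (1 - ρ)))) (fun ρ => ?_) (fun x hx => ?_) fun u hu => ?_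
  · refine h.congr (fun u _ => ?_) fun z hz => ?_
    · exact (hsub fun ρ => Complex.exp (-(1 - ρ) * u)).symm
    · rw [hsub fun ρ => 1 / (z + (1 - ρ)), ← tsum_xiCoeff_div hz]
      have hz0 : z ≠ 0 := by
        rintro rfl
        simp at hz
      have hz1 : 1 + z ≠ 0 := by
        intro h'
        have := congrArg Complex.re h'
        simp at this
        linarith
      field_simp
  · refine (hasLaplace_exp ?_).const_mul _
    have := (re_mem_Ioo_of_riemannXi_eq_zero (hmem ρ)).2
    simp
    exact this.le
  · exact summable_integral_of_norm_le (ι := S) (c := fun ρ => xiWeight ρ)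
      (f := fun ρ u => xiCoeff ρ * Complex.exp (-(1 - ρ) * u)) (summable_xiWeight.subtype S)
      (fun ρ u hu => (norm_zeroSum_term_le ρ u).trans (xiWeight_mul_exp_le ρ hu.le)) hx
  · exact Summable.of_nonneg_of_le (fun ρ => norm_nonneg _) (fun ρ =>
      (norm_zeroSum_term_le ρ u).trans (xiWeight_mul_exp_le ρ hu.le))
      (summable_xiWeight.subtype S)

end ZeroSum

section ExplicitFormula

open MeasureTheory ArithmeticFunction

/-- The contribution of the trivial zeros to the explicit formula. -/
noncomputable def trivialPart (u : ℝ) : ℝ :=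
  ∑' k : ℕ, (Real.exp (-u) - Real.exp (-(2 * k + 3) * u)) / ((2 * k + 2) * (2 * k + 3))

/-- The sum `∑ Λ(n) (1/n - exp (-u))` over `n < exp u`. -/
noncomputable def rampSum (u : ℝ) : ℝ :=
  ∑' n : ℕ, vonMangoldt n * max (1 / n - Real.exp (-u)) 0

lemma hasSum_telescope : HasSum (fun k : ℕ => 1 / 2 * (1 / (2 * k + 3 / 2) -
    1 / (2 * ((k + 1 : ℕ) : ℝ) + 3 / 2) : ℝ)) (1 / 3) := by
  have h : Tendsto (fun k : ℕ => (1 / (2 * k + 3 / 2) : ℝ)) atTop (𝓝 0) := by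
    refine tendsto_const_nhds.div_atTop ?_
    exact tendsto_atTop_add_const_right _ _
      (tendsto_natCast_atTop_atTop.const_mul_atTop (by norm_num))
  have h2 : Tendsto (fun n : ℕ => ∑ k ∈ Finset.range n, 1 / 2 * (1 / (2 * k + 3 / 2) -
      1 / (2 * ((k + 1 : ℕ) : ℝ) + 3 / 2) : ℝ)) atTop (𝓝 (1 / 3)) := by
    have e : ∀ n : ℕ, ∑ k ∈ Finset.range n, 1 / 2 * (1 / (2 * k + 3 / 2) -
        1 / (2 * ((k + 1 : ℕ) : ℝ) + 3 / 2) : ℝ) = 1 / 2 * (2 / 3 - 1 / (2 * n + 3 / 2)) := by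
      intro n
      rw [← Finset.mul_sum, Finset.sum_range_sub' fun k : ℕ => (1 / (2 * k + 3 / 2) : ℝ)]
      norm_num
    simp only [e]
    convert (h.const_sub (2 / 3)).const_mul (1 / 2) using 2
    norm_num
  rwa [hasSum_iff_tendsto_nat_of_nonneg]
  intro k
  refine mul_nonneg (by norm_num) (sub_nonneg.mpr (one_div_le_one_div_of_le (by positivity) ?_))
  push_cast
  linarith

lemma trivialPart_term_nonneg {u : ℝ} (hu : 0 ≤ u) (k : ℕ) :
    0 ≤ (Real.exp (-u) - Real.exp (-(2 * k + 3) * u)) / ((2 * k + 2) * (2 * k + 3)) := by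
  refine div_nonneg (sub_nonneg.mpr (Real.exp_le_exp.mpr ?_)) (by positivity)
  have : (0 : ℝ) ≤ k * u := by positivity
  nlinarith

lemma trivialPart_term_le (u : ℝ) (k : ℕ) :
    (Real.exp (-u) - Real.exp (-(2 * k + 3) * u)) / ((2 * k + 2) * (2 * k + 3)) ≤
      1 / 2 * (1 / (2 * k + 3 / 2) - 1 / (2 * ((k + 1 : ℕ) : ℝ) + 3 / 2)) * Real.exp (-u) := by
  have h1 : (Real.exp (-u) - Real.exp (-(2 * k + 3) * u)) / ((2 * k + 2) * (2 * k + 3)) ≤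
      1 / ((2 * k + 2) * (2 * k + 3)) * Real.exp (-u) := by
    rw [div_mul_eq_mul_div, one_mul]
    gcongr
    have := Real.exp_pos (-(2 * k + 3) * u)
    linarith
  refine h1.trans (mul_le_mul_of_nonneg_right ?_ (Real.exp_pos _).le)
  have e : 1 / 2 * (1 / (2 * k + 3 / 2) - 1 / (2 * ((k + 1 : ℕ) : ℝ) + 3 / 2)) =
      1 / ((2 * k + 3 / 2) * (2 * k + 7 / 2)) := by
    push_cast
    have h2 : (2 * k + 3 / 2 : ℝ) ≠ 0 := by positivity
    have h3 : (2 * k + 7 / 2 : ℝ) ≠ 0 := by positivity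
    rw [show (2 * (k + 1 : ℝ) + 3 / 2) = 2 * k + 7 / 2 by ring]
    field_simp
    ring
  rw [e]
  refine one_div_le_one_div_of_le (by positivity) ?_
  nlinarith

lemma summable_trivialPart {u : ℝ} (hu : 0 ≤ u) : Summable fun k : ℕ =>
    (Real.exp (-u) - Real.exp (-(2 * k + 3) * u)) / ((2 * k + 2) * (2 * k + 3)) :=
  Summable.of_nonneg_of_le (trivialPart_term_nonneg hu) (trivialPart_term_le u)
    (hasSum_telescope.summable.mul_right _)

lemma trivialPart_nonneg {u : ℝ} (hu : 0 ≤ u) : 0 ≤ trivialPart u :=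
  tsum_nonneg (trivialPart_term_nonneg hu)

lemma trivialPart_le {u : ℝ} (hu : 0 ≤ u) : trivialPart u ≤ 1 / 3 * Real.exp (-u) := by
  have := (summable_trivialPart hu).tsum_le_tsum (trivialPart_term_le u)
    (hasSum_telescope.summable.mul_right _)
  rwa [tsum_mul_right, hasSum_telescope.tsum_eq] at this

lemma norm_trivialPart_term_le {u : ℝ} (hu : 0 ≤ u) (k : ℕ) :
    ‖(Real.exp (-u) - Real.exp (-(2 * k + 3) * u)) / ((2 * k + 2) * (2 * k + 3))‖ ≤
      1 / 2 * (1 / (2 * k + 3 / 2) - 1 / (2 * ((k + 1 : ℕ) : ℝ) + 3 / 2)) := by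
  rw [Real.norm_of_nonneg (trivialPart_term_nonneg hu k)]
  refine (trivialPart_term_le u k).trans (mul_le_of_le_one_right ?_ ?_)
  · refine mul_nonneg (by norm_num) (sub_nonneg.mpr (one_div_le_one_div_of_le (by positivity) ?_))
    push_cast
    linarith
  · exact Real.exp_le_one_iff.mpr (by linarith)

lemma continuousOn_trivialPart : ContinuousOn trivialPart (Set.Ici 0) :=
  continuousOn_tsum (fun k => Continuous.continuousOn (by fun_prop)) hasSum_telescope.summable
    fun k _ hu => norm_trivialPart_term_le hu k

lemma trivialPart_zero : trivialPart 0 = 0 := by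
  simp [trivialPart]

lemma ne_zero_of_re_pos {z : ℂ} (hz : 0 < z.re) : z ≠ 0 := by
  rintro rfl
  simp at hz

lemma hasLaplace_trivialPart : HasLaplace (fun u => (trivialPart u : ℂ))
    fun z => trivialZeroSum (1 + z) / (z * (1 + z)) := by
  have h := HasLaplace.tsum (ι := ℕ)
    (f := fun k u => (((Real.exp (-u) - Real.exp (-(2 * k + 3) * u)) /
      ((2 * k + 2) * (2 * k + 3)) : ℝ) : ℂ))
    (F := fun k z => (1 / (2 * k + 3) - 1 / (1 + z + 2 * k + 2)) * (1 / (z * (1 + z))))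
    (fun k => ?_) (fun x hx => ?_) fun u hu => ?_
  · refine h.congr (fun u _ => ?_) fun z hz => ?_
    · rw [trivialPart, Complex.ofReal_tsum]
    · rw [tsum_mul_right, trivialZeroSum]
      ring
  · have h1 := (hasLaplace_exp (a := 1) (by simp)).sub
      (hasLaplace_exp (a := 2 * k + 3) (by simp; positivity))
    refine (h1.const_mul (1 / ((2 * k + 2) * (2 * k + 3)))).congr (fun u _ => ?_) fun z hz => ?_
    · push_cast
      rw [neg_one_mul]
      ring
    · have z0 := ne_zero_of_re_pos hz
      have z1 : 1 + z ≠ 0 := ne_zero_of_re_pos (by simp; linarith)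
      have z1' : z + 1 ≠ 0 := by rwa [add_comm]
      have z2 : z + (2 * k + 3) ≠ 0 := ne_zero_of_re_pos (by simp; positivity)
      have z3 : (2 * k + 3 : ℂ) ≠ 0 := ne_zero_of_re_pos (by simp; positivity)
      have z4 : (2 * k + 2 : ℂ) ≠ 0 := ne_zero_of_re_pos (by simp; positivity)
      rw [show 1 + z + 2 * k + 2 = z + (2 * k + 3) by ring, show 1 + z = z + 1 by ring]
      field_simp
      ring
  · refine summable_integral_of_norm_le hasSum_telescope.summable (fun k u hu => ?_) hx
    rw [Complex.norm_real]
    exact norm_trivialPart_term_le hu.le k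
  · refine Summable.of_nonneg_of_le (fun k => norm_nonneg _) (fun k => ?_)
      hasSum_telescope.summable
    rw [Complex.norm_real]
    exact norm_trivialPart_term_le hu.le k

lemma rampSum_term_eq_zero {u : ℝ} {n : ℕ} (h : Real.exp u ≤ n) :
    vonMangoldt n * max (1 / n - Real.exp (-u)) 0 = 0 := by
  rw [max_eq_right, mul_zero]
  rw [Real.exp_neg, sub_nonpos, one_div]
  exact inv_anti₀ (Real.exp_pos u) h

lemma rampSum_eq_sum {u : ℝ} {N : ℕ} (h : Real.exp u ≤ N) : rampSum u =
    ∑ n ∈ Finset.range N, vonMangoldt n * max (1 / n - Real.exp (-u)) 0 := by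
  refine tsum_eq_sum fun n hn => rampSum_term_eq_zero (h.trans ?_)
  exact_mod_cast (not_lt.mp fun h' => hn (Finset.mem_range.mpr h'))

lemma continuous_rampSum : Continuous rampSum := by
  rw [continuous_iff_continuousAt]
  intro u
  have h : (fun v => ∑ n ∈ Finset.range ⌈Real.exp (u + 1)⌉₊,
      vonMangoldt n * max (1 / n - Real.exp (-v)) 0) =ᶠ[𝓝 u] rampSum := by
    filter_upwards [gt_mem_nhds (lt_add_one u)] with v hv
    refine (rampSum_eq_sum ((Real.exp_le_exp.mpr hv.le).trans (Nat.le_ceil _))).symm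
  refine ContinuousAt.congr (Continuous.continuousAt ?_) h
  fun_prop

lemma rampSum_zero : rampSum 0 = 0 := by
  rw [rampSum_eq_sum (N := 1) (by simp)]
  simp

lemma hasLaplace_rampSum_term (n : ℕ) :
    HasLaplace (fun u => ((vonMangoldt n * max (1 / n - Real.exp (-u)) 0 : ℝ) : ℂ))
      fun z => LSeries.term (fun n => (vonMangoldt n : ℂ)) (1 + z) n * (1 / (z * (1 + z))) := by
  rcases Nat.eq_zero_or_pos n with rfl | hn
  · have := hasLaplace_one.const_mul 0
    refine this.congr (fun u _ => by simp) fun z hz => by simp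
  have hn' : (0 : ℝ) < n := by exact_mod_cast hn
  have hl : 0 ≤ Real.log n := Real.log_natCast_nonneg n
  have h := ((hasLaplace_indicator_exp (a := 0) (by simp) hl).const_mul (vonMangoldt n / n)).sub
    ((hasLaplace_indicator_exp (a := 1) (by simp) hl).const_mul (vonMangoldt n))
  refine h.congr (fun u _ => ?_) fun z hz => ?_
  · by_cases hu : u ∈ Set.Ioi (Real.log n)
    · rw [Set.indicator_of_mem hu, Set.indicator_of_mem hu, max_eq_left]
      · push_cast
        simp
        ring
      · rw [sub_nonneg, Real.exp_neg, one_div]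
        refine inv_anti₀ hn' ?_
        rw [← Real.log_le_iff_le_exp hn']
        exact le_of_lt hu
    · rw [Set.indicator_of_notMem hu, Set.indicator_of_notMem hu,
        rampSum_term_eq_zero ((Real.le_log_iff_exp_le hn').mp (not_lt.mp hu))]
      simp
  · have z0 := ne_zero_of_re_pos hz
    have z1 : 1 + z ≠ 0 := ne_zero_of_re_pos (by simp; linarith)
    have hnc : (n : ℂ) ≠ 0 := by exact_mod_cast hn.ne'
    have e0 : (n : ℂ) ^ (1 + z) = n * Complex.exp (z * Real.log n) := by
      rw [Complex.cpow_add _ _ hnc, Complex.cpow_one, Complex.cpow_def_of_ne_zero hnc,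
        Complex.ofReal_log hn'.le, mul_comm z]
      simp
    have e1 : Complex.exp (-(z + 0) * Real.log n) = (Complex.exp (z * Real.log n))⁻¹ := by
      rw [← Complex.exp_neg, add_zero, neg_mul]
    have e2 : Complex.exp (-(z + 1) * Real.log n) =
        (Complex.exp (z * Real.log n))⁻¹ * (n : ℂ)⁻¹ := by
      have : (n : ℂ) = Complex.exp (Real.log n) := by
        rw [← Complex.ofReal_exp, Real.exp_log hn']
        simp
      rw [show -(z + 1) * Real.log n = -(z * Real.log n) + -Real.log n by ring, Complex.exp_add,
        Complex.exp_neg, Complex.exp_neg, ← this]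
    rw [LSeries.term_of_ne_zero hn.ne', e0, e1, e2]
    have e3 := Complex.exp_ne_zero (z * Real.log n)
    rw [show z + 1 = 1 + z by ring, add_zero]
    field_simp
    ring

lemma hasLaplace_rampSum : HasLaplace (fun u => (rampSum u : ℂ))
    fun z => -logDeriv riemannZeta (1 + z) * (1 / (z * (1 + z))) := by
  have h := HasLaplace.tsum hasLaplace_rampSum_term (fun x hx => ?_) fun u hu => ?_
  · refine h.congr (fun u _ => ?_) fun z hz => ?_
    · rw [rampSum, Complex.ofReal_tsum]
    · rw [tsum_mul_right, neg_logDeriv_riemannZeta_eq_LSeries (by simpa using hz), LSeries]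
  · have h1 := LSeriesSummable_vonMangoldt (s := 1 + x) (by simpa using hx)
    have h2 := (h1.mul_right (1 / ((x : ℂ) * (1 + x)))).mapL Complex.reCLM
    refine h2.congr fun n => ?_
    have h3 := (hasLaplace_rampSum_term n x (by simpa using hx)).2
    have h4 : ∀ u : ℝ, ((vonMangoldt n * max (1 / n - Real.exp (-u)) 0 : ℝ) : ℂ) *
        Complex.exp (-x * u) = ((‖((vonMangoldt n * max (1 / n - Real.exp (-u)) 0 : ℝ) : ℂ)‖ *
          Real.exp (-x * u) : ℝ) : ℂ) := by
      intro u
      rw [Complex.norm_real, Real.norm_of_nonneg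
        (mul_nonneg vonMangoldt_nonneg (le_max_right _ _))]
      push_cast
      rfl
    simp only [h4] at h3
    rw [integral_complex_ofReal] at h3
    have := congrArg Complex.re h3
    rw [Complex.ofReal_re] at this
    rw [Complex.reCLM_apply]
    exact this.symm
  · refine summable_of_ne_finset_zero (s := Finset.range ⌈Real.exp u⌉₊) fun n hn => ?_
    rw [rampSum_term_eq_zero]
    · simp
    · refine (Nat.le_ceil _).trans ?_
      exact_mod_cast (not_lt.mp fun h' => hn (Finset.mem_range.mpr h'))

/-- The oscillating part of the explicit formula for `rampSum`. -/
noncomputable def explicitError (u : ℝ) : ℝ :=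
  (1 + Real.eulerMascheroniConstant - 2 * xiLogDerivOne) * Real.exp (-u) + trivialPart u +
    (zeroSum u).re

/-- The explicit formula. -/
theorem rampSum_eq {u : ℝ} (hu : 0 ≤ u) :
    rampSum u = u - 1 - Real.eulerMascheroniConstant + explicitError u := by
  set γ := Real.eulerMascheroniConstant with hγ
  have h1 := (hasLaplace_id.sub (hasLaplace_one.const_mul (1 + γ))).add
    ((hasLaplace_exp (a := 1) (by simp)).const_mul (1 + γ - 2 * xiLogDerivOne))
  have h2 := hasLaplace_rampSum.sub ((h1.add hasLaplace_trivialPart).add hasLaplace_zeroSum)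
  have h3 := h2.congr (G := fun _ => 0) (fun u _ => rfl) fun z hz => by
    have hz' : 1 < (1 + z).re := by simpa using hz
    have z0 := ne_zero_of_re_pos hz
    have z1 : 1 + z ≠ 0 := ne_zero_of_re_pos (by simp; linarith)
    rw [neg_logDeriv_riemannZeta hz', ← hγ, add_sub_cancel_left, show z + 1 = 1 + z by ring]
    push_cast
    field_simp
    ring
  have h4 := h3.eq_zero ?_ ?_ hu
  · have h5 := congrArg Complex.re h4
    have e : Complex.exp (-1 * (u : ℂ)) = (Real.exp (-u) : ℂ) := by
      push_cast
      rw [neg_one_mul]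
    rw [e] at h5
    have e2 : (1 + (γ : ℂ) - 2 * xiLogDerivOne) * (Real.exp (-u) : ℂ) =
        (((1 + γ - 2 * xiLogDerivOne) * Real.exp (-u) : ℝ) : ℂ) := by
      push_cast
      rfl
    rw [e2] at h5
    simp only [Complex.sub_re, Complex.add_re, Complex.ofReal_re, Complex.zero_re, mul_one,
      Complex.one_re] at h5
    rw [explicitError]
    linarith
  · refine ContinuousOn.sub ?_ ((ContinuousOn.add ?_ ?_).add continuousOn_zeroSum)
    · exact (Complex.continuous_ofReal.comp continuous_rampSum).continuousOn
    · exact Continuous.continuousOn (by fun_prop)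
    · exact Complex.continuous_ofReal.comp_continuousOn continuousOn_trivialPart
  · rw [rampSum_zero, trivialPart_zero, zeroSum_zero]
    simp

lemma xiLogDerivOne_nonneg : 0 ≤ xiLogDerivOne := by
  have := sum_zeros_one_le ∅ (by simp)
  simp at this
  exact this

lemma explicitError_le {u : ℝ} (hu : 0 ≤ u) :
    explicitError u ≤ 1.92 * Real.exp (-u) + ‖zeroSum u‖ := by
  have h1 := trivialPart_le hu
  have h2 := Complex.re_le_norm (zeroSum u)
  have h3 := Real.exp_pos (-u)
  have h4 := xiLogDerivOne_nonneg
  have h5 := eulerMascheroniConstant_lt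
  rw [explicitError]
  nlinarith

lemma neg_norm_zeroSum_le_explicitError {u : ℝ} (hu : 0 ≤ u) :
    -‖zeroSum u‖ ≤ explicitError u := by
  have h1 := trivialPart_nonneg hu
  have h2 := neg_le_of_abs_le (Complex.abs_re_le_norm (zeroSum u))
  have h3 := Real.exp_pos (-u)
  have h4 := xiLogDerivOne_le
  have h5 := lt_eulerMascheroniConstant
  rw [explicitError]
  nlinarith

lemma continuousOn_explicitError : ContinuousOn explicitError (Set.Ici 0) :=
  ((Continuous.continuousOn (by fun_prop)).add continuousOn_trivialPart).add
    (Complex.continuous_re.comp_continuousOn continuousOn_zeroSum)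

end ExplicitFormula

section Abelian

open MeasureTheory ArithmeticFunction

lemma integrableOn_exp_neg_mul {z : ℝ} (hz : 0 < z) :
    IntegrableOn (fun u : ℝ => Real.exp (-z * u)) (Set.Ioi 0) :=
  integrableOn_exp_mul_Ioi (by linarith) 0

lemma integral_exp_neg_mul {z : ℝ} (hz : 0 < z) :
    ∫ u in Set.Ioi (0 : ℝ), Real.exp (-z * u) = 1 / z := by
  rw [integral_exp_mul_Ioi (by linarith) 0]
  simp

/-- An Abelian theorem for Laplace transforms. -/
theorem tendsto_mul_laplace {f : ℝ → ℝ} {K : ℝ}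
    (hi : ∀ z : ℝ, 0 < z → IntegrableOn (fun u => f u * Real.exp (-z * u)) (Set.Ioi 0))
    (hf : Tendsto f atTop (𝓝 K)) :
    Tendsto (fun z => z * ∫ u in Set.Ioi (0 : ℝ), f u * Real.exp (-z * u)) (𝓝[>] 0) (𝓝 K) := by
  have hi' : ∀ z : ℝ, 0 < z →
      IntegrableOn (fun u => (f u - K) * Real.exp (-z * u)) (Set.Ioi 0) := by
    intro z hz
    simp only [sub_mul]
    exact (hi z hz).sub ((integrableOn_exp_neg_mul hz).const_mul K)
  have hsub : ∀ z : ℝ, 0 < z → z * ∫ u in Set.Ioi (0 : ℝ), f u * Real.exp (-z * u) =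
      K + z * ∫ u in Set.Ioi (0 : ℝ), (f u - K) * Real.exp (-z * u) := by
    intro z hz
    simp only [sub_mul]
    rw [integral_sub (hi z hz) ((integrableOn_exp_neg_mul hz).const_mul K), integral_const_mul,
      integral_exp_neg_mul hz]
    field_simp
    ring
  rw [Metric.tendsto_nhds]
  intro ε hε
  obtain ⟨A, hA⟩ := (Metric.tendsto_atTop.mp hf) (ε / 2) (by positivity)
  set B := ∫ u in Set.Ioi (0 : ℝ), |f u - K| * Real.exp (-1 * u) with hB
  have hlim : Tendsto (fun z : ℝ => z * (Real.exp A * B)) (𝓝[>] 0) (𝓝 0) := by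
    have : Tendsto (fun z : ℝ => z * (Real.exp A * B)) (𝓝 0) (𝓝 (0 * (Real.exp A * B))) :=
      tendsto_id.mul_const _
    rw [zero_mul] at this
    exact this.mono_left nhdsWithin_le_nhds
  have hi1 : IntegrableOn (fun u => |f u - K| * Real.exp (-1 * u)) (Set.Ioi 0) := by
    have h0 : IntegrableOn (fun u => ‖(f u - K) * Real.exp (-1 * u)‖) (Set.Ioi 0) :=
      (hi' 1 one_pos).norm
    refine h0.congr_fun (fun u _ => ?_) measurableSet_Ioi
    simp only [norm_mul, Real.norm_eq_abs, Real.abs_exp]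
  filter_upwards [self_mem_nhdsWithin, hlim.eventually (gt_mem_nhds (half_pos hε)),
    nhdsWithin_le_nhds (gt_mem_nhds one_pos)] with z hz hz1 hz2
  have hz0 : 0 < z := hz
  rw [hsub z hz0, Real.dist_eq, add_sub_cancel_left, abs_mul, abs_of_pos hz0]
  have hb : |∫ u in Set.Ioi (0 : ℝ), (f u - K) * Real.exp (-z * u)| ≤
      ∫ u in Set.Ioi (0 : ℝ), (Real.exp A * (|f u - K| * Real.exp (-1 * u)) +
        ε / 2 * Real.exp (-z * u)) := by
    rw [← Real.norm_eq_abs]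
    refine norm_integral_le_of_norm_le ((hi1.const_mul _).add
      ((integrableOn_exp_neg_mul hz0).const_mul _)) ?_
    refine (ae_restrict_iff' measurableSet_Ioi).mpr (Eventually.of_forall fun u hu => ?_)
    have hu0 : 0 < u := hu
    rw [norm_mul, Real.norm_eq_abs, Real.norm_eq_abs, Real.abs_exp]
    have p1 := Real.exp_pos (-z * u)
    rcases le_total A u with h | h
    · have h1 := (hA u h).le
      rw [Real.dist_eq] at h1
      have h2 : 0 ≤ Real.exp A * (|f u - K| * Real.exp (-1 * u)) := by positivity
      nlinarith
    · have h1 : Real.exp (-z * u) ≤ Real.exp A * Real.exp (-1 * u) := by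
        rw [← Real.exp_add]
        refine Real.exp_le_exp.mpr ?_
        nlinarith
      have h2 : 0 ≤ ε / 2 * Real.exp (-z * u) := by positivity
      have h3 := mul_le_mul_of_nonneg_left h1 (abs_nonneg (f u - K))
      linarith
  rw [integral_add (hi1.const_mul _) ((integrableOn_exp_neg_mul hz0).const_mul _),
    integral_const_mul, integral_const_mul, integral_exp_neg_mul hz0, ← hB] at hb
  have h4 := mul_le_mul_of_nonneg_left hb hz0.le
  have h5 : z * (Real.exp A * B + ε / 2 * (1 / z)) = z * (Real.exp A * B) + ε / 2 := by
    field_simp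
  linarith

lemma integral_log_mul_exp_neg :
    IntegrableOn (fun t : ℝ => Real.log t * Real.exp (-t)) (Set.Ioi 0) ∧
    ∫ t in Set.Ioi (0 : ℝ), Real.log t * Real.exp (-t) = -Real.eulerMascheroniConstant := by
  have h1 := Complex.hasDerivAt_GammaIntegral (s := 1) (by simp)
  have h2 : Complex.GammaIntegral =ᶠ[𝓝 1] Complex.Gamma := by
    have : ∀ᶠ s : ℂ in 𝓝 1, 0 < s.re :=
      (isOpen_lt continuous_const Complex.continuous_re).mem_nhds (by simp)
    filter_upwards [this] with s hs
    exact (Complex.Gamma_eq_integral hs).symm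
  have h3 := (h1.congr_of_eventuallyEq h2.symm).unique Complex.hasDerivAt_Gamma_one
  have h4 : ∫ t in Set.Ioi (0 : ℝ), Real.log t * Real.exp (-t) =
      -Real.eulerMascheroniConstant := by
    have e : ∀ t : ℝ, (t : ℂ) ^ ((1 : ℂ) - 1) * (Real.log t * Real.exp (-t)) =
        ((Real.log t * Real.exp (-t) : ℝ) : ℂ) := by
      intro t
      simp
    simp only [e] at h3
    rw [integral_complex_ofReal] at h3
    exact_mod_cast h3
  refine ⟨?_, h4⟩
  by_contra hni
  rw [integral_undef hni] at h4
  have := lt_eulerMascheroniConstant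
  linarith

lemma integral_log_mul_exp_neg_mul {z : ℝ} (hz : 0 < z) :
    IntegrableOn (fun u : ℝ => Real.log u * Real.exp (-z * u)) (Set.Ioi 0) ∧
    z * ∫ u in Set.Ioi (0 : ℝ), Real.log u * Real.exp (-z * u) =
      -Real.eulerMascheroniConstant - Real.log z := by
  obtain ⟨h1, h2⟩ := integral_log_mul_exp_neg
  have e : Set.EqOn (fun u : ℝ => Real.log (z * u) * Real.exp (-(z * u)) -
      Real.log z * Real.exp (-z * u)) (fun u : ℝ => Real.log u * Real.exp (-z * u))
      (Set.Ioi 0) := by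
    intro u hu
    simp only [Real.log_mul hz.ne' (ne_of_gt hu)]
    rw [neg_mul]
    ring
  have h3 : IntegrableOn (fun u : ℝ => Real.log (z * u) * Real.exp (-(z * u))) (Set.Ioi 0) := by
    have := (integrableOn_Ioi_comp_mul_left_iff
      (fun t : ℝ => Real.log t * Real.exp (-t)) 0 hz).mpr (by simpa using h1)
    exact this
  have h4 := integral_comp_mul_left_Ioi (fun t : ℝ => Real.log t * Real.exp (-t)) 0 hz
  rw [mul_zero, h2, smul_eq_mul] at h4
  refine ⟨(h3.sub ((integrableOn_exp_neg_mul hz).const_mul _)).congr_fun e measurableSet_Ioi, ?_⟩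
  rw [← setIntegral_congr_fun measurableSet_Ioi e,
    integral_sub h3 ((integrableOn_exp_neg_mul hz).const_mul _), h4, integral_const_mul,
    integral_exp_neg_mul hz]
  field_simp

/-- The Dirichlet series of `log ζ`. -/
lemma exp_LSeries_vonMangoldt_div_log {x : ℝ} (hx : 1 < x) :
    Complex.exp (LSeries (fun n => ((vonMangoldt n / Real.log n : ℝ) : ℂ)) x) = riemannZeta x := by
  set f : ℕ → ℂ := fun n => ((vonMangoldt n / Real.log n : ℝ) : ℂ) with hf
  have habs : LSeries.abscissaOfAbsConv f ≤ 1 := by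
    refine LSeries.abscissaOfAbsConv_le_of_le_const ⟨1, fun n _ => ?_⟩
    rw [hf, Complex.norm_real, Real.norm_of_nonneg
      (div_nonneg vonMangoldt_nonneg (Real.log_natCast_nonneg n))]
    exact div_le_one_of_le₀ vonMangoldt_le_log (Real.log_natCast_nonneg n)
  have hlog : ∀ {n : ℕ}, n ≠ 0 → LSeries.logMul f n = (vonMangoldt n : ℂ) := by
    intro n hn
    rw [LSeries.logMul, hf]
    rcases eq_or_ne n 1 with rfl | h1
    · simp
    · have hl : Real.log n ≠ 0 := by
        refine (Real.log_pos ?_).ne'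
        exact_mod_cast (by omega : 1 < n)
      rw [← Complex.natCast_log, ← Complex.ofReal_mul, mul_div_cancel₀ _ hl]
  have hder : ∀ y : ℝ, 1 < y → HasDerivAt
      (fun y : ℝ => Complex.exp (-LSeries f y) * riemannZeta y) 0 y := by
    intro y hy
    have hy' : 1 < (y : ℂ).re := by simpa using hy
    have h1 := LSeries_hasDerivAt (f := f) (s := y)
      (habs.trans_lt (by simpa using (EReal.coe_lt_coe_iff.mpr hy)))
    rw [LSeries_congr hlog, ← neg_logDeriv_riemannZeta_eq_LSeries hy', neg_neg] at h1
    have hz : riemannZeta y ≠ 0 := riemannZeta_ne_zero_of_one_lt_re hy'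
    have h2 : HasDerivAt riemannZeta (deriv riemannZeta y) (y : ℂ) :=
      (differentiableAt_riemannZeta (by
        intro h
        rw [h] at hy'
        simp at hy')).hasDerivAt
    have h3 := (h1.neg.cexp.mul h2).comp_ofReal
    refine h3.congr_deriv ?_
    rw [logDeriv_apply]
    simp only [Pi.neg_apply]
    field_simp
    ring
  have hlim : Tendsto (fun y : ℝ => Complex.exp (-LSeries f y) * riemannZeta y) atTop (𝓝 1) := by
    have h1 := LSeries.tendsto_atTop (f := f) (habs.trans_lt (by decide))
    have h2 := LSeries.tendsto_atTop (f := 1)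
      (by rw [LSeries.abscissaOfAbsConv_one]; decide)
    have h3 := ((Complex.continuous_exp.tendsto _).comp h1.neg).mul h2
    have e : Complex.exp (-f 1) * (1 : ℕ → ℂ) 1 = 1 := by simp [hf]
    rw [e] at h3
    refine h3.congr' ?_
    filter_upwards [eventually_gt_atTop 1] with y hy
    rw [LSeries_one_eq_riemannZeta (by simpa using hy)]
    rfl
  have hconst : ∀ y ∈ Set.Ioi (1 : ℝ), Complex.exp (-LSeries f y) * riemannZeta y =
      Complex.exp (-LSeries f x) * riemannZeta x := by
    intro y hy
    exact (convex_Ioi (1 : ℝ)).is_const_of_fderivWithin_eq_zero (𝕜 := ℝ)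
      (f := fun y : ℝ => Complex.exp (-LSeries f y) * riemannZeta y)
      (fun w hw => (hder w hw).differentiableAt.differentiableWithinAt)
      (fun w hw => by
        rw [fderivWithin_of_isOpen isOpen_Ioi hw]
        ext
        simp [(hder w hw).deriv]) hy hx
  have h1 : Complex.exp (-LSeries f x) * riemannZeta x = 1 := by
    refine tendsto_nhds_unique (tendsto_const_nhds.congr' ?_) hlim
    filter_upwards [eventually_gt_atTop 1] with y hy
    exact (hconst y hy).symm
  rw [Complex.exp_neg, inv_mul_eq_one₀ (Complex.exp_ne_zero _)] at h1
  exact h1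

/-- The sum `∑ Λ(n) / (n log n)` over `n < exp u`. -/
noncomputable def mertensPartial (u : ℝ) : ℝ :=
  ∑' n : ℕ, (Set.Ioi (Real.log n)).indicator (fun _ => vonMangoldt n / (n * Real.log n)) u

lemma mertensPartial_term_nonneg (n : ℕ) (u : ℝ) :
    0 ≤ (Set.Ioi (Real.log n)).indicator (fun _ => vonMangoldt n / (n * Real.log n)) u := by
  refine Set.indicator_nonneg (fun _ _ => ?_) u
  exact div_nonneg vonMangoldt_nonneg (mul_nonneg (Nat.cast_nonneg n) (Real.log_natCast_nonneg n))

lemma mertensPartial_term_eq_zero {u : ℝ} {n : ℕ} (h : Real.exp u ≤ n) :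
    (Set.Ioi (Real.log n)).indicator (fun _ => vonMangoldt n / (n * Real.log n)) u = 0 := by
  refine Set.indicator_of_notMem (fun h' => ?_) _
  have hn : (0 : ℝ) < n := (Real.exp_pos u).trans_le h
  exact absurd ((Real.le_log_iff_exp_le hn).mpr h) (not_le.mpr h')

lemma hasLaplace_mertensPartial_term (n : ℕ) :
    HasLaplace (fun u => (((Set.Ioi (Real.log n)).indicator
      (fun _ => vonMangoldt n / (n * Real.log n)) u : ℝ) : ℂ))
      fun z => LSeries.term (fun n => ((vonMangoldt n / Real.log n : ℝ) : ℂ)) (1 + z) n *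
        (1 / z) := by
  rcases Nat.eq_zero_or_pos n with rfl | hn
  · have := hasLaplace_one.const_mul 0
    refine this.congr (fun u _ => by simp) fun z hz => by simp
  have hn' : (0 : ℝ) < n := by exact_mod_cast hn
  have hl : 0 ≤ Real.log n := Real.log_natCast_nonneg n
  have h := (hasLaplace_indicator_exp (a := 0) (by simp) hl).const_mul
    ((vonMangoldt n / (n * Real.log n) : ℝ) : ℂ)
  refine h.congr (fun u _ => ?_) fun z hz => ?_
  · by_cases hu : u ∈ Set.Ioi (Real.log n)
    · rw [Set.indicator_of_mem hu, Set.indicator_of_mem hu]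
      simp
    · rw [Set.indicator_of_notMem hu, Set.indicator_of_notMem hu]
      simp
  · have hnc : (n : ℂ) ≠ 0 := by exact_mod_cast hn.ne'
    have e0 : (n : ℂ) ^ (1 + z) = n * Complex.exp (z * Real.log n) := by
      rw [Complex.cpow_add _ _ hnc, Complex.cpow_one, Complex.cpow_def_of_ne_zero hnc,
        Complex.ofReal_log hn'.le, mul_comm z]
      simp
    have e1 : Complex.exp (-(z + 0) * Real.log n) = (Complex.exp (z * Real.log n))⁻¹ := by
      rw [← Complex.exp_neg, add_zero, neg_mul]
    rw [LSeries.term_of_ne_zero hn.ne', e0, e1, add_zero]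
    push_cast
    simp only [div_eq_mul_inv, mul_inv]
    ring

lemma summable_mertensPartial (u : ℝ) : Summable fun n : ℕ =>
    (Set.Ioi (Real.log n)).indicator (fun _ => vonMangoldt n / (n * Real.log n)) u := by
  refine summable_of_ne_finset_zero (s := Finset.range ⌈Real.exp u⌉₊) fun n hn => ?_
  refine mertensPartial_term_eq_zero ((Nat.le_ceil _).trans ?_)
  exact_mod_cast (not_lt.mp fun h' => hn (Finset.mem_range.mpr h'))

lemma hasLaplace_mertensPartial : HasLaplace (fun u => (mertensPartial u : ℂ))
    fun z => LSeries (fun n => ((vonMangoldt n / Real.log n : ℝ) : ℂ)) (1 + z) * (1 / z) := by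
  have h := HasLaplace.tsum hasLaplace_mertensPartial_term (fun x hx => ?_) fun u hu => ?_
  · refine h.congr (fun u _ => ?_) fun z hz => ?_
    · rw [mertensPartial, Complex.ofReal_tsum]
    · rw [tsum_mul_right, LSeries]
  · have habs : LSeriesSummable (fun n => ((vonMangoldt n / Real.log n : ℝ) : ℂ))
        (1 + (x : ℂ)) := by
      refine LSeriesSummable_of_bounded_of_one_lt_re (m := 1) (fun n _ => ?_) (by simpa using hx)
      rw [Complex.norm_real, Real.norm_of_nonneg
        (div_nonneg vonMangoldt_nonneg (Real.log_natCast_nonneg n))]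
      exact div_le_one_of_le₀ vonMangoldt_le_log (Real.log_natCast_nonneg n)
    have h2 := (habs.mul_right (1 / (x : ℂ))).mapL Complex.reCLM
    refine h2.congr fun n => ?_
    have h3 := (hasLaplace_mertensPartial_term n x (by simpa using hx)).2
    have h4 : ∀ u : ℝ, (((Set.Ioi (Real.log n)).indicator
        (fun _ => vonMangoldt n / (n * Real.log n)) u : ℝ) : ℂ) *
        Complex.exp (-x * u) = ((‖(((Set.Ioi (Real.log n)).indicator
          (fun _ => vonMangoldt n / (n * Real.log n)) u : ℝ) : ℂ)‖ *
          Real.exp (-x * u) : ℝ) : ℂ) := by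
      intro u
      rw [Complex.norm_real, Real.norm_of_nonneg (mertensPartial_term_nonneg n u)]
      push_cast
      rfl
    simp only [h4] at h3
    rw [integral_complex_ofReal] at h3
    have := congrArg Complex.re h3
    rw [Complex.ofReal_re] at this
    rw [Complex.reCLM_apply]
    exact this.symm
  · simp only [Complex.norm_real]
    exact (summable_mertensPartial u).norm

lemma integral_mertensPartial {x : ℝ} (hx : 0 < x) :
    IntegrableOn (fun u => mertensPartial u * Real.exp (-x * u)) (Set.Ioi 0) ∧
    x * ∫ u in Set.Ioi (0 : ℝ), mertensPartial u * Real.exp (-x * u) =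
      Real.log (riemannZeta (1 + x : ℝ)).re := by
  obtain ⟨h1, h2⟩ := hasLaplace_mertensPartial x (by simpa using hx)
  have e : ∀ u : ℝ, (mertensPartial u : ℂ) * Complex.exp (-x * u) =
      ((mertensPartial u * Real.exp (-x * u) : ℝ) : ℂ) := by
    intro u
    push_cast
    rfl
  simp only [e] at h1 h2
  refine ⟨h1.re, ?_⟩
  rw [integral_complex_ofReal] at h2
  have hxc : (x : ℂ) ≠ 0 := by exact_mod_cast hx.ne'
  have h3 := exp_LSeries_vonMangoldt_div_log (x := 1 + x) (by linarith)
  have h4 : LSeries (fun n => ((vonMangoldt n / Real.log n : ℝ) : ℂ)) ((1 + x : ℝ) : ℂ) =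
      ((x * ∫ u in Set.Ioi (0 : ℝ), mertensPartial u * Real.exp (-x * u) : ℝ) : ℂ) := by
    rw [Complex.ofReal_mul, h2]
    push_cast
    field_simp
  rw [h4, ← Complex.ofReal_exp] at h3
  rw [← h3, Complex.ofReal_re, Real.log_exp]

/-- The constant in Mertens' theorem is the Euler–Mascheroni constant. -/
theorem eq_eulerMascheroniConstant_of_tendsto {K : ℝ}
    (h : Tendsto (fun u => mertensPartial u - Real.log u) atTop (𝓝 K)) :
    K = Real.eulerMascheroniConstant := by
  have h1 := tendsto_mul_laplace (fun z hz => by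
    simp only [sub_mul]
    exact (integral_mertensPartial hz).1.sub (integral_log_mul_exp_neg_mul hz).1) h
  refine tendsto_nhds_unique h1 ?_
  have h2 := log_riemannZeta_add_log_sub_isLittleO_ofReal.tendsto_div_nhds_zero
  have h3 : Tendsto (fun z : ℝ => 1 + z) (𝓝[>] 0) (𝓝[>] 1) := by
    refine tendsto_nhdsWithin_of_tendsto_nhds_of_eventually_within _ ?_ ?_
    · have : Tendsto (fun z : ℝ => 1 + z) (𝓝 0) (𝓝 (1 + 0)) := tendsto_id.const_add 1
      rw [add_zero] at this
      exact this.mono_left nhdsWithin_le_nhds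
    · filter_upwards [self_mem_nhdsWithin] with z hz
      have : 0 < z := hz
      simp only [Set.mem_Ioi]
      linarith
  have h4 := (h2.comp h3).add_const Real.eulerMascheroniConstant
  rw [zero_add] at h4
  refine h4.congr' ?_
  filter_upwards [self_mem_nhdsWithin] with z hz
  simp only [sub_mul]
  rw [integral_sub (integral_mertensPartial hz).1 (integral_log_mul_exp_neg_mul hz).1, mul_sub,
    (integral_mertensPartial hz).2, (integral_log_mul_exp_neg_mul hz).2]
  simp only [Function.comp_apply, div_one, add_sub_cancel_left]
  ring

end Abelian

section PartialSummation

open MeasureTheory ArithmeticFunction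

/-- The sum `∑ Λ(n) (1 / (n log n) - 1 / (y log y))` over `n < y`, with `y = exp U`. -/
noncomputable def mertensSum (U : ℝ) : ℝ :=
  ∑' n : ℕ, vonMangoldt n * max (1 / (n * Real.log n) - 1 / (Real.exp U * U)) 0

/-- The function `1 / v + 1 / v ^ 2`. -/
noncomputable def tailWeight (v : ℝ) : ℝ := 1 / v + 1 / v ^ 2

/-- The function `1 / v ^ 2 + 2 / v ^ 3`, minus the derivative of `tailWeight`. -/
noncomputable def negDerivTailWeight (v : ℝ) : ℝ := 1 / v ^ 2 + 2 / v ^ 3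

lemma hasDerivAt_tailWeight {v : ℝ} (hv : 0 < v) :
    HasDerivAt tailWeight (-negDerivTailWeight v) v := by
  have h1 := (hasDerivAt_inv hv.ne').add ((hasDerivAt_pow 2 v).inv (by positivity))
  refine (h1.congr_deriv ?_).congr_of_eventuallyEq (Eventually.of_forall fun x => ?_)
  · rw [negDerivTailWeight]
    field_simp
    ring
  · simp [tailWeight]

lemma negDerivTailWeight_nonneg {v : ℝ} (hv : 0 < v) : 0 ≤ negDerivTailWeight v := by
  rw [negDerivTailWeight]
  positivity

lemma continuousOn_negDerivTailWeight : ContinuousOn negDerivTailWeight (Set.Ioi 0) := by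
  refine ContinuousOn.add ?_ ?_
  · exact continuousOn_const.div (by fun_prop) fun v (hv : 0 < v) => by positivity
  · exact continuousOn_const.div (by fun_prop) fun v (hv : 0 < v) => by positivity

lemma log_two_pos : 0 < Real.log 2 := Real.log_pos one_lt_two

lemma uIcc_subset_Ioi {a b : ℝ} (ha : 0 < a) (hb : 0 < b) : Set.uIcc a b ⊆ Set.Ioi 0 :=
  fun _ hx => lt_of_lt_of_le (lt_min ha hb) hx.1

lemma intervalIntegrable_mul_negDerivTailWeight {f : ℝ → ℝ} (hf : ContinuousOn f (Set.Ioi 0))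
    {a b : ℝ} (ha : 0 < a) (hb : 0 < b) :
    IntervalIntegrable (fun v => f v * negDerivTailWeight v) volume a b :=
  ((hf.mul continuousOn_negDerivTailWeight).mono (uIcc_subset_Ioi ha hb)).intervalIntegrable

lemma one_div_mul_log_eq {t U : ℝ} (ht : Real.log 2 ≤ t) (hU : Real.log 2 ≤ U) :
    max (1 / (Real.exp t * t) - 1 / (Real.exp U * U)) 0 =
      max (1 / Real.exp t - Real.exp (-U)) 0 * tailWeight U +
        ∫ v in (Real.log 2)..U,
          max (1 / Real.exp t - Real.exp (-v)) 0 * negDerivTailWeight v := by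
  have hl := log_two_pos
  have ht0 : 0 < t := hl.trans_le ht
  have hU0 : 0 < U := hl.trans_le hU
  have e1 : ∀ v, 1 / Real.exp t - Real.exp (-v) = Real.exp (-t) - Real.exp (-v) := fun v => by
    rw [Real.exp_neg t, one_div]
  simp only [e1]
  have hz : ∀ v ≤ t, max (Real.exp (-t) - Real.exp (-v)) 0 = 0 := fun v hv =>
    max_eq_right (sub_nonpos.mpr (Real.exp_le_exp.mpr (neg_le_neg hv)))
  have hzi : ∀ V, Real.log 2 ≤ V → V ≤ t → ∫ v in (Real.log 2)..V,
      max (Real.exp (-t) - Real.exp (-v)) 0 * negDerivTailWeight v = 0 := fun V hV1 hV => by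
    rw [intervalIntegral.integral_congr (g := fun _ => 0), intervalIntegral.integral_zero]
    intro v hv
    rw [Set.uIcc_of_le hV1] at hv
    simp only [hz v (hv.2.trans hV), zero_mul]
  rcases le_total U t with h | h
  · rw [hzi U hU h, hz U h, max_eq_right]
    · ring
    · rw [sub_nonpos]
      have := Real.exp_le_exp.mpr h
      gcongr
  · have hc : ContinuousOn (fun v => max (Real.exp (-t) - Real.exp (-v)) 0) (Set.Ioi 0) := by
      fun_prop
    rw [← intervalIntegral.integral_add_adjacent_intervals
      (intervalIntegrable_mul_negDerivTailWeight hc hl ht0)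
      (intervalIntegrable_mul_negDerivTailWeight hc ht0 hU0), hzi t ht le_rfl, zero_add]
    have hm : ∀ v, t ≤ v → max (Real.exp (-t) - Real.exp (-v)) 0 =
        Real.exp (-t) - Real.exp (-v) := fun v hv =>
      max_eq_left (sub_nonneg.mpr (Real.exp_le_exp.mpr (neg_le_neg hv)))
    rw [intervalIntegral.integral_congr (g := fun v =>
      (Real.exp (-t) - Real.exp (-v)) * negDerivTailWeight v), hm U h, max_eq_left]
    · have hd : ∀ v ∈ Set.uIcc t U, HasDerivAt (fun v => -((Real.exp (-t) - Real.exp (-v)) *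
          tailWeight v) - Real.exp (-v) * v⁻¹)
          ((Real.exp (-t) - Real.exp (-v)) * negDerivTailWeight v) v := by
        intro v hv
        have hv0 : 0 < v := uIcc_subset_Ioi ht0 hU0 hv
        have h1 : HasDerivAt (fun v : ℝ => Real.exp (-v)) (-Real.exp (-v)) v := by
          simpa using (hasDerivAt_neg v).exp
        refine ((((h1.const_sub (Real.exp (-t))).mul (hasDerivAt_tailWeight hv0)).neg).sub
          (h1.mul (hasDerivAt_inv hv0.ne'))).congr_deriv ?_
        rw [tailWeight]
        field_simp
        ring
      have hc' : ContinuousOn (fun v => Real.exp (-t) - Real.exp (-v)) (Set.Ioi 0) := by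
        fun_prop
      rw [intervalIntegral.integral_eq_sub_of_hasDerivAt hd
        (intervalIntegrable_mul_negDerivTailWeight hc' ht0 hU0)]
      rw [Real.exp_neg, Real.exp_neg]
      field_simp
      ring
    · rw [sub_nonneg]
      have := Real.exp_le_exp.mpr h
      gcongr
    · intro v hv
      rw [Set.uIcc_of_le h] at hv
      simp only [hm v hv.1]

lemma mertensSum_term_eq_zero {U : ℝ} (hU : 0 < U) {n : ℕ} (h : Real.exp U ≤ n) :
    vonMangoldt n * max (1 / (n * Real.log n) - 1 / (Real.exp U * U)) 0 = 0 := by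
  rw [max_eq_right, mul_zero]
  have := (Real.le_log_iff_exp_le ((Real.exp_pos U).trans_le h)).mpr h
  rw [sub_nonpos]
  gcongr

lemma mertensSum_eq_sum {U : ℝ} (hU : 0 < U) {N : ℕ} (h : Real.exp U ≤ N) : mertensSum U =
    ∑ n ∈ Finset.range N,
      vonMangoldt n * max (1 / (n * Real.log n) - 1 / (Real.exp U * U)) 0 := by
  refine tsum_eq_sum fun n hn => mertensSum_term_eq_zero hU (h.trans ?_)
  exact_mod_cast (not_lt.mp fun h' => hn (Finset.mem_range.mpr h'))

lemma vonMangoldt_eq_zero_of_lt_two {n : ℕ} (h : n < 2) : vonMangoldt n = 0 := by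
  interval_cases n <;> simp

lemma mertensSum_eq_rampSum {U : ℝ} (hU : Real.log 2 ≤ U) :
    mertensSum U = rampSum U * tailWeight U +
      ∫ v in (Real.log 2)..U, rampSum v * negDerivTailWeight v := by
  have hl := log_two_pos
  have hU0 : 0 < U := hl.trans_le hU
  set N := ⌈Real.exp U⌉₊
  have hN : Real.exp U ≤ N := Nat.le_ceil _
  rw [mertensSum_eq_sum hU0 hN, rampSum_eq_sum hN,
    intervalIntegral.integral_congr (g := fun v => ∑ n ∈ Finset.range N,
      vonMangoldt n * max (1 / n - Real.exp (-v)) 0 * negDerivTailWeight v),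
    intervalIntegral.integral_finsetSum, Finset.sum_mul, ← Finset.sum_add_distrib]
  · refine Finset.sum_congr rfl fun n _ => ?_
    rcases lt_or_ge n 2 with h2 | h2
    · simp [vonMangoldt_eq_zero_of_lt_two h2]
    have h2' : (2 : ℝ) ≤ n := by exact_mod_cast h2
    have h := one_div_mul_log_eq (Real.log_le_log two_pos h2') hU
    rw [Real.exp_log (by linarith)] at h
    simp only [mul_assoc]
    rw [intervalIntegral.integral_const_mul, h]
    ring
  · intro n _
    refine intervalIntegrable_mul_negDerivTailWeight ?_ hl hU0
    fun_prop
  · intro v hv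
    rw [Set.uIcc_of_le hU] at hv
    simp only
    rw [rampSum_eq_sum ((Real.exp_le_exp.mpr hv.2).trans hN), Finset.sum_mul]

lemma continuousOn_explicitError_Ioi : ContinuousOn explicitError (Set.Ioi 0) :=
  continuousOn_explicitError.mono Set.Ioi_subset_Ici_self

lemma exists_mertensSum_eq : ∃ C : ℝ, ∀ U, Real.log 2 ≤ U →
    mertensSum U = explicitError U * tailWeight U + Real.log U - 1 / U + C +
      ∫ v in (Real.log 2)..U, explicitError v * negDerivTailWeight v := by
  have hl := log_two_pos
  set γ := Real.eulerMascheroniConstant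
  set G : ℝ → ℝ := fun v => -((v - (1 + γ)) * tailWeight v) + Real.log v - v⁻¹ with hG
  refine ⟨-G (Real.log 2), fun U hU => ?_⟩
  have hU0 : 0 < U := hl.trans_le hU
  have hd : ∀ v ∈ Set.uIcc (Real.log 2) U,
      HasDerivAt G ((v - (1 + γ)) * negDerivTailWeight v) v := by
    intro v hv
    have hv0 : 0 < v := uIcc_subset_Ioi hl hU0 hv
    refine ((((((hasDerivAt_id v).sub_const (1 + γ)).mul (hasDerivAt_tailWeight hv0)).neg).add
      (Real.hasDerivAt_log hv0.ne')).sub (hasDerivAt_inv hv0.ne')).congr_deriv ?_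
    simp only [id, tailWeight]
    field_simp
    ring
  have hc : ContinuousOn (fun v : ℝ => v - (1 + γ)) (Set.Ioi 0) := by fun_prop
  have hi := intervalIntegrable_mul_negDerivTailWeight hc hl hU0
  rw [mertensSum_eq_rampSum hU, rampSum_eq hU0.le,
    intervalIntegral.integral_congr (g := fun v => (v - (1 + γ)) * negDerivTailWeight v +
      explicitError v * negDerivTailWeight v),
    intervalIntegral.integral_add hi
      (intervalIntegrable_mul_negDerivTailWeight continuousOn_explicitError_Ioi hl hU0),
    intervalIntegral.integral_eq_sub_of_hasDerivAt hd hi]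
  · simp only [hG, one_div]
    ring
  · intro v hv
    have hv0 : 0 < v := uIcc_subset_Ioi hl hU0 hv
    simp only
    rw [rampSum_eq hv0.le]
    ring

lemma tendsto_tailWeight : Tendsto tailWeight atTop (𝓝 0) := by
  have h1 : Tendsto (fun v : ℝ => 1 / v) atTop (𝓝 0) := by
    simpa only [one_div] using tendsto_inv_atTop_zero (𝕜 := ℝ)
  have h2 := h1.add (h1.pow 2)
  simp only [one_div_pow] at h2
  rw [show (0 : ℝ) + 0 ^ 2 = 0 by norm_num] at h2
  exact h2

lemma integrableOn_negDerivTailWeight {U : ℝ} (hU : 0 < U) :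
    IntegrableOn negDerivTailWeight (Set.Ioi U) := by
  have h := integrableOn_Ioi_deriv_of_nonpos' (g := tailWeight)
    (g' := fun v => -negDerivTailWeight v) (a := U) (l := 0)
    (fun v hv => hasDerivAt_tailWeight (hU.trans_le hv))
    (fun v hv => neg_nonpos.mpr (negDerivTailWeight_nonneg (hU.trans hv))) tendsto_tailWeight
  simpa using h.neg

lemma integral_negDerivTailWeight {U : ℝ} (hU : 0 < U) :
    ∫ v in Set.Ioi U, negDerivTailWeight v = tailWeight U := by
  have h := integral_Ioi_of_hasDerivAt_of_nonpos' (g := tailWeight)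
    (g' := fun v => -negDerivTailWeight v) (a := U) (l := 0)
    (fun v hv => hasDerivAt_tailWeight (hU.trans_le hv))
    (fun v hv => neg_nonpos.mpr (negDerivTailWeight_nonneg (hU.trans hv))) tendsto_tailWeight
  rw [integral_neg] at h
  linarith

lemma abs_explicitError_le {u : ℝ} (hu : 0 ≤ u) : |explicitError u| ≤ 2 := by
  have h1 := norm_zeroSum_le hu
  have h2 := explicitError_le hu
  have h3 := neg_norm_zeroSum_le_explicitError hu
  have h4 : Real.exp (-u) ≤ 1 := Real.exp_le_one_iff.mpr (by linarith)
  rw [abs_le]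
  constructor <;> linarith

lemma integrableOn_explicitError_mul {U : ℝ} (hU : 0 < U) :
    IntegrableOn (fun v => explicitError v * negDerivTailWeight v) (Set.Ioi U) := by
  refine Integrable.mono' ((integrableOn_negDerivTailWeight hU).const_mul 2) ?_ ?_
  · refine ContinuousOn.aestronglyMeasurable ?_ measurableSet_Ioi
    exact (continuousOn_explicitError_Ioi.mul continuousOn_negDerivTailWeight).mono
      (Set.Ioi_subset_Ioi hU.le)
  · refine (ae_restrict_iff' measurableSet_Ioi).mpr (Eventually.of_forall fun v hv => ?_)
    have hv0 : 0 < v := hU.trans hv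
    rw [norm_mul, Real.norm_of_nonneg (negDerivTailWeight_nonneg hv0), Real.norm_eq_abs]
    exact mul_le_mul_of_nonneg_right (abs_explicitError_le hv0.le) (negDerivTailWeight_nonneg hv0)

lemma abs_mertensPartial_sub_mertensSum_le {U : ℝ} (hU : 0 < U) :
    |mertensPartial U - mertensSum U| ≤ (Real.log 4 + 4) / U := by
  set N := ⌊Real.exp U⌋₊ + 1
  have hN : Real.exp U ≤ N := by
    simpa [N] using (Nat.lt_floor_add_one (Real.exp U)).le
  have h1 : mertensPartial U = ∑ n ∈ Finset.range N,
      (Set.Ioi (Real.log n)).indicator (fun _ => vonMangoldt n / (n * Real.log n)) U := by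
    refine tsum_eq_sum fun n hn => mertensPartial_term_eq_zero (hN.trans ?_)
    exact_mod_cast (not_lt.mp fun h' => hn (Finset.mem_range.mpr h'))
  have hterm : ∀ n ∈ Finset.range N,
      |(Set.Ioi (Real.log n)).indicator (fun _ => vonMangoldt n / (n * Real.log n)) U -
        vonMangoldt n * max (1 / (n * Real.log n) - 1 / (Real.exp U * U)) 0| ≤
      vonMangoldt n * (1 / (Real.exp U * U)) := by
    intro n _
    rcases lt_or_ge n 2 with h2 | h2
    · simp [vonMangoldt_eq_zero_of_lt_two h2]
    have h2' : (2 : ℝ) ≤ n := by exact_mod_cast h2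
    have hn0 : (0 : ℝ) < n := by linarith
    have hln : 0 < Real.log n := Real.log_pos (by linarith)
    have hE := Real.exp_pos U
    have hL : 0 ≤ vonMangoldt n := vonMangoldt_nonneg
    by_cases h : Real.log n < U
    · rw [Set.indicator_of_mem (show U ∈ Set.Ioi (Real.log n) from h), max_eq_left]
      · rw [show vonMangoldt n / (n * Real.log n) - vonMangoldt n * (1 / (n * Real.log n) -
          1 / (Real.exp U * U)) = vonMangoldt n * (1 / (Real.exp U * U)) by ring,
          abs_of_nonneg (by positivity)]
      · rw [sub_nonneg]
        have := (Real.log_le_iff_le_exp hn0).mp h.le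
        gcongr
    · rw [Set.indicator_of_notMem (show U ∉ Set.Ioi (Real.log n) from h),
        mertensSum_term_eq_zero hU ((Real.le_log_iff_exp_le hn0).mp (not_lt.mp h))]
      simp only [sub_zero, abs_zero]
      positivity
  rw [h1, mertensSum_eq_sum hU hN, ← Finset.sum_sub_distrib]
  refine (Finset.abs_sum_le_sum_abs _ _).trans ((Finset.sum_le_sum hterm).trans ?_)
  rw [← Finset.sum_mul]
  have hpsi : ∑ n ∈ Finset.range N, vonMangoldt n = Chebyshev.psi (Real.exp U) := by
    rw [Chebyshev.psi_eq_sum_Icc]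
    congr 1
    ext n
    simp [N]
  rw [hpsi]
  have hE := Real.exp_pos U
  calc Chebyshev.psi (Real.exp U) * (1 / (Real.exp U * U))
      ≤ ((Real.log 4 + 4) * Real.exp U) * (1 / (Real.exp U * U)) := by
        gcongr
        exact Chebyshev.psi_le_const_mul_self hE.le
    _ = _ := by field_simp

/-- An explicit form of Mertens' second theorem. -/
theorem mertensSum_eq {U : ℝ} (hU : Real.log 2 ≤ U) :
    mertensSum U + 1 / U = Real.eulerMascheroniConstant + Real.log U +
      explicitError U * tailWeight U -
      ∫ v in Set.Ioi U, explicitError v * negDerivTailWeight v := by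
  have hl := log_two_pos
  obtain ⟨C, hC⟩ := exists_mertensSum_eq
  set I := ∫ v in Set.Ioi (Real.log 2), explicitError v * negDerivTailWeight v with hI
  have hzero : Tendsto (fun U => explicitError U * tailWeight U) atTop (𝓝 0) := by
    refine squeeze_zero_norm' (a := fun U => 2 * |tailWeight U|) ?_ ?_
    · filter_upwards [eventually_ge_atTop 0] with u hu
      rw [norm_mul, Real.norm_eq_abs, Real.norm_eq_abs]
      exact mul_le_mul_of_nonneg_right (abs_explicitError_le hu) (abs_nonneg _)
    · simpa using tendsto_tailWeight.abs.const_mul 2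
  have hinv : Tendsto (fun U : ℝ => 1 / U) atTop (𝓝 0) := by
    simpa using tendsto_inv_atTop_zero (𝕜 := ℝ)
  have hlim1 : Tendsto (fun U => mertensSum U - Real.log U) atTop (𝓝 (C + I)) := by
    have h := (((hzero.sub hinv).add_const C).add
      (intervalIntegral_tendsto_integral_Ioi (Real.log 2)
        (integrableOn_explicitError_mul hl) tendsto_id))
    rw [sub_zero, zero_add] at h
    refine h.congr' ?_
    filter_upwards [eventually_ge_atTop (Real.log 2)] with u hu
    rw [hC u hu]
    simp only [id]
    ring
  have hlim2 : Tendsto (fun U => mertensPartial U - Real.log U) atTop (𝓝 (C + I)) := by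
    have h0 : Tendsto (fun U => mertensPartial U - mertensSum U) atTop (𝓝 0) := by
      refine squeeze_zero_norm' (a := fun U => (Real.log 4 + 4) / U) ?_
        (tendsto_const_nhds.div_atTop tendsto_id)
      filter_upwards [eventually_gt_atTop 0] with u hu
      exact abs_mertensPartial_sub_mertensSum_le hu
    have h := h0.add hlim1
    rw [zero_add] at h
    refine h.congr fun u => ?_
    ring
  have hK := eq_eulerMascheroniConstant_of_tendsto hlim2
  have hsplit := intervalIntegral.integral_interval_add_Ioi
    (integrableOn_explicitError_mul hl) (integrableOn_explicitError_mul (hl.trans_le hU))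
  rw [hC U hU, ← hK, hI, ← hsplit]
  ring

end PartialSummation

section SigmaBound

open MeasureTheory ArithmeticFunction

lemma log_sum_range_pow_le {x : ℝ} (hx0 : 0 < x) (hx : x ≤ 1 / 2) (k : ℕ) :
    Real.log (∑ j ∈ Finset.range (k + 1), x ^ j) ≤
      ∑ i ∈ Finset.range k, x ^ (i + 1) / (i + 1) := by
  rcases Nat.eq_zero_or_pos k with rfl | hk
  · simp
  have h1 : 0 < 1 - x := by linarith
  have hp : x ^ (k + 1) < 1 := pow_lt_one₀ hx0.le (by linarith) (by omega)
  have hs : ∑ j ∈ Finset.range (k + 1), x ^ j = (1 - x ^ (k + 1)) / (1 - x) := by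
    rw [eq_div_iff h1.ne', mul_comm, mul_neg_geom_sum]
  have h := (hasSum_nat_add_iff' k).mpr
    (Real.hasSum_pow_div_log_of_abs_lt_one (x := x) (by rw [abs_lt]; constructor <;> linarith))
  have hg := (hasSum_geometric_of_lt_one hx0.le (by linarith)).mul_left (x ^ (k + 1) / 2)
  have hle := hasSum_le (fun i => ?_) h hg
  · rw [hs, Real.log_div (by linarith) h1.ne']
    have hl := Real.log_le_sub_one_of_pos (show 0 < 1 - x ^ (k + 1) by linarith)
    have hq : x ^ (k + 1) / 2 * (1 - x)⁻¹ ≤ x ^ (k + 1) := by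
      rw [← div_eq_mul_inv, div_le_iff₀ h1]
      nlinarith [pow_pos hx0 (k + 1)]
    linarith
  · have hk' : (1 : ℝ) ≤ k := by exact_mod_cast hk
    rw [show x ^ (k + 1) / 2 * x ^ i = x ^ (i + k + 1) / 2 by ring]
    push_cast
    gcongr
    linarith [(Nat.cast_nonneg i : (0 : ℝ) ≤ i)]

lemma log_sigma_div_le_sum_divisors (n : ℕ) :
    Real.log (sigma 1 n / n) ≤ ∑ d ∈ n.divisors, vonMangoldt d / (d * Real.log d) := by
  induction n using Nat.recOnPrimeCoprime with
  | zero => simp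
  | prime_pow p k hp =>
    have hp2 : (2 : ℝ) ≤ p := by exact_mod_cast hp.two_le
    have hp0 : (0 : ℝ) < p := by linarith
    have hl : 0 < Real.log p := Real.log_pos (by linarith)
    have h := log_sum_range_pow_le (x := 1 / p) (by positivity)
      (one_div_le_one_div_of_le two_pos hp2) k
    convert h using 1
    · congr 1
      rw [sigma_one_apply_prime_pow hp, ← Finset.sum_range_reflect]
      push_cast
      rw [Finset.sum_div]
      refine Finset.sum_congr rfl fun j hj => ?_
      have hj' : j ≤ k := Nat.lt_succ_iff.mp (Finset.mem_range.mp hj)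
      rw [one_div_pow, pow_sub₀ _ hp0.ne' hj']
      field_simp
    · rw [Nat.sum_divisors_prime_pow hp, Finset.sum_range_succ', pow_zero, vonMangoldt_apply_one,
        zero_div, add_zero]
      refine Finset.sum_congr rfl fun j _ => ?_
      rw [vonMangoldt_apply_pow (Nat.succ_ne_zero _), vonMangoldt_apply_prime hp, Nat.cast_pow,
        Real.log_pow, one_div_pow]
      push_cast
      field_simp
  | coprime a b ha hb hab iha ihb =>
    have hsum : ∀ m : ℕ, ∑ d ∈ m.divisors, vonMangoldt d / (d * Real.log d) =
        ∑ d ∈ m.divisors with IsPrimePow d, vonMangoldt d / (d * Real.log d) := fun m => by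
      refine (Finset.sum_filter_of_ne fun d _ hd => ?_).symm
      by_contra hc
      exact hd (by rw [vonMangoldt_eq_zero_iff.mpr hc, zero_div])
    rw [hsum] at iha ihb ⊢
    rw [Nat.mul_divisors_filter_prime_pow hab, Finset.filter_union,
      Finset.sum_union (Nat.disjoint_divisors_filter_isPrimePow hab),
      isMultiplicative_sigma.map_mul_of_coprime hab]
    push_cast
    have ha0 : (0 : ℝ) < a := by exact_mod_cast (zero_lt_one.trans ha)
    have hb0 : (0 : ℝ) < b := by exact_mod_cast (zero_lt_one.trans hb)
    have hsa : (0 : ℝ) < sigma 1 a := by exact_mod_cast sigma_pos 1 a (by omega)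
    have hsb : (0 : ℝ) < sigma 1 b := by exact_mod_cast sigma_pos 1 b (by omega)
    rw [mul_div_mul_comm, Real.log_mul (by positivity) (by positivity)]
    exact add_le_add iha ihb

lemma log_sigma_div_le {U : ℝ} (hU : 0 < U) (n : ℕ) :
    Real.log (sigma 1 n / n) ≤ mertensSum U + Real.log n / (Real.exp U * U) := by
  have hs : Summable fun d : ℕ =>
      vonMangoldt d * max (1 / (d * Real.log d) - 1 / (Real.exp U * U)) 0 := by
    refine summable_of_ne_finset_zero (s := Finset.range ⌈Real.exp U⌉₊) fun d hd => ?_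
    refine mertensSum_term_eq_zero hU ((Nat.le_ceil _).trans ?_)
    exact_mod_cast (not_lt.mp fun h' => hd (Finset.mem_range.mpr h'))
  calc Real.log (sigma 1 n / n)
      ≤ ∑ d ∈ n.divisors, vonMangoldt d / (d * Real.log d) := log_sigma_div_le_sum_divisors n
    _ ≤ ∑ d ∈ n.divisors, (vonMangoldt d * max (1 / (d * Real.log d) - 1 / (Real.exp U * U)) 0 +
          vonMangoldt d * (1 / (Real.exp U * U))) := by
        refine Finset.sum_le_sum fun d _ => ?_
        rw [← mul_add, div_eq_mul_one_div]
        refine mul_le_mul_of_nonneg_left ?_ vonMangoldt_nonneg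
        linarith [le_max_left (1 / (d * Real.log d) - 1 / (Real.exp U * U)) 0]
    _ = (∑ d ∈ n.divisors, vonMangoldt d * max (1 / (d * Real.log d) - 1 / (Real.exp U * U)) 0) +
          Real.log n / (Real.exp U * U) := by
        rw [Finset.sum_add_distrib, ← Finset.sum_mul, vonMangoldt_sum, mul_one_div]
    _ ≤ _ := by
        gcongr
        exact hs.sum_le_tsum _ fun d _ => mul_nonneg vonMangoldt_nonneg (le_max_right _ _)

end SigmaBound

section Numerics

open MeasureTheory ArithmeticFunction

/-- The error term in Mertens' second theorem. -/
noncomputable def mertensError (U : ℝ) : ℝ :=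
  explicitError U * tailWeight U - ∫ v in Set.Ioi U, explicitError v * negDerivTailWeight v

lemma tailWeight_eq {U : ℝ} (hU : 0 < U) : tailWeight U = (U + 1) / U ^ 2 := by
  rw [tailWeight]
  field_simp

lemma mertensError_le_of_forall {U a : ℝ} {g : ℝ → ℝ} (hU : 0 < U) (ha : explicitError U ≤ a)
    (hg : IntegrableOn (fun v => g v * negDerivTailWeight v) (Set.Ioi U))
    (h : ∀ v, U < v → -g v ≤ explicitError v) :
    mertensError U ≤ a * tailWeight U + ∫ v in Set.Ioi U, g v * negDerivTailWeight v := by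
  have h1 := setIntegral_mono_on hg.neg (integrableOn_explicitError_mul hU) measurableSet_Ioi
    fun v (hv : U < v) => by
      have := mul_le_mul_of_nonneg_right (h v hv) (negDerivTailWeight_nonneg (hU.trans hv))
      simpa using this
  simp only [Pi.neg_apply, integral_neg] at h1
  have h2 : explicitError U * tailWeight U ≤ a * tailWeight U := by
    refine mul_le_mul_of_nonneg_right ha ?_
    rw [tailWeight]
    positivity
  rw [mertensError]
  linarith

lemma mertensError_le {U : ℝ} (hU : 0 < U) :
    mertensError U ≤ (0.0513 + 1.9713 * Real.exp (-U)) * ((U + 1) / U ^ 2) := by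
  have h := mertensError_le_of_forall (U := U) (a := 1.92 * Real.exp (-U) +
      0.0513 / 2 * (1 + Real.exp (-U))) (g := fun _ => 0.0513 / 2 * (1 + Real.exp (-U))) hU
    ((explicitError_le hU.le).trans (by linarith [norm_zeroSum_le hU.le]))
    ((integrableOn_negDerivTailWeight hU).const_mul _) fun v hv => by
      have h1 := neg_norm_zeroSum_le_explicitError (hU.trans hv).le
      have h2 := norm_zeroSum_le (hU.trans hv).le
      have h3 : Real.exp (-v) ≤ Real.exp (-U) := Real.exp_le_exp.mpr (by linarith)
      linarith
  rw [integral_const_mul, integral_negDerivTailWeight hU, tailWeight_eq hU] at h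
  refine h.trans (le_of_eq ?_)
  ring

lemma mertensError_le' {U : ℝ} (hU : 0 < U) :
    mertensError U ≤ (0.75 / U + 1.92 * Real.exp (-U)) * ((U + 1) / U ^ 2) +
      0.75 * (1 / (2 * U ^ 2) + 2 / (3 * U ^ 3)) := by
  have hd : ∀ v ∈ Set.Ici U, HasDerivAt (fun v : ℝ => -(0.75 * (2⁻¹ * (v⁻¹) ^ 2 +
      2 / 3 * (v⁻¹) ^ 3))) (0.75 / v * negDerivTailWeight v) v := by
    intro v hv
    have hv0 : 0 < v := hU.trans_le hv
    have hi := hasDerivAt_inv hv0.ne'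
    refine ((((hi.pow 2).const_mul 2⁻¹).add ((hi.pow 3).const_mul (2 / 3))).const_mul
      0.75).neg.congr_deriv ?_
    rw [negDerivTailWeight]
    norm_num
    field_simp
    ring
  have hn : ∀ v ∈ Set.Ioi U, 0 ≤ 0.75 / v * negDerivTailWeight v := fun v hv => by
    have hv0 : 0 < v := hU.trans hv
    have := negDerivTailWeight_nonneg hv0
    positivity
  have hl : Tendsto (fun v : ℝ => -(0.75 * (2⁻¹ * (v⁻¹) ^ 2 + 2 / 3 * (v⁻¹) ^ 3))) atTop
      (𝓝 0) := by
    have hi := tendsto_inv_atTop_zero (𝕜 := ℝ)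
    have := ((((hi.pow 2).const_mul 2⁻¹).add ((hi.pow 3).const_mul (2 / 3))).const_mul 0.75).neg
    simpa using this
  have h := mertensError_le_of_forall (U := U) (a := 1.92 * Real.exp (-U) + 0.75 / U)
    (g := fun v => 0.75 / v) hU
    ((explicitError_le hU.le).trans (by linarith [norm_zeroSum_le_div hU]))
    (integrableOn_Ioi_deriv_of_nonneg' hd hn hl) fun v hv => by
      have h1 := neg_norm_zeroSum_le_explicitError (hU.trans hv).le
      have h2 := norm_zeroSum_le_div (hU.trans hv)
      linarith
  rw [integral_Ioi_of_hasDerivAt_of_nonneg' hd hn hl, tailWeight_eq hU] at h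
  refine h.trans (le_of_eq ?_)
  field_simp
  ring

lemma exp_neg_mul_add_one_le {c U : ℝ} (hc : 0 ≤ c) (hU : c ≤ U) :
    Real.exp (-U) * (U + 1) ≤ Real.exp (-c) * (c + 1) := by
  have h1 := Real.add_one_le_exp (U - c)
  have h2 : Real.exp (-c) = Real.exp (-U) * Real.exp (U - c) := by
    rw [← Real.exp_add]
    congr 1
    ring
  rw [h2, mul_assoc]
  refine mul_le_mul_of_nonneg_left ?_ (Real.exp_pos _).le
  nlinarith

lemma exp_neg_two_lt : Real.exp (-2) < 0.1354 := by
  have h := Real.exp_one_gt_d9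
  rw [Real.exp_neg, show (2 : ℝ) = 1 + 1 by norm_num, Real.exp_add,
    inv_lt_comm₀ (by positivity) (by norm_num)]
  nlinarith

lemma exp_neg_five_lt : Real.exp (-5) < 0.0068 := by
  have h := Real.exp_one_gt_d9
  rw [Real.exp_neg, show (5 : ℝ) = ((5 : ℕ) : ℝ) * 1 by norm_num, Real.exp_nat_mul,
    inv_lt_comm₀ (by positivity) (by norm_num)]
  calc (0.0068 : ℝ)⁻¹ < 2.718 ^ 5 := by norm_num
    _ ≤ Real.exp 1 ^ 5 := by gcongr; linarith

lemma mertensError_lt {U : ℝ} (hU : 2 ≤ U) : mertensError U < Real.log (1 + 1.4 / U ^ 2) := by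
  have hU0 : 0 < U := by linarith
  refine lt_of_lt_of_le ?_ (Real.le_log_one_add_of_nonneg (by positivity))
  have e : 2 * (1.4 / U ^ 2) / (1.4 / U ^ 2 + 2) = 2.8 / (2 + 1.4 / U ^ 2) / U ^ 2 := by
    field_simp
    ring
  rw [e]
  have hU2 : 0 < U ^ 2 := by positivity
  rcases le_total U 20 with h | h
  · refine (mertensError_le hU0).trans_lt ?_
    rw [← mul_div_assoc, div_lt_div_iff_of_pos_right hU2, lt_div_iff₀ (by positivity)]
    have key : ∀ a b : ℝ, a ≤ U → U ≤ b → 0 < a →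
        (0.0513 * (b + 1) + 1.9713 * (Real.exp (-a) * (a + 1))) * (2 + 1.4 / a ^ 2) < 2.8 →
        (0.0513 + 1.9713 * Real.exp (-U)) * (U + 1) * (2 + 1.4 / U ^ 2) < 2.8 := by
      intro a b ha hb ha0 hlt
      refine lt_of_le_of_lt ?_ hlt
      have h1 := exp_neg_mul_add_one_le ha0.le ha
      have h2 := Real.exp_pos (-U)
      have h3 : (0.0513 + 1.9713 * Real.exp (-U)) * (U + 1) ≤
          0.0513 * (b + 1) + 1.9713 * (Real.exp (-a) * (a + 1)) := by linarith
      have h4 := Real.exp_pos (-a)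
      have h5 : 0 ≤ b := by linarith
      gcongr
    rcases le_total U 5 with h5 | h5
    · refine key 2 5 hU h5 (by norm_num) ?_
      linarith [exp_neg_two_lt]
    · refine key 5 20 h5 h (by norm_num) ?_
      linarith [exp_neg_five_lt]
  · refine (mertensError_le' hU0).trans_lt ?_
    rw [lt_div_iff₀ hU2, lt_div_iff₀ (by positivity)]
    have h1 := exp_neg_mul_add_one_le (c := 5) (by norm_num) (show (5 : ℝ) ≤ U by linarith)
    have h2 := exp_neg_five_lt
    have e : ((0.75 / U + 1.92 * Real.exp (-U)) * ((U + 1) / U ^ 2) +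
        0.75 * (1 / (2 * U ^ 2) + 2 / (3 * U ^ 3))) * U ^ 2 =
        1.125 + 1.25 * (1 / U) + 1.92 * (Real.exp (-U) * (U + 1)) := by
      field_simp
      ring
    rw [e]
    have h3 : 1 / U ≤ 1 / 20 := one_div_le_one_div_of_le (by norm_num) h
    have h4 : 1.4 / U ^ 2 ≤ 1.4 / 20 ^ 2 := by gcongr
    have h5 : 1.125 + 1.25 * (1 / U) + 1.92 * (Real.exp (-U) * (U + 1)) ≤ 1.3 := by linarith
    have h6 : 0 < 1.4 / U ^ 2 := by positivity
    nlinarith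

lemma exp_eulerMascheroniConstant_mul_lt :
    Real.exp Real.eulerMascheroniConstant * 1.4 < 2.50637 := by
  have h1 : Real.exp Real.eulerMascheroniConstant < Real.exp 0.58 :=
    Real.exp_lt_exp.mpr eulerMascheroniConstant_lt
  have h2 := Real.exp_bound' (x := 0.58) (by norm_num) (by norm_num) (n := 6) (by norm_num)
  norm_num [Finset.sum_range_succ, Nat.factorial] at h2
  rw [show (0.58 : ℝ) = 29 / 50 by norm_num] at h1
  linarith

lemma mertensSum_log_eight_le :
    mertensSum (Real.log 8) ≤ 1.302 - 1 / 3 := by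
  have hl := log_two_pos
  have h8 : Real.log 8 = 3 * Real.log 2 := by
    rw [show (8 : ℝ) = 2 ^ 3 by norm_num, Real.log_pow]
    norm_num
  have h4 : Real.log 4 = 2 * Real.log 2 := by
    rw [show (4 : ℝ) = 2 ^ 2 by norm_num, Real.log_pow]
    norm_num
  have hL8 : 0 < Real.log 8 := by linarith
  have hL4 : vonMangoldt 4 = Real.log 2 := by
    rw [show 4 = 2 ^ 2 by norm_num, vonMangoldt_apply_pow two_ne_zero,
      vonMangoldt_apply_prime Nat.prime_two]
    norm_num
  have hL6 : vonMangoldt 6 = 0 := vonMangoldt_eq_zero_iff.mpr (by decide)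
  have hmax : ∀ n : ℕ, 0 < n → n ≤ 8 → Real.log n > 0 →
      max (1 / (n * Real.log n) - 1 / (Real.exp (Real.log 8) * Real.log 8)) 0 =
        1 / (n * Real.log n) - 1 / (8 * Real.log 8) := by
    intro n hn0 hn hln
    rw [Real.exp_log (by norm_num), max_eq_left]
    rw [sub_nonneg]
    have hn' : (n : ℝ) ≤ 8 := by exact_mod_cast hn
    have hn0' : (0 : ℝ) < n := by exact_mod_cast hn0
    have := Real.log_le_log hn0' hn'
    gcongr
  rw [mertensSum_eq_sum hL8 (N := 8) (by rw [Real.exp_log] <;> norm_num)]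
  have h3 : 0 < Real.log 3 := Real.log_pos (by norm_num)
  have h5 : 0 < Real.log 5 := Real.log_pos (by norm_num)
  have h7 : 0 < Real.log 7 := Real.log_pos (by norm_num)
  simp only [Finset.sum_range_succ, Finset.sum_range_zero, hL6, hL4,
    vonMangoldt_eq_zero_of_lt_two (show 0 < 2 by norm_num),
    vonMangoldt_eq_zero_of_lt_two (show 1 < 2 by norm_num), vonMangoldt_apply_prime Nat.prime_two,
    vonMangoldt_apply_prime Nat.prime_three, vonMangoldt_apply_prime Nat.prime_five,
    vonMangoldt_apply_prime (show Nat.Prime 7 by norm_num), zero_mul, zero_add, add_zero]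
  rw [hmax 2 (by norm_num) (by norm_num) (by simpa using hl),
    hmax 3 (by norm_num) (by norm_num) (by simpa using h3),
    hmax 4 (by norm_num) (by norm_num) (by simp only [Nat.cast_ofNat]; linarith),
    hmax 5 (by norm_num) (by norm_num) (by simpa using h5),
    hmax 7 (by norm_num) (by norm_num) (by simpa using h7)]
  have hlog : 8 * Real.log 2 ≤
      Real.log 2 + Real.log 3 + Real.log 2 + Real.log 5 + Real.log 7 := by
    rw [← Real.log_mul (by norm_num) (by norm_num), ← Real.log_mul (by norm_num) (by norm_num),
      ← Real.log_mul (by norm_num) (by norm_num), ← Real.log_mul (by norm_num) (by norm_num)]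
    have : (8 : ℝ) * Real.log 2 = Real.log (2 ^ 8) := by rw [Real.log_pow]; norm_num
    rw [this]
    exact Real.log_le_log (by norm_num) (by norm_num)
  have hmul := mul_le_mul_of_nonneg_right hlog
    (show 0 ≤ 1 / (8 * Real.log 8) by positivity)
  have hthird : 8 * Real.log 2 * (1 / (8 * Real.log 8)) = 1 / 3 := by
    rw [h8]
    field_simp
  have e : ∀ m l : ℝ, 0 < l → l * (1 / (m * l) - 1 / (8 * Real.log 8)) =
      1 / m - l * (1 / (8 * Real.log 8)) := by
    intro m l hl'
    field_simp
  have e4 : Real.log 2 * (1 / (4 * Real.log 4) - 1 / (8 * Real.log 8)) =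
      1 / 8 - Real.log 2 * (1 / (8 * Real.log 8)) := by
    rw [h4]
    field_simp
    ring
  push_cast
  rw [e _ _ hl, e _ _ h3, e4, e _ _ h5, e _ _ h7]
  linarith

lemma exp_two_lt : Real.exp 2 < 7.3891 := by
  have h := Real.exp_one_lt_d9
  have h0 := Real.exp_pos 1
  rw [show (2 : ℝ) = 1 + 1 by norm_num, Real.exp_add]
  nlinarith

lemma sigma_div_lt_of_log_le {n : ℕ} (hn : n ≠ 0) (h : Real.log n ≤ Real.exp 2) :
    (sigma 1 n : ℝ) / n < 4.2 := by
  have hl := Real.log_two_gt_d9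
  have h8 : Real.log 8 = 3 * Real.log 2 := by
    rw [show (8 : ℝ) = 2 ^ 3 by norm_num, Real.log_pow]
    norm_num
  have hn0 : (0 : ℝ) < n := by exact_mod_cast Nat.pos_of_ne_zero hn
  have hs0 : (0 : ℝ) < sigma 1 n := by exact_mod_cast sigma_pos 1 n hn
  have h1 := log_sigma_div_le (U := Real.log 8) (by linarith) n
  have h2 := mertensSum_log_eight_le
  have h3 : Real.log n / (Real.exp (Real.log 8) * Real.log 8) ≤ 0.445 := by
    rw [Real.exp_log (by norm_num), div_le_iff₀ (by linarith)]
    linarith [exp_two_lt]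
  have h4 : Real.log (sigma 1 n / n) ≤ 1.42 := by linarith
  rw [Real.log_le_iff_le_exp (by positivity)] at h4
  refine h4.trans_lt ?_
  have h5 := Real.exp_bound' (x := 0.42) (by norm_num) (by norm_num) (n := 4) (by norm_num)
  norm_num [Finset.sum_range_succ, Nat.factorial] at h5
  have h6 := Real.exp_one_lt_d9
  rw [show (1.42 : ℝ) = 1 + 21 / 50 by norm_num, Real.exp_add]
  have h7 := Real.exp_pos 1
  nlinarith

lemma le_exp_eulerMascheroniConstant : 1.763 ≤ Real.exp Real.eulerMascheroniConstant := by
  have h := Real.sum_le_exp_of_nonneg (x := 0.57) (by norm_num) 4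
  norm_num [Finset.sum_range_succ, Nat.factorial] at h
  have h1 : Real.exp 0.57 ≤ Real.exp Real.eulerMascheroniConstant :=
    Real.exp_le_exp.mpr lt_eulerMascheroniConstant.le
  rw [show (0.57 : ℝ) = 57 / 100 by norm_num] at h1
  linarith

end Numerics

/-- Rosser–Schoenfeld (1962): for every integer `n ≥ 3`,
`σ(n) < e^γ n log log n + 2.50637 n / log log n`. -/
theorem rosser_schoenfeld_sigma_bound (n : ℕ) (hn : 3 ≤ n) :
    (ArithmeticFunction.sigma 1 n : ℝ) <
      Real.exp Real.eulerMascheroniConstant * n * Real.log (Real.log n) +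
        2.50637 * n / Real.log (Real.log n) := by
  have hn3 : (3 : ℝ) ≤ n := by exact_mod_cast hn
  have hn0 : (0 : ℝ) < n := by linarith
  have hlog : 1 < Real.log n := by
    rw [Real.lt_log_iff_exp_lt hn0]
    linarith [Real.exp_one_lt_d9]
  set U := Real.log (Real.log n) with hU
  have hU0 : 0 < U := Real.log_pos hlog
  have hexpU : Real.exp U = Real.log n := Real.exp_log (by linarith)
  set a := Real.exp Real.eulerMascheroniConstant with ha
  have ha0 : 0 < a := Real.exp_pos _
  suffices h : (ArithmeticFunction.sigma 1 n : ℝ) / n < a * U + 2.50637 / U by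
    rw [div_lt_iff₀ hn0] at h
    refine h.trans_le (le_of_eq ?_)
    ring
  rcases le_total U 2 with h2 | h2
  · refine (sigma_div_lt_of_log_le (by omega) ?_).trans_le ?_
    · rw [← hexpU]
      exact Real.exp_le_exp.mpr h2
    · rw [← sub_nonneg, show a * U + 2.50637 / U - 4.2 = (a * U ^ 2 + 2.50637 - 4.2 * U) / U by
        field_simp]
      refine div_nonneg ?_ hU0.le
      nlinarith [le_exp_eulerMascheroniConstant, sq_nonneg (U - 2.1 / 1.763), sq_nonneg U]
  · have hs0 : (0 : ℝ) < ArithmeticFunction.sigma 1 n := by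
      exact_mod_cast ArithmeticFunction.sigma_pos 1 n (by omega)
    have h1 := log_sigma_div_le hU0 n
    have h3 := mertensSum_eq (show Real.log 2 ≤ U by linarith [Real.log_two_lt_d9])
    have h4 := mertensError_lt h2
    rw [mertensError] at h4
    rw [hexpU, ← div_div, div_self (by linarith)] at h1
    have h5 : Real.log (ArithmeticFunction.sigma 1 n / n) <
        Real.log (a * U * (1 + 1.4 / U ^ 2)) := by
      rw [Real.log_mul (by positivity) (by positivity), Real.log_mul ha0.ne' hU0.ne', ha,
        Real.log_exp]
      linarith
    have h6 := (Real.log_lt_log_iff (by positivity) (by positivity)).mp h5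
    refine h6.trans ?_
    have h7 : a * 1.4 < 2.50637 := exp_eulerMascheroniConstant_mul_lt
    have h8 : a * U * (1 + 1.4 / U ^ 2) = a * U + a * 1.4 / U := by field_simp
    rw [h8]
    gcongr
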